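/- Let (p_t(x,·)) be an affine family of transition kernels on K with associated functions φ and ψ, and suppose that for every u ∈ K* the derivatives F(u) := ∂_t φ(t,u)|_{t=0} and R(u) := ∂_t ψ(t,u)|_{t=0} exist. Then, for any truncation function χ, F is of form (F) for some parameters (b,c,m) and R is of form (R) for some parameters (Q,Bᵀ,γ,M). -/

import Mathlib

open MeasureTheory Filter Set
open scoped RealInnerProductSpace ENNReal Topology

variable {V : Type*} [NormedAddCommGroup V] [InnerProductSpace ℝ V] [FiniteDimensional ℝ V]
  [MeasurableSpace V] [BorelSpace V]

/-- The closed dual cone of a set `K`. -/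
def dualCone (K : Set V) : Set V := {u | ∀ x ∈ K, 0 ≤ ⟪x, u⟫}

/-- `K` is a proper (pointed) generating closed convex cone. -/
structure IsProperConvexCone (K : Set V) : Prop where
  isClosed : IsClosed K
  convex : Convex ℝ K
  smul_mem : ∀ (c : ℝ), 0 ≤ c → ∀ x ∈ K, c • x ∈ K
  proper : K ∩ (-K) = {0}
  generating : ∀ v : V, ∃ x ∈ K, ∃ y ∈ K, v = x - y

/-- An affine family of transition kernels on the cone `K`, with associated
functions `φ` and `ψ`. -/
structure AffineTransitionFamily (K : Set V) (φ : ℝ → V → ℝ) (ψ : ℝ → V → V) where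
  p : ℝ → V → Measure V
  measurable_p : ∀ t : ℝ, 0 ≤ t → ∀ A : Set V, MeasurableSet A →
      Measurable fun x => p t x A
  subprob : ∀ t : ℝ, 0 ≤ t → ∀ x ∈ K, p t x Set.univ ≤ 1
  supported : ∀ t : ℝ, 0 ≤ t → ∀ x ∈ K, p t x Kᶜ = 0
  init : ∀ x ∈ K, p 0 x = Measure.dirac x
  chapman : ∀ s t : ℝ, 0 ≤ s → 0 ≤ t → ∀ x ∈ K, ∀ A : Set V, MeasurableSet A →
      p (t + s) x A = ∫⁻ ξ, p t ξ A ∂(p s x)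
  weakCont : ∀ x ∈ K, ∀ f : BoundedContinuousFunction V ℝ,
      ContinuousOn (fun s => ∫ ξ, f ξ ∂(p s x)) (Set.Ici (0 : ℝ))
  laplace : ∀ t : ℝ, 0 ≤ t → ∀ u ∈ dualCone K, ∀ x ∈ K,
      ∫ ξ, Real.exp (-⟪u, ξ⟫) ∂(p t x) = Real.exp (-(φ t u) - ⟪ψ t u, x⟫)

/-- `χ` is a truncation function: continuous, bounded in norm by `1`, and equal to
the identity on a neighborhood of the origin. -/
def IsTruncation {V : Type*} [NormedAddCommGroup V] (χ : V → V) : Prop :=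
  Continuous χ ∧ (∀ ξ : V, ‖χ ξ‖ ≤ 1) ∧ ∀ᶠ ξ in nhds (0 : V), χ ξ = ξ

/-- Parameters witnessing that `F` is of form (F). -/
structure FParams {V : Type*} [NormedAddCommGroup V] [InnerProductSpace ℝ V]
    [MeasurableSpace V] (K : Set V) (F : V → ℝ) where
  b : V
  b_mem : b ∈ K
  c : ℝ
  c_nonneg : 0 ≤ c
  m : Measure V
  m_supp : m Kᶜ = 0
  m_zero : m {0} = 0
  m_int : (∫⁻ ξ, ENNReal.ofReal (min ‖ξ‖ 1) ∂m) < ⊤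
  eq : ∀ u ∈ dualCone K, F u = ⟪b, u⟫ + c - ∫ ξ, (Real.exp (-⟪u, ξ⟫) - 1) ∂m

/-- Parameters witnessing that `R` is of form (R) relative to the truncation
function `χ`. -/
structure RParams {V : Type*} [NormedAddCommGroup V] [InnerProductSpace ℝ V]
    [MeasurableSpace V] (K : Set V) (χ : V → V) (R : V → V) where
  Q : V →ₗ[ℝ] V →ₗ[ℝ] V
  Q_symm : ∀ u v : V, Q u v = Q v u
  Q_pos : ∀ v : V, Q v v ∈ dualCone K
  B : V →ₗ[ℝ] V
  γ : V
  γ_mem : γ ∈ dualCone K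
  M : V → Measure V
  M_sigma : ∀ x ∈ K, SigmaFinite (M x)
  M_add : ∀ x ∈ K, ∀ y ∈ K, M (x + y) = M x + M y
  M_smul : ∀ (c : ℝ), 0 ≤ c → ∀ x ∈ K, M (c • x) = ENNReal.ofReal c • M x
  M_supp : ∀ x ∈ K, M x Kᶜ = 0
  M_zero : ∀ x ∈ K, M x {0} = 0
  M_int : ∀ x ∈ K, (∫⁻ ξ, ENNReal.ofReal (min (‖ξ‖ ^ 2) 1) ∂(M x)) < ⊤
  eq : ∀ u ∈ dualCone K, ∀ x ∈ K,
    ⟪R u, x⟫ = -(1/2) * ⟪Q u u, x⟫ + ⟪B u, x⟫ + ⟪γ, x⟫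
      - ∫ ξ, (Real.exp (-⟪u, ξ⟫) - 1 + ⟪χ ξ, u⟫) ∂(M x)

/-- The parameters of form (R) are admissible. -/
def RParams.Admissible {V : Type*} [NormedAddCommGroup V] [InnerProductSpace ℝ V]
    [MeasurableSpace V] {K : Set V} {χ : V → V} {R : V → V}
    (P : RParams K χ R) : Prop :=
  ∀ u ∈ dualCone K, ∀ x ∈ K, ⟪u, x⟫ = 0 →
    (∀ v : V, ⟪P.Q u v, x⟫ = 0) ∧
    Integrable (fun ξ => ⟪χ ξ, u⟫) (P.M x) ∧
    0 ≤ ⟪P.B u, x⟫ - ∫ ξ, ⟪χ ξ, u⟫ ∂(P.M x)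

section ConeLemmas

variable {K : Set V}

set_option linter.unusedSectionVars false
set_option linter.unusedVariables false

theorem cone_zero_mem (hK : IsProperConvexCone K) : (0 : V) ∈ K := by
  have : (0 : V) ∈ K ∩ (-K) := by rw [hK.proper]; simp
  exact this.1

theorem cone_add_mem (hK : IsProperConvexCone K) {x y : V} (hx : x ∈ K) (hy : y ∈ K) :
    x + y ∈ K := by
  have h := hK.convex hx hy (by norm_num : (0:ℝ) ≤ 1/2) (by norm_num : (0:ℝ) ≤ 1/2) (by norm_num)
  have := hK.smul_mem 2 (by norm_num) _ h
  rw [smul_add, smul_smul, smul_smul] at this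
  norm_num at this
  exact this

theorem dual_zero_mem : (0 : V) ∈ dualCone K := fun x _ => by simp

theorem dual_add_mem {u v : V} (hu : u ∈ dualCone K) (hv : v ∈ dualCone K) :
    u + v ∈ dualCone K := fun x hx => by
  rw [inner_add_right]; exact add_nonneg (hu x hx) (hv x hx)

theorem dual_smul_mem {u : V} {c : ℝ} (hc : 0 ≤ c) (hu : u ∈ dualCone K) :
    c • u ∈ dualCone K := fun x hx => by
  rw [inner_smul_right]; exact mul_nonneg hc (hu x hx)

theorem dual_nonneg {u x : V} (hu : u ∈ dualCone K) (hx : x ∈ K) : 0 ≤ ⟪u, x⟫ := by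
  rw [real_inner_comm]; exact hu x hx

theorem dual_convex : Convex ℝ (dualCone K) := fun u hu v hv a c ha hc _ =>
  dual_add_mem (dual_smul_mem ha hu) (dual_smul_mem hc hv)

theorem inner_ext_cone (hK : IsProperConvexCone K) {u v : V} (h : ∀ x ∈ K, ⟪u, x⟫ = ⟪v, x⟫) :
    u = v := by
  refine ext_inner_right ℝ fun w => ?_
  obtain ⟨x, hx, y, hy, rfl⟩ := hK.generating w
  rw [inner_sub_right, inner_sub_right, h x hx, h y hy]

theorem bidual (hK : IsProperConvexCone K) {w : V}
    (h : ∀ u ∈ dualCone K, 0 ≤ ⟪w, u⟫) : w ∈ K := by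
  let C : ProperCone ℝ V :=
    { carrier := K
      add_mem' := fun hx hy => cone_add_mem hK hx hy
      zero_mem' := cone_zero_mem hK
      smul_mem' := fun c x hx => hK.smul_mem c c.2 x hx
      isClosed' := hK.isClosed }
  have : CompleteSpace V := FiniteDimensional.complete ℝ V
  by_contra hw
  obtain ⟨f, hf, hf'⟩ := ProperCone.hyperplane_separation' C (x₀ := w) hw
  have := h f (fun x hx => hf x hx)
  exact absurd this (not_le.2 hf')

/-- strictly positive functionals -/
def sPos (K : Set V) : Set V := {u | ∃ ε > 0, ∀ ξ ∈ K, ε * ‖ξ‖ ≤ ⟪u, ξ⟫}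

theorem sPos_subset : sPos K ⊆ dualCone K := by
  rintro u ⟨ε, hε, h⟩ ξ hξ
  rw [real_inner_comm]
  exact le_trans (by positivity) (h ξ hξ)

theorem sPos_add {u v : V} (hu : u ∈ sPos K) (hv : v ∈ dualCone K) : u + v ∈ sPos K := by
  obtain ⟨ε, hε, h⟩ := hu
  refine ⟨ε, hε, fun ξ hξ => ?_⟩
  rw [inner_add_left]
  have := dual_nonneg hv hξ
  have := h ξ hξ
  linarith

theorem sPos_smul {u : V} {c : ℝ} (hc : 0 < c) (hu : u ∈ sPos K) : c • u ∈ sPos K := by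
  obtain ⟨ε, hε, h⟩ := hu
  refine ⟨c * ε, by positivity, fun ξ hξ => ?_⟩
  rw [real_inner_smul_left, mul_assoc]
  exact mul_le_mul_of_nonneg_left (h ξ hξ) hc.le

theorem sPos_ball {u : V} (hu : u ∈ sPos K) : ∃ δ > 0, ∀ v, ‖v - u‖ ≤ δ → v ∈ sPos K := by
  obtain ⟨ε, hε, h⟩ := hu
  refine ⟨ε / 2, by positivity, fun v hv => ⟨ε / 2, by positivity, fun ξ hξ => ?_⟩⟩
  have h1 := h ξ hξ
  have h2 : |⟪v - u, ξ⟫| ≤ ‖v - u‖ * ‖ξ‖ := abs_real_inner_le_norm _ _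
  have h3 : ‖v - u‖ * ‖ξ‖ ≤ ε / 2 * ‖ξ‖ := by gcongr
  have h4 : ⟪v, ξ⟫ = ⟪u, ξ⟫ + ⟪v - u, ξ⟫ := by rw [← inner_add_left]; congr 1; abel
  have := neg_abs_le ⟪v - u, ξ⟫
  linarith

theorem sPos_isOpen : IsOpen (sPos K) := by
  rw [Metric.isOpen_iff]
  intro u hu
  obtain ⟨δ, hδ, h⟩ := sPos_ball hu
  exact ⟨δ, hδ, fun v hv => h v (by rw [Metric.mem_ball, dist_eq_norm] at hv; exact hv.le)⟩

theorem sPos_convex : Convex ℝ (sPos K) := by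
  intro u hu v hv a c ha hc hac
  rcases ha.eq_or_lt with rfl | ha'
  · have : c = 1 := by linarith
    subst this; simpa using hv
  · exact sPos_add (sPos_smul ha' hu) (dual_smul_mem hc (sPos_subset hv))

theorem basis_inner {ι : Type*} [Fintype ι] (B : Module.Basis ι ℝ V) (u y : V) :
    ⟪u, y⟫ = ∑ i, B.repr u i * ⟪B i, y⟫ := by
  conv_lhs => rw [← B.sum_repr u]
  simp only [sum_inner, real_inner_smul_left]

theorem basis_inner_zero {ι : Type*} [Fintype ι] (B : Module.Basis ι ℝ V) {y : V}
    (h : ∀ i, ⟪B i, y⟫ = 0) : y = 0 := by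
  rw [← inner_self_eq_zero (𝕜 := ℝ), basis_inner B]
  simp [h]

theorem sPos_nonempty (hK : IsProperConvexCone K) : (sPos K).Nonempty := by
  have : ProperSpace V := FiniteDimensional.proper ℝ V
  have hspan : ⊤ ≤ Submodule.span ℝ (dualCone K) := by
    rw [top_le_iff, ← Submodule.orthogonal_eq_bot_iff, Submodule.eq_bot_iff]
    intro w hw
    rw [Submodule.mem_orthogonal] at hw
    have h0 : ∀ u ∈ dualCone K, ⟪u, w⟫ = 0 := fun u hu => hw u (Submodule.subset_span hu)
    have h1 : w ∈ K := bidual hK fun u hu => by rw [real_inner_comm, h0 u hu]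
    have h2 : -w ∈ K := bidual hK fun u hu => by
      rw [real_inner_comm, inner_neg_right, h0 u hu]; simp
    have : w ∈ K ∩ (-K) := ⟨h1, h2⟩
    rw [hK.proper] at this
    exact this
  let B := Module.Basis.ofSpan hspan
  have hB : ∀ i, B i ∈ dualCone K := fun i => Module.Basis.ofSpan_subset hspan ⟨i, rfl⟩
  have : Fintype _ := Module.Basis.fintypeIndexOfRankLtAleph0 B (Module.rank_lt_aleph0 ℝ V)
  let u := ∑ i, B i
  have hu : u ∈ dualCone K := fun x hx => by
    simp only [u, inner_sum]
    exact Finset.sum_nonneg fun i _ => hB i x hx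
  have hpos : ∀ ξ ∈ K, ξ ≠ 0 → 0 < ⟪u, ξ⟫ := by
    intro ξ hξ hne
    refine lt_of_le_of_ne (dual_nonneg hu hξ) fun h => hne ?_
    simp only [u, sum_inner] at h
    have h2 := (Finset.sum_eq_zero_iff_of_nonneg (fun i _ => dual_nonneg (hB i) hξ)).1 h.symm
    exact basis_inner_zero B fun i => h2 i (Finset.mem_univ _)
  have hcomp : IsCompact (K ∩ Metric.sphere (0:V) 1) :=
    (isCompact_sphere (0:V) 1).inter_left hK.isClosed
  rcases (K ∩ Metric.sphere (0:V) 1).eq_empty_or_nonempty with he | hne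
  · refine ⟨u, 1, one_pos, fun ξ hξ => ?_⟩
    by_cases h0 : ξ = 0
    · simp [h0]
    · exfalso
      have : ‖ξ‖⁻¹ • ξ ∈ K ∩ Metric.sphere (0:V) 1 :=
        ⟨hK.smul_mem _ (by positivity) _ hξ, by
          simp [norm_smul, norm_ne_zero_iff.2 h0]⟩
      rw [he] at this; exact this
  · obtain ⟨z, hz, hmin⟩ := hcomp.exists_isMinOn hne
      (f := fun ξ => ⟪u, ξ⟫) (by fun_prop)
    have hz0 : z ≠ 0 := by rintro rfl; simpa using hz.2
    refine ⟨u, ⟪u, z⟫, hpos z hz.1 hz0, fun ξ hξ => ?_⟩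
    by_cases h0 : ξ = 0
    · simp [h0]
    · have hm : ‖ξ‖⁻¹ • ξ ∈ K ∩ Metric.sphere (0:V) 1 :=
        ⟨hK.smul_mem _ (by positivity) _ hξ, by
          simp [norm_smul, norm_ne_zero_iff.2 h0]⟩
      have h1 : ⟪u, z⟫ ≤ ⟪u, ‖ξ‖⁻¹ • ξ⟫ := hmin hm
      rw [inner_smul_right] at h1
      have hn : 0 < ‖ξ‖ := norm_pos_iff.2 h0
      calc ⟪u, z⟫ * ‖ξ‖ ≤ (‖ξ‖⁻¹ * ⟪u, ξ⟫) * ‖ξ‖ := by gcongr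
        _ = ⟪u, ξ⟫ := by field_simp

theorem exists_basis_sPos (hK : IsProperConvexCone K) :
    ∃ (n : ℕ) (B : Module.Basis (Fin n) ℝ V), ∀ i, B i ∈ sPos K := by
  obtain ⟨u, hu⟩ := sPos_nonempty hK
  have hspan : ⊤ ≤ Submodule.span ℝ (sPos K) := by
    intro v _
    obtain ⟨δ, hδ, h⟩ := sPos_ball hu
    by_cases hv : v = 0
    · rw [hv]; exact Submodule.zero_mem _
    have hn : 0 < ‖v‖ := norm_pos_iff.2 hv
    have h1 : u + (δ / ‖v‖) • v ∈ sPos K := h _ (by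
      rw [add_sub_cancel_left, norm_smul, Real.norm_of_nonneg (by positivity)]
      rw [div_mul_cancel₀ _ hn.ne'])
    have h2 : v = (δ / ‖v‖)⁻¹ • ((u + (δ / ‖v‖) • v) - u) := by
      rw [add_sub_cancel_left, smul_smul, inv_mul_cancel₀ (by positivity), one_smul]
    rw [h2]
    exact Submodule.smul_mem _ _ (Submodule.sub_mem _ (Submodule.subset_span h1)
      (Submodule.subset_span hu))
  let B := Module.Basis.ofSpan hspan
  have : Fintype _ := Module.Basis.fintypeIndexOfRankLtAleph0 B (Module.rank_lt_aleph0 ℝ V)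
  have hB : ∀ i, B i ∈ sPos K := fun i => Module.Basis.ofSpan_subset hspan ⟨i, rfl⟩
  exact ⟨_, B.reindex (Fintype.equivFin _), fun i => by simpa using hB _⟩

end ConeLemmas

section Analytic

set_option linter.unusedSectionVars false
set_option linter.unusedVariables false

open Asymptotics

variable {K : Set V} {n : ℕ}

/-- the shifted cone -/
def shift (K : Set V) (x : V) : Set V := {y | y + x ∈ K}

noncomputable def th (B : Module.Basis (Fin n) ℝ V) (i : Fin n) (y : V) : ℝ := 1 - Real.exp (-⟪B i, y⟫)

noncomputable def hh (B : Module.Basis (Fin n) ℝ V) (y : V) : ℝ := ∑ i, th B i y ^ 2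

noncomputable def ta (B : Module.Basis (Fin n) ℝ V) (i : Fin n) (y : V) : ℝ :=
  2 * th B i y - 1 / 2 * (1 - Real.exp (-⟪(2:ℝ) • B i, y⟫))

theorem shift_closed (hK : IsProperConvexCone K) (x : V) : IsClosed (shift K x) :=
  hK.isClosed.preimage (f := fun y => y + x) (by fun_prop)

theorem th_cont (B : Module.Basis (Fin n) ℝ V) (i : Fin n) : Continuous (th B i) := by
  unfold th; fun_prop

theorem hh_cont (B : Module.Basis (Fin n) ℝ V) : Continuous (hh B) := by
  unfold hh; have := th_cont B; fun_prop

theorem ta_cont (B : Module.Basis (Fin n) ℝ V) (i : Fin n) : Continuous (ta B i) := by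
  unfold ta; have := th_cont B; fun_prop

theorem hh_nonneg (B : Module.Basis (Fin n) ℝ V) (y : V) : 0 ≤ hh B y :=
  Finset.sum_nonneg fun i _ => sq_nonneg _

theorem th_zero (B : Module.Basis (Fin n) ℝ V) (i : Fin n) : th B i 0 = 0 := by simp [th]

theorem ta_zero (B : Module.Basis (Fin n) ℝ V) (i : Fin n) : ta B i 0 = 0 := by simp [ta, th]

theorem hh_zero (B : Module.Basis (Fin n) ℝ V) : hh B 0 = 0 := by simp [hh, th_zero]

theorem ta_eq (B : Module.Basis (Fin n) ℝ V) (i : Fin n) (y : V) :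
    ta B i y = th B i y + 1 / 2 * th B i y ^ 2 := by
  unfold ta th
  rw [real_inner_smul_left, show -(2 * ⟪B i, y⟫) = -⟪B i, y⟫ + -⟪B i, y⟫ by ring, Real.exp_add]
  ring

theorem hh_pos (B : Module.Basis (Fin n) ℝ V) {y : V} (hy : y ≠ 0) : 0 < hh B y := by
  refine lt_of_le_of_ne (hh_nonneg B y) fun h => hy (basis_inner_zero B fun i => ?_)
  have h2 := (Finset.sum_eq_zero_iff_of_nonneg (fun i _ => sq_nonneg (th B i y))).1 h.symm i
    (Finset.mem_univ _)
  have h3 : th B i y = 0 := by simpa using h2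
  unfold th at h3
  have : Real.exp (-⟪B i, y⟫) = 1 := by linarith
  rw [Real.exp_eq_one_iff] at this
  linarith

theorem exp_le_shift {u x y : V} (hu : u ∈ dualCone K) (hy : y ∈ shift K x) :
    Real.exp (-⟪u, y⟫) ≤ Real.exp ⟪u, x⟫ := by
  apply Real.exp_le_exp.2
  have h := dual_nonneg hu hy
  rw [inner_add_right] at h
  linarith

theorem th_bound (B : Module.Basis (Fin n) ℝ V) (hB : ∀ i, B i ∈ sPos K) (x : V) (i : Fin n) :
    ∃ C, ∀ y ∈ shift K x, |th B i y| ≤ C := by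
  refine ⟨1 + Real.exp ⟪B i, x⟫, fun y hy => ?_⟩
  have := exp_le_shift (sPos_subset (hB i)) hy
  have h2 := Real.exp_pos (-⟪B i, y⟫)
  unfold th
  rw [abs_le]; constructor <;> linarith

theorem hh_bound (B : Module.Basis (Fin n) ℝ V) (hB : ∀ i, B i ∈ sPos K) (x : V) :
    ∃ C, ∀ y ∈ shift K x, |hh B y| ≤ C := by
  choose C hC using th_bound B hB x
  refine ⟨∑ i, C i ^ 2, fun y hy => ?_⟩
  rw [abs_of_nonneg (hh_nonneg B y)]
  refine Finset.sum_le_sum fun i _ => ?_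
  rw [← sq_abs]
  gcongr
  exact hC i y hy

theorem ta_bound (B : Module.Basis (Fin n) ℝ V) (hB : ∀ i, B i ∈ sPos K) (x : V) (i : Fin n) :
    ∃ C, ∀ y ∈ shift K x, |ta B i y| ≤ C := by
  obtain ⟨C, hC⟩ := th_bound B hB x i
  refine ⟨C + 1 / 2 * C ^ 2, fun y hy => ?_⟩
  rw [ta_eq]
  have h1 := hC y hy
  have h2 : th B i y ^ 2 ≤ C ^ 2 := by rw [← sq_abs]; gcongr
  calc |th B i y + 1 / 2 * th B i y ^ 2| ≤ |th B i y| + |1 / 2 * th B i y ^ 2| := abs_add_le _ _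
    _ = |th B i y| + 1 / 2 * th B i y ^ 2 := by rw [abs_of_nonneg (a := 1 / 2 * _) (by positivity)]
    _ ≤ _ := by linarith

/-- lower bound of `th` near zero -/
theorem abs_one_sub_exp {a : ℝ} (ha : |a| ≤ 1 / 2) : |a| / 2 ≤ |1 - Real.exp (-a)| := by
  have h := Real.abs_exp_sub_one_sub_id_le (x := -a) (by rw [abs_neg]; linarith)
  have h1 : |a| ≤ |1 - Real.exp (-a)| + |Real.exp (-a) - 1 - -a| := by
    calc |a| = |(1 - Real.exp (-a)) + (Real.exp (-a) - 1 - -a)| := by congr 1; ring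
      _ ≤ _ := abs_add_le _ _
  have h2 : (-a) ^ 2 ≤ |a| / 2 := by
    rw [neg_sq, ← sq_abs]; nlinarith [abs_nonneg a]
  linarith

theorem basis_sq_lower (B : Module.Basis (Fin n) ℝ V) :
    ∃ C > 0, ∀ y, ‖y‖ ^ 2 ≤ C * ∑ i, ⟪B i, y⟫ ^ 2 := by
  have : ProperSpace V := FiniteDimensional.proper ℝ V
  by_cases hne : (Metric.sphere (0:V) 1).Nonempty
  · obtain ⟨z, hz, hmin⟩ := (isCompact_sphere (0:V) 1).exists_isMinOn hne
      (f := fun y => ∑ i, ⟪B i, y⟫ ^ 2) (by fun_prop)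
    have hz0 : z ≠ 0 := by rintro rfl; simp at hz
    have hpos : 0 < ∑ i, ⟪B i, z⟫ ^ 2 := by
      refine lt_of_le_of_ne (Finset.sum_nonneg fun i _ => sq_nonneg _) fun h => hz0 ?_
      refine basis_inner_zero B fun i => ?_
      have h2 := (Finset.sum_eq_zero_iff_of_nonneg (fun i _ => sq_nonneg ⟪B i, z⟫)).1 h.symm i
        (Finset.mem_univ _)
      simpa using h2
    refine ⟨(∑ i, ⟪B i, z⟫ ^ 2)⁻¹, by positivity, fun y => ?_⟩
    by_cases h0 : y = 0
    · simp [h0]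
    have hn : 0 < ‖y‖ := norm_pos_iff.2 h0
    have hm : ‖y‖⁻¹ • y ∈ Metric.sphere (0:V) 1 := by
      simp [norm_smul, norm_ne_zero_iff.2 h0]
    have h1 : ∑ i, ⟪B i, z⟫ ^ 2 ≤ ∑ i, ⟪B i, ‖y‖⁻¹ • y⟫ ^ 2 := hmin hm
    simp only [inner_smul_right, mul_pow] at h1
    rw [← Finset.mul_sum] at h1
    rw [le_inv_mul_iff₀ hpos]
    calc (∑ i, ⟪B i, z⟫ ^ 2) * ‖y‖ ^ 2 ≤ (‖y‖⁻¹ ^ 2 * ∑ i, ⟪B i, y⟫ ^ 2) * ‖y‖ ^ 2 := by gcongr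
      _ = _ := by field_simp
  · refine ⟨1, one_pos, fun y => ?_⟩
    have : y = 0 := by
      by_contra h0
      exact hne ⟨‖y‖⁻¹ • y, by simp [norm_smul, norm_ne_zero_iff.2 h0]⟩
    simp [this]

theorem hh_lower_near (B : Module.Basis (Fin n) ℝ V) :
    ∃ C > 0, ∃ r > 0, ∀ y, ‖y‖ ≤ r → ‖y‖ ^ 2 ≤ C * hh B y := by
  obtain ⟨C, hC, h⟩ := basis_sq_lower B
  let D := 1 + ∑ i, ‖B i‖
  have hD : 0 < D := by positivity
  have hDi : ∀ i, ‖B i‖ ≤ D := fun i => by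
    have := Finset.single_le_sum (f := fun i => ‖B i‖) (fun i _ => norm_nonneg _) (Finset.mem_univ i)
    simp only [D]; linarith
  refine ⟨C * 4, by positivity, 1 / (2 * D), by positivity, fun y hy => (h y).trans ?_⟩
  rw [mul_assoc]
  gcongr
  unfold hh
  rw [Finset.mul_sum]
  refine Finset.sum_le_sum fun i _ => ?_
  have h1 : |⟪B i, y⟫| ≤ 1 / 2 := by
    calc |⟪B i, y⟫| ≤ ‖B i‖ * ‖y‖ := abs_real_inner_le_norm _ _
      _ ≤ D * (1 / (2 * D)) := by gcongr; exact hDi i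
      _ = 1 / 2 := by field_simp
  have h2 := abs_one_sub_exp h1
  unfold th
  rw [← sq_abs, ← sq_abs (1 - _)]
  nlinarith [abs_nonneg ⟪B i, y⟫]

theorem hh_lower_far (hK : IsProperConvexCone K) (B : Module.Basis (Fin n) ℝ V)
    (hB : ∀ i, B i ∈ sPos K) (x : V) {r : ℝ} (hr : 0 < r) :
    ∃ c > 0, ∀ y ∈ shift K x, r ≤ ‖y‖ → c ≤ hh B y := by
  have : ProperSpace V := FiniteDimensional.proper ℝ V
  rcases isEmpty_or_nonempty (Fin n) with he | ⟨⟨i⟩⟩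
  · refine ⟨1, one_pos, fun y hy h => ?_⟩
    have : y = 0 := basis_inner_zero B fun i => (he.false i).elim
    rw [this, norm_zero] at h; linarith
  obtain ⟨ε, hε, hεK⟩ := hB i
  let R := ‖x‖ + (1 + |⟪B i, x⟫|) / ε
  have hR : ∀ y ∈ shift K x, R ≤ ‖y‖ → 1 / 4 ≤ hh B y := by
    intro y hy hRy
    have h1 := hεK _ hy
    rw [inner_add_right] at h1
    have h2 : ‖y‖ ≤ ‖y + x‖ + ‖x‖ := by
      calc ‖y‖ = ‖(y + x) - x‖ := by rw [add_sub_cancel_right]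
        _ ≤ _ := norm_sub_le _ _
    have h3 : (1 + |⟪B i, x⟫|) / ε ≤ ‖y + x‖ := by simp only [R] at hRy; linarith
    rw [div_le_iff₀ hε] at h3
    have h4 := le_abs_self ⟪B i, x⟫
    have h5 : 1 ≤ ⟪B i, y⟫ := by linarith
    have h6 : Real.exp (-⟪B i, y⟫) ≤ 1 / 2 := by
      have : Real.exp (-⟪B i, y⟫) ≤ Real.exp (-1) := Real.exp_le_exp.2 (by linarith)
      have := Real.exp_neg_one_lt_half
      linarith
    have h7 : 1 / 2 ≤ th B i y := by unfold th; linarith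
    have h8 : th B i y ^ 2 ≤ hh B y :=
      Finset.single_le_sum (f := fun i => th B i y ^ 2) (fun i _ => sq_nonneg _) (Finset.mem_univ i)
    nlinarith
  have hc : IsCompact (Metric.closedBall (0:V) R ∩ {y | r ≤ ‖y‖}) :=
    (isCompact_closedBall (0:V) R).inter_right (isClosed_le continuous_const continuous_norm)
  rcases (Metric.closedBall (0:V) R ∩ {y | r ≤ ‖y‖}).eq_empty_or_nonempty with he | hne
  · refine ⟨1 / 4, by norm_num, fun y hy hry => ?_⟩
    by_cases h : R ≤ ‖y‖
    · exact hR y hy h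
    · exfalso
      have : y ∈ (Metric.closedBall (0:V) R ∩ {y | r ≤ ‖y‖}) := ⟨by
        simp only [Metric.mem_closedBall, dist_zero_right]; linarith, hry⟩
      rw [he] at this; exact this
  · obtain ⟨z, hz, hmin⟩ := hc.exists_isMinOn hne (hh_cont B).continuousOn
    have hz0 : z ≠ 0 := by
      rintro rfl
      have := hz.2
      simp only [mem_ofPred_eq, norm_zero] at this; linarith
    refine ⟨min (1 / 4) (hh B z), lt_min (by norm_num) (hh_pos B hz0), fun y hy hry => ?_⟩
    by_cases h : R ≤ ‖y‖
    · exact (min_le_left _ _).trans (hR y hy h)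
    · exact (min_le_right _ _).trans (hmin ⟨by
        simp only [Metric.mem_closedBall, dist_zero_right]; linarith, hry⟩)

/-- any bounded function that is `≤ C‖y‖²` near zero is bounded by a multiple of `hh` -/
theorem le_hh_of (hK : IsProperConvexCone K) (B : Module.Basis (Fin n) ℝ V)
    (hB : ∀ i, B i ∈ sPos K) (x : V) {r C₁ C₂ : ℝ} (hr : 0 < r) :
    ∃ C, 0 ≤ C ∧ ∀ g : V → ℝ, (∀ y ∈ shift K x, g y ≤ C₁) → (∀ y, ‖y‖ ≤ r → g y ≤ C₂ * ‖y‖ ^ 2) →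
      ∀ y ∈ shift K x, g y ≤ C * hh B y := by
  obtain ⟨D, hD, s, hs, hnear⟩ := hh_lower_near B
  obtain ⟨c, hc, hfar⟩ := hh_lower_far hK B hB x (lt_min hr hs)
  refine ⟨|C₂| * D + |C₁| / c, by positivity, fun g h1 h2 y hy => ?_⟩
  have hn := hh_nonneg B y
  by_cases h : ‖y‖ ≤ min r s
  · have := h2 y (h.trans (min_le_left _ _))
    have h3 := hnear y (h.trans (min_le_right _ _))
    calc g y ≤ C₂ * ‖y‖ ^ 2 := this
      _ ≤ |C₂| * ‖y‖ ^ 2 := by gcongr; exact le_abs_self _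
      _ ≤ |C₂| * (D * hh B y) := by gcongr
      _ ≤ _ := by rw [add_mul, mul_assoc]; have : 0 ≤ |C₁| / c * hh B y := by positivity
                  linarith
  · have := hfar y hy (not_le.1 h).le
    calc g y ≤ C₁ := h1 y hy
      _ ≤ |C₁| := le_abs_self _
      _ = |C₁| / c * c := by field_simp
      _ ≤ |C₁| / c * hh B y := by gcongr
      _ ≤ _ := by rw [add_mul]; have : 0 ≤ |C₂| * D * hh B y := by positivity
                  linarith

theorem abs_le_hh_of_isBigO (hK : IsProperConvexCone K) (B : Module.Basis (Fin n) ℝ V)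
    (hB : ∀ i, B i ∈ sPos K) (x : V) {g : V → ℝ} {C₁ : ℝ} (h1 : ∀ y ∈ shift K x, |g y| ≤ C₁)
    (h2 : g =O[𝓝 0] fun y => ‖y‖ ^ 2) :
    ∃ C, 0 ≤ C ∧ ∀ y ∈ shift K x, |g y| ≤ C * hh B y := by
  obtain ⟨c, hc⟩ := h2.bound
  obtain ⟨r, hr, hball⟩ := Metric.eventually_nhds_iff.1 hc
  obtain ⟨C, hC, h⟩ := le_hh_of (C₁ := C₁) (C₂ := c) hK B hB x (half_pos hr)
  refine ⟨C, hC, h (fun y => |g y|) h1 fun y hy => ?_⟩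
  have := hball (y := y) (by rw [dist_zero_right]; linarith)
  simpa using this

theorem min_le_hh (hK : IsProperConvexCone K) (B : Module.Basis (Fin n) ℝ V)
    (hB : ∀ i, B i ∈ sPos K) (x : V) :
    ∃ C, 0 ≤ C ∧ ∀ y ∈ shift K x, min (‖y‖ ^ 2) 1 ≤ C * hh B y := by
  obtain ⟨C, hC, h⟩ := le_hh_of (C₁ := 1) (C₂ := 1) hK B hB x one_pos
  exact ⟨C, hC, h (fun y => min (‖y‖ ^ 2) 1) (fun y _ => min_le_right _ _)
    fun y _ => by rw [one_mul]; exact min_le_left _ _⟩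

/-- quotient by `hh` of a little-o is continuous -/
theorem div_hh_cont (B : Module.Basis (Fin n) ℝ V) {g : V → ℝ} (hg : Continuous g)
    (h2 : g =o[𝓝 0] fun y => ‖y‖ ^ 2) : Continuous fun y => g y / hh B y := by
  rw [continuous_iff_continuousAt]
  intro y
  by_cases hy : y = 0
  · subst hy
    show Tendsto _ _ (𝓝 (g 0 / hh B 0))
    rw [hh_zero, div_zero]
    obtain ⟨D, hD, s, hs, hnear⟩ := hh_lower_near B
    have h3 : (fun y : V => ‖y‖ ^ 2) =O[𝓝 0] hh B := by
      refine IsBigO.of_bound D ?_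
      filter_upwards [Metric.closedBall_mem_nhds (0:V) hs] with y hy
      rw [Metric.mem_closedBall, dist_zero_right] at hy
      rw [Real.norm_of_nonneg (by positivity), Real.norm_of_nonneg (hh_nonneg B y)]
      exact hnear y hy
    exact (h2.trans_isBigO h3).tendsto_div_nhds_zero
  · exact hg.continuousAt.div (hh_cont B).continuousAt (hh_pos B hy).ne'

end Analytic

section Analytic2

set_option linter.unusedSectionVars false
set_option linter.unusedVariables false

open Asymptotics

variable {K : Set V} {n : ℕ}

/-- bounded on a set -/
def Bdd (S : Set V) (g : V → ℝ) : Prop := ∃ C, ∀ y ∈ S, |g y| ≤ C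

theorem Bdd.add {S : Set V} {f g : V → ℝ} (hf : Bdd S f) (hg : Bdd S g) :
    Bdd S (fun y => f y + g y) := by
  obtain ⟨C, hC⟩ := hf
  obtain ⟨D, hD⟩ := hg
  exact ⟨C + D, fun y hy => (abs_add_le _ _).trans (add_le_add (hC y hy) (hD y hy))⟩

theorem Bdd.const {S : Set V} (c : ℝ) : Bdd S (fun _ => c) := ⟨|c|, fun _ _ => le_rfl⟩

theorem Bdd.mul {S : Set V} {f g : V → ℝ} (hf : Bdd S f) (hg : Bdd S g) :
    Bdd S (fun y => f y * g y) := by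
  obtain ⟨C, hC⟩ := hf
  obtain ⟨D, hD⟩ := hg
  refine ⟨C * D, fun y hy => ?_⟩
  rw [abs_mul]
  exact mul_le_mul (hC y hy) (hD y hy) (abs_nonneg _) ((abs_nonneg _).trans (hC y hy))

theorem Bdd.const_mul {S : Set V} {g : V → ℝ} (c : ℝ) (hg : Bdd S g) :
    Bdd S (fun y => c * g y) := (Bdd.const c).mul hg

theorem Bdd.neg {S : Set V} {g : V → ℝ} (hg : Bdd S g) : Bdd S (fun y => - g y) := by
  simpa using hg.const_mul (-1)

theorem Bdd.sub {S : Set V} {f g : V → ℝ} (hf : Bdd S f) (hg : Bdd S g) :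
    Bdd S (fun y => f y - g y) := by
  simpa [sub_eq_add_neg] using hf.add hg.neg

theorem Bdd.pow {S : Set V} {f : V → ℝ} (hf : Bdd S f) : Bdd S (fun y => f y ^ 2) := by
  simpa [sq] using hf.mul hf

theorem Bdd.sum {S : Set V} {ι : Type*} (s : Finset ι) {f : ι → V → ℝ} (hf : ∀ i, Bdd S (f i)) :
    Bdd S (fun y => ∑ i ∈ s, f i y) := by
  choose C hC using hf
  exact ⟨∑ i ∈ s, C i, fun y hy => (Finset.abs_sum_le_sum_abs _ _).trans
    (Finset.sum_le_sum fun i _ => hC i y hy)⟩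

theorem exp_bdd {u x : V} (hu : u ∈ dualCone K) :
    Bdd (shift K x) (fun y => Real.exp (-⟪u, y⟫)) :=
  ⟨Real.exp ⟪u, x⟫, fun y hy => by rw [abs_of_pos (Real.exp_pos _)]; exact exp_le_shift hu hy⟩

theorem chi_bdd {S : Set V} {χ : V → V} (hχ : IsTruncation χ) (u : V) :
    Bdd S (fun y => ⟪χ y, u⟫) :=
  ⟨1 * ‖u‖, fun y hy => (abs_real_inner_le_norm _ _).trans (by gcongr; exact hχ.2.1 y)⟩

/-- uniform upper bound -/
theorem L4 (hK : IsProperConvexCone K) (B : Module.Basis (Fin n) ℝ V)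
    (hB : ∀ i, B i ∈ sPos K) (x : V) {M : ℝ} (hM : 0 ≤ M) :
    ∃ C, 0 ≤ C ∧ ∀ z ∈ dualCone K, (∀ i, |B.repr z i| ≤ M) → ∀ y ∈ shift K x,
      Real.exp (-⟪z, y⟫) - 1 + ∑ i, B.repr z i * th B i y ≤ C * hh B y := by
  choose T hT using th_bound B hB x
  let D := ∑ i, ‖B i‖
  have hD : 0 ≤ D := Finset.sum_nonneg fun i _ => norm_nonneg _
  have hDi : ∀ i, ‖B i‖ ≤ D := fun i =>
    Finset.single_le_sum (f := fun i => ‖B i‖) (fun i _ => norm_nonneg _) (Finset.mem_univ i)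
  have hz : ∀ z, (∀ i, |B.repr z i| ≤ M) → ‖z‖ ≤ M * D := by
    intro z hz
    conv_lhs => rw [← B.sum_repr z]
    refine (norm_sum_le _ _).trans ?_
    simp only [D, Finset.mul_sum]
    refine Finset.sum_le_sum fun i _ => ?_
    rw [norm_smul]
    gcongr
    exact hz i
  have hr : 0 < 1 / ((M + 1) * D + 1) := by positivity
  obtain ⟨C, hC, h⟩ := le_hh_of (C₁ := Real.exp (M * D * ‖x‖) + M * ∑ i, T i)
    (C₂ := (M * D) ^ 2 + M * ∑ i : Fin n, D ^ 2) hK B hB x hr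
  refine ⟨C, hC, fun z hzK hzM => h _ ?_ ?_⟩
  · intro y hy
    have h1 := exp_le_shift hzK hy
    have h2 : Real.exp ⟪z, x⟫ ≤ Real.exp (M * D * ‖x‖) := by
      apply Real.exp_le_exp.2
      refine (real_inner_le_norm _ _).trans ?_
      gcongr
      exact hz z hzM
    have h3 : ∑ i, B.repr z i * th B i y ≤ M * ∑ i, T i := by
      rw [Finset.mul_sum]
      refine Finset.sum_le_sum fun i _ => (le_abs_self _).trans ?_
      rw [abs_mul]
      exact mul_le_mul (hzM i) (hT i y hy) (abs_nonneg _) hM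
    linarith
  · intro y hy
    rw [le_div_iff₀ (by positivity)] at hy
    have hn := norm_nonneg y
    have hMD : M * D * ‖y‖ ≤ 1 := by nlinarith [mul_nonneg hD hn]
    have hDy : D * ‖y‖ ≤ 1 := by nlinarith [mul_nonneg hM (mul_nonneg hD hn)]
    have h1 : |⟪z, y⟫| ≤ M * D * ‖y‖ := (abs_real_inner_le_norm _ _).trans (by
      gcongr; exact hz z hzM)
    have h2 := (abs_le.1 (Real.abs_exp_sub_one_sub_id_le (x := -⟪z, y⟫)
      (by rw [abs_neg]; linarith))).2
    have h3 : (-⟪z, y⟫) ^ 2 ≤ (M * D * ‖y‖) ^ 2 := by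
      rw [neg_sq, ← sq_abs]; gcongr
    have h4 : ∑ i, B.repr z i * (th B i y - ⟪B i, y⟫) ≤ M * ∑ i : Fin n, (D * ‖y‖) ^ 2 := by
      rw [Finset.mul_sum]
      refine Finset.sum_le_sum fun i _ => (le_abs_self _).trans ?_
      rw [abs_mul]
      refine mul_le_mul (hzM i) ?_ (abs_nonneg _) hM
      have h5 : |⟪B i, y⟫| ≤ D * ‖y‖ := (abs_real_inner_le_norm _ _).trans (by
        gcongr; exact hDi i)
      have h6 := Real.abs_exp_sub_one_sub_id_le (x := -⟪B i, y⟫) (by rw [abs_neg]; linarith)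
      rw [show th B i y - ⟪B i, y⟫ = -(Real.exp (-⟪B i, y⟫) - 1 - -⟪B i, y⟫) by unfold th; ring,
        abs_neg]
      refine h6.trans ?_
      rw [neg_sq, ← sq_abs]; gcongr
    simp only [mul_sub, Finset.sum_sub_distrib] at h4
    rw [← basis_inner B z y] at h4
    have h7 : M * ∑ i : Fin n, (D * ‖y‖) ^ 2 = (M * ∑ i : Fin n, D ^ 2) * ‖y‖ ^ 2 := by
      simp only [mul_pow, ← Finset.sum_mul]; ring
    have h8 : (M * D * ‖y‖) ^ 2 = (M * D) ^ 2 * ‖y‖ ^ 2 := by ring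
    rw [add_mul, ← h7, ← h8]
    linarith

/-- third order remainder -/
noncomputable def al (v y : V) : ℝ :=
  Real.exp (-⟪v, y⟫) - 1 + ⟪v, y⟫ - 1 / 2 * ⟪v, y⟫ ^ 2

theorem inner_isBigO (v : V) : (fun y => ⟪v, y⟫) =O[𝓝 0] fun y : V => ‖y‖ :=
  IsBigO.of_bound ‖v‖ (Eventually.of_forall fun y => by
    rw [norm_norm]; exact norm_inner_le_norm _ _)

theorem norm_sq_isLittleO : (fun y : V => ‖y‖ ^ 2) =o[𝓝 0] fun y : V => ‖y‖ := by
  have h : (fun y : V => ‖y‖) =o[𝓝 0] fun y : V => (1:ℝ) := by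
    rw [isLittleO_one_iff]; simpa using (continuous_norm (E := V)).tendsto 0
  simpa [sq] using h.mul_isBigO (isBigO_refl (fun y : V => ‖y‖) _)

theorem norm_cube_isLittleO : (fun y : V => ‖y‖ ^ 3) =o[𝓝 0] fun y : V => ‖y‖ ^ 2 := by
  have := (norm_sq_isLittleO (V := V)).mul_isBigO (isBigO_refl (fun y : V => ‖y‖) _)
  refine this.congr (fun y => by ring) (fun y => by ring)

theorem al_isLittleO (v : V) : al v =o[𝓝 0] fun y : V => ‖y‖ ^ 2 := by
  refine IsBigO.trans_isLittleO ?_ norm_cube_isLittleO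
  have h := Real.exp_sub_sum_range_succ_isLittleO_pow 2
  have h := Real.exp_sub_sum_range_isBigO_pow 3
  have hk : Tendsto (fun y : V => -⟪v, y⟫) (𝓝 0) (𝓝 0) := by
    have : Continuous (fun y : V => -⟪v, y⟫) := by fun_prop
    simpa using this.tendsto 0
  have h2 := (h.comp_tendsto hk).trans ((inner_isBigO v).neg_left.pow 3)
  refine h2.congr_left fun y => ?_
  simp [Finset.sum_range_succ, al]
  ring

theorem th_sub_isBigO (B : Module.Basis (Fin n) ℝ V) (i : Fin n) :
    (fun y => th B i y - ⟪B i, y⟫) =O[𝓝 0] fun y : V => ‖y‖ ^ 2 := by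
  have h : (fun y => th B i y - ⟪B i, y⟫) = fun y => -(1 / 2 * ⟪B i, y⟫ ^ 2) - al (B i) y := by
    funext y; unfold th al; ring
  rw [h]
  exact (((inner_isBigO (B i)).pow 2).const_mul_left _).neg_left.sub (al_isLittleO _).isBigO

theorem th_isBigO (B : Module.Basis (Fin n) ℝ V) (i : Fin n) :
    (fun y => th B i y) =O[𝓝 0] fun y : V => ‖y‖ := by
  have := ((th_sub_isBigO B i).trans norm_sq_isLittleO.isBigO).add (inner_isBigO (B i))
  simpa using this

theorem ta_sub_isLittleO (B : Module.Basis (Fin n) ℝ V) (i : Fin n) :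
    (fun y => ta B i y - ⟪B i, y⟫) =o[𝓝 0] fun y : V => ‖y‖ ^ 2 := by
  have h : (fun y => ta B i y - ⟪B i, y⟫) = fun y => 1 / 2 * al ((2:ℝ) • B i) y - 2 * al (B i) y := by
    funext y; unfold ta th al; rw [real_inner_smul_left]; ring
  rw [h]
  exact ((al_isLittleO _).const_mul_left _).sub ((al_isLittleO _).const_mul_left _)

noncomputable def kk (B : Module.Basis (Fin n) ℝ V) (u y : V) : ℝ :=
  Real.exp (-⟪u, y⟫) - 1 + ∑ i, B.repr u i * ta B i y - 1 / 2 * (∑ i, B.repr u i * th B i y) ^ 2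

theorem kk_cont (B : Module.Basis (Fin n) ℝ V) (u : V) : Continuous (kk B u) := by
  unfold kk; have := th_cont B; have := ta_cont B; fun_prop

theorem kk_isLittleO (B : Module.Basis (Fin n) ℝ V) (u : V) :
    kk B u =o[𝓝 0] fun y : V => ‖y‖ ^ 2 := by
  have h : kk B u = fun y => al u y + ∑ i, B.repr u i * (ta B i y - ⟪B i, y⟫)
      - 1 / 2 * ((∑ i, B.repr u i * (th B i y - ⟪B i, y⟫)) *
        (∑ i, B.repr u i * th B i y + ⟪u, y⟫)) := by
    funext y
    unfold kk al
    simp only [mul_sub, Finset.sum_sub_distrib]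
    rw [← basis_inner B u y]
    ring
  rw [h]
  have h1 : (fun y => ∑ i, B.repr u i * (ta B i y - ⟪B i, y⟫)) =o[𝓝 0] fun y : V => ‖y‖ ^ 2 :=
    IsLittleO.fun_sum fun i _ => (ta_sub_isLittleO B i).const_mul_left _
  have h2 : (fun y => ∑ i, B.repr u i * (th B i y - ⟪B i, y⟫)) =O[𝓝 0] fun y : V => ‖y‖ ^ 2 :=
    IsBigO.fun_sum fun i _ => (th_sub_isBigO B i).const_mul_left _
  have h3 : (fun y => ∑ i, B.repr u i * th B i y) =O[𝓝 0] fun y : V => ‖y‖ :=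
    IsBigO.fun_sum fun i _ => (th_isBigO B i).const_mul_left _
  have h4 := (h2.trans_isLittleO norm_sq_isLittleO).mul_isBigO (h3.add (inner_isBigO u))
  have h5 := h4.congr_right (g₂ := fun y : V => ‖y‖ ^ 2) (fun y => by ring)
  exact ((al_isLittleO u).add h1).sub (h5.const_mul_left _)

theorem chi_sub_isLittleO (B : Module.Basis (Fin n) ℝ V) {χ : V → V} (hχ : IsTruncation χ)
    (i : Fin n) : (fun y => ⟪χ y, B i⟫ - ta B i y) =o[𝓝 0] fun y : V => ‖y‖ ^ 2 := by
  refine (ta_sub_isLittleO B i).neg_left.congr' ?_ EventuallyEq.rfl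
  filter_upwards [hχ.2.2] with y hy
  rw [hy, real_inner_comm]; ring

theorem thth_isBigO (B : Module.Basis (Fin n) ℝ V) (i j : Fin n) :
    (fun y => th B i y * th B j y) =O[𝓝 0] fun y : V => ‖y‖ ^ 2 := by
  simpa [sq] using (th_isBigO B i).mul (th_isBigO B j)

theorem ta_nonneg (B : Module.Basis (Fin n) ℝ V) (hB : ∀ i, B i ∈ sPos K) (i : Fin n) {y : V}
    (hy : y ∈ K) : 0 ≤ th B i y ∧ 0 ≤ ta B i y := by
  have h : 0 ≤ th B i y := by
    unfold th
    have h0 := dual_nonneg (sPos_subset (hB i)) hy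
    have : Real.exp (-⟪B i, y⟫) ≤ 1 := Real.exp_le_one_iff.2 (by linarith)
    linarith
  refine ⟨h, ?_⟩
  rw [ta_eq]; positivity

end Analytic2

section ProcFam

set_option linter.unusedSectionVars false
set_option linter.unusedVariables false

variable {K : Set V} {φ : ℝ → V → ℝ} {ψ : ℝ → V → V}

theorem nonneg_of_nat {a b : ℝ} (h : ∀ n : ℕ, 0 ≤ a + n * b) : 0 ≤ b := by
  by_contra hb
  push Not at hb
  obtain ⟨n, hn⟩ := exists_nat_gt (a / (-b))
  rw [div_lt_iff₀ (by linarith)] at hn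
  have := h n
  linarith

theorem p_fin (X : AffineTransitionFamily K φ ψ) {t : ℝ} (ht : 0 ≤ t) {x : V} (hx : x ∈ K) :
    IsFiniteMeasure (X.p t x) := ⟨(X.subprob t ht x hx).trans_lt ENNReal.one_lt_top⟩

theorem p_ae (X : AffineTransitionFamily K φ ψ) {t : ℝ} (ht : 0 ≤ t) {x : V} (hx : x ∈ K) :
    ∀ᵐ ξ ∂(X.p t x), ξ ∈ K := X.supported t ht x hx

theorem exp_le_one {u ξ : V} (hu : u ∈ dualCone K) (hξ : ξ ∈ K) : Real.exp (-⟪u, ξ⟫) ≤ 1 :=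
  Real.exp_le_one_iff.2 (by have := dual_nonneg hu hξ; linarith)

theorem p_int (X : AffineTransitionFamily K φ ψ) {t : ℝ} (ht : 0 ≤ t) {x : V} (hx : x ∈ K)
    {u : V} (hu : u ∈ dualCone K) : Integrable (fun ξ => Real.exp (-⟪u, ξ⟫)) (X.p t x) := by
  have := p_fin X ht hx
  refine Integrable.of_bound (C := 1) (by fun_prop) ?_
  filter_upwards [p_ae X ht hx] with ξ hξ
  rw [Real.norm_of_nonneg (Real.exp_pos _).le]
  exact exp_le_one hu hξ

theorem p_mass_le (X : AffineTransitionFamily K φ ψ) {t : ℝ} (ht : 0 ≤ t) {x : V} (hx : x ∈ K) :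
    (X.p t x).real univ ≤ 1 := by
  rw [Measure.real]
  exact ENNReal.toReal_le_of_le_ofReal one_pos.le (by simpa using X.subprob t ht x hx)

theorem lap_nonneg (X : AffineTransitionFamily K φ ψ) {t : ℝ} (ht : 0 ≤ t) {x : V} (hx : x ∈ K)
    {u : V} (hu : u ∈ dualCone K) : 0 ≤ φ t u + ⟪ψ t u, x⟫ := by
  have := p_fin X ht hx
  have h := X.laplace t ht u hu x hx
  have h2 : ∫ ξ, Real.exp (-⟪u, ξ⟫) ∂(X.p t x) ≤ ∫ ξ, (1:ℝ) ∂(X.p t x) := by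
    refine integral_mono_ae (p_int X ht hx hu) (integrable_const _) ?_
    filter_upwards [p_ae X ht hx] with ξ hξ
    exact exp_le_one hu hξ
  rw [integral_const, smul_eq_mul, mul_one, h] at h2
  have := Real.exp_le_one_iff.1 (h2.trans (p_mass_le X ht hx))
  linarith

theorem nsmul_cone (hK : IsProperConvexCone K) {x : V} (hx : x ∈ K) (n : ℕ) : (n:ℝ) • x ∈ K :=
  hK.smul_mem n (Nat.cast_nonneg n) x hx

theorem psi_mem (hK : IsProperConvexCone K) (X : AffineTransitionFamily K φ ψ) {t : ℝ}
    (ht : 0 ≤ t) {u : V} (hu : u ∈ dualCone K) : ψ t u ∈ dualCone K := by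
  intro x hx
  rw [real_inner_comm]
  refine nonneg_of_nat (a := φ t u) fun n => ?_
  have := lap_nonneg X ht (nsmul_cone hK hx n) hu
  rwa [inner_smul_right] at this

theorem lap_mono (X : AffineTransitionFamily K φ ψ) {t : ℝ} (ht : 0 ≤ t) {x : V} (hx : x ∈ K)
    {u v : V} (hu : u ∈ dualCone K) (huv : v - u ∈ dualCone K) :
    φ t u + ⟪ψ t u, x⟫ ≤ φ t v + ⟪ψ t v, x⟫ := by
  have hv : v ∈ dualCone K := by simpa using dual_add_mem hu huv
  have h2 : ∫ ξ, Real.exp (-⟪v, ξ⟫) ∂(X.p t x) ≤ ∫ ξ, Real.exp (-⟪u, ξ⟫) ∂(X.p t x) := by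
    refine integral_mono_ae (p_int X ht hx hv) (p_int X ht hx hu) ?_
    filter_upwards [p_ae X ht hx] with ξ hξ
    apply Real.exp_le_exp.2
    have := dual_nonneg huv hξ
    rw [inner_sub_left] at this
    linarith
  rw [X.laplace t ht u hu x hx, X.laplace t ht v hv x hx, Real.exp_le_exp] at h2
  linarith

theorem psi_mono (hK : IsProperConvexCone K) (X : AffineTransitionFamily K φ ψ) {t : ℝ}
    (ht : 0 ≤ t) {u v : V} (hu : u ∈ dualCone K) (huv : v - u ∈ dualCone K) :
    ψ t v - ψ t u ∈ dualCone K := by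
  intro x hx
  rw [real_inner_comm]
  refine nonneg_of_nat (a := φ t v - φ t u) fun n => ?_
  have := lap_mono X ht (nsmul_cone hK hx n) hu huv
  rw [inner_smul_right, inner_smul_right] at this
  rw [inner_sub_left]
  linarith

theorem sq_integral_le {μ : Measure V} [IsFiniteMeasure μ] (hμ : μ.real univ ≤ 1) {g : V → ℝ}
    (hg : Integrable g μ) (hg2 : Integrable (fun x => g x ^ 2) μ) :
    (∫ x, g x ∂μ) ^ 2 ≤ ∫ x, g x ^ 2 ∂μ := by
  set a := ∫ x, g x ∂μ
  have h0 : 0 ≤ ∫ x, (g x - a) ^ 2 ∂μ := integral_nonneg fun x => sq_nonneg _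
  have h1 : ∫ x, (g x - a) ^ 2 ∂μ = ∫ x, g x ^ 2 ∂μ - 2 * a * a + a ^ 2 * μ.real univ := by
    have : (fun x => (g x - a) ^ 2) = fun x => g x ^ 2 - 2 * a * g x + a ^ 2 := by
      funext x; ring
    have hi : Integrable (fun x => g x ^ 2 - 2 * a * g x) μ := hg2.sub (hg.const_mul _)
    rw [this, integral_add hi (integrable_const _),
      integral_sub hg2 (hg.const_mul _), integral_const_mul, integral_const, smul_eq_mul]
    ring
  have h2 : a ^ 2 * μ.real univ ≤ a ^ 2 := mul_le_of_le_one_right (sq_nonneg _) hμ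
  nlinarith

theorem lap_half (X : AffineTransitionFamily K φ ψ) {t : ℝ} (ht : 0 ≤ t) {x : V} (hx : x ∈ K)
    {u : V} (hu : u ∈ dualCone K) :
    φ t u + ⟪ψ t u, x⟫ ≤ 2 * (φ t ((1/2:ℝ) • u) + ⟪ψ t ((1/2:ℝ) • u), x⟫) := by
  have := p_fin X ht hx
  have hu2 : (1/2:ℝ) • u ∈ dualCone K := dual_smul_mem (by norm_num) hu
  have he : ∀ ξ, Real.exp (-⟪(1/2:ℝ) • u, ξ⟫) ^ 2 = Real.exp (-⟪u, ξ⟫) := fun ξ => by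
    rw [← Real.exp_nat_mul, real_inner_smul_left]; congr 1; push_cast; ring
  have h := sq_integral_le (p_mass_le X ht hx) (p_int X ht hx hu2)
    (by simpa only [he] using p_int X ht hx hu)
  simp only [he] at h
  rw [X.laplace t ht u hu x hx, X.laplace t ht _ hu2 x hx, ← Real.exp_nat_mul,
    Real.exp_le_exp] at h
  push_cast at h
  linarith

theorem psi_half (hK : IsProperConvexCone K) (X : AffineTransitionFamily K φ ψ) {t : ℝ}
    (ht : 0 ≤ t) {u : V} (hu : u ∈ dualCone K) :
    ψ t ((1/2:ℝ) • u) - (1/2:ℝ) • ψ t u ∈ dualCone K := by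
  intro x hx
  rw [real_inner_comm]
  refine nonneg_of_nat (a := φ t ((1/2:ℝ) • u) - 1/2 * φ t u) fun n => ?_
  have := lap_half X ht (nsmul_cone hK hx n) hu
  rw [inner_smul_right, inner_smul_right] at this
  rw [inner_sub_left, real_inner_smul_left]
  linarith

theorem psi_half_pow (hK : IsProperConvexCone K) (X : AffineTransitionFamily K φ ψ) {t : ℝ}
    (ht : 0 ≤ t) {u : V} (hu : u ∈ dualCone K) (j : ℕ) :
    ψ t ((1/2:ℝ) ^ j • u) - (1/2:ℝ) ^ j • ψ t u ∈ dualCone K := by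
  induction j with
  | zero => simpa using dual_zero_mem
  | succ j ih =>
    have h1 := psi_half hK X ht (u := (1/2:ℝ) ^ j • u) (dual_smul_mem (by positivity) hu)
    have h2 := dual_add_mem h1 (dual_smul_mem (c := 1/2) (by norm_num) ih)
    rw [pow_succ', mul_smul, mul_smul]
    convert h2 using 1
    rw [smul_sub]; abel

theorem init_eq (hK : IsProperConvexCone K) (X : AffineTransitionFamily K φ ψ)
    {u : V} (hu : u ∈ dualCone K) : φ 0 u = 0 ∧ ψ 0 u = u := by
  have h : ∀ x ∈ K, φ 0 u + ⟪ψ 0 u, x⟫ = ⟪u, x⟫ := by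
    intro x hx
    have := X.laplace 0 le_rfl u hu x hx
    rw [X.init x hx, integral_dirac, Real.exp_eq_exp] at this
    linarith
  have h0 : φ 0 u = 0 := by simpa using h 0 (cone_zero_mem hK)
  refine ⟨h0, inner_ext_cone hK fun x hx => ?_⟩
  have := h x hx
  linarith

theorem lint_exp (X : AffineTransitionFamily K φ ψ) {t : ℝ} (ht : 0 ≤ t) {x : V} (hx : x ∈ K)
    {u : V} (hu : u ∈ dualCone K) :
    ∫⁻ ξ, ENNReal.ofReal (Real.exp (-⟪u, ξ⟫)) ∂(X.p t x) =
      ENNReal.ofReal (Real.exp (-(φ t u) - ⟪ψ t u, x⟫)) := by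
  rw [← X.laplace t ht u hu x hx, ofReal_integral_eq_lintegral_ofReal (p_int X ht hx hu)
    (Eventually.of_forall fun ξ => (Real.exp_pos _).le)]

theorem semiflow_lap (hK : IsProperConvexCone K) (X : AffineTransitionFamily K φ ψ) {t s : ℝ}
    (ht : 0 ≤ t) (hs : 0 ≤ s) {u : V} (hu : u ∈ dualCone K) {x : V} (hx : x ∈ K) :
    φ (t + s) u + ⟪ψ (t + s) u, x⟫ =
      φ t u + φ s (ψ t u) + ⟪ψ s (ψ t u), x⟫ := by
  have hm : Measurable (X.p t) := Measure.measurable_of_measurable_coe _ (X.measurable_p t ht)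
  have hb : X.p (t + s) x = (X.p s x).bind (X.p t) := by
    ext A hA
    rw [X.chapman s t hs ht x hx A hA, Measure.bind_apply hA hm.aemeasurable]
  have h1 := lint_exp X (add_nonneg ht hs) hx hu
  rw [hb, Measure.lintegral_bind hm.aemeasurable (by fun_prop)] at h1
  have h2 : ∫⁻ ξ, ∫⁻ η, ENNReal.ofReal (Real.exp (-⟪u, η⟫)) ∂(X.p t ξ) ∂(X.p s x) =
      ∫⁻ ξ, ENNReal.ofReal (Real.exp (-(φ t u))) * ENNReal.ofReal (Real.exp (-⟪ψ t u, ξ⟫))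
        ∂(X.p s x) := by
    refine lintegral_congr_ae ?_
    filter_upwards [p_ae X hs hx] with ξ hξ
    rw [lint_exp X ht hξ hu, ← ENNReal.ofReal_mul (Real.exp_pos _).le, ← Real.exp_add]
    rfl
  rw [h2, lintegral_const_mul _ (by fun_prop), lint_exp X hs hx (psi_mem hK X ht hu),
    ← ENNReal.ofReal_mul (Real.exp_pos _).le, ← Real.exp_add] at h1
  rw [ENNReal.ofReal_eq_ofReal_iff (Real.exp_pos _).le (Real.exp_pos _).le, Real.exp_eq_exp] at h1
  linarith

theorem semiflow (hK : IsProperConvexCone K) (X : AffineTransitionFamily K φ ψ) {t s : ℝ}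
    (ht : 0 ≤ t) (hs : 0 ≤ s) {u : V} (hu : u ∈ dualCone K) :
    φ (t + s) u = φ t u + φ s (ψ t u) ∧ ψ (t + s) u = ψ s (ψ t u) := by
  have h := fun x hx => semiflow_lap hK X ht hs hu (x := x) hx
  have h0 : φ (t + s) u = φ t u + φ s (ψ t u) := by simpa using h 0 (cone_zero_mem hK)
  refine ⟨h0, inner_ext_cone hK fun x hx => ?_⟩
  have := h x hx
  linarith

/-- exponent of the increment -/
noncomputable def ff (φ : ℝ → V → ℝ) (ψ : ℝ → V → V) (x : V) (s : ℝ) (z : V) : ℝ :=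
  φ s z + ⟪ψ s z - z, x⟫

theorem ff_lap (X : AffineTransitionFamily K φ ψ) {t : ℝ} (ht : 0 ≤ t) {x : V} (hx : x ∈ K)
    {u : V} (hu : u ∈ dualCone K) :
    ∫ ξ, Real.exp (-⟪u, ξ - x⟫) ∂(X.p t x) = Real.exp (-ff φ ψ x t u) := by
  have : ∀ ξ, Real.exp (-⟪u, ξ - x⟫) = Real.exp ⟪u, x⟫ * Real.exp (-⟪u, ξ⟫) := fun ξ => by
    rw [← Real.exp_add, inner_sub_right]; congr 1; ring
  simp only [this]
  rw [integral_const_mul, X.laplace t ht u hu x hx, ← Real.exp_add, ff, inner_sub_left]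
  congr 1; ring

theorem ff_semiflow (hK : IsProperConvexCone K) (X : AffineTransitionFamily K φ ψ) {t s : ℝ}
    (ht : 0 ≤ t) (hs : 0 ≤ s) {u : V} (hu : u ∈ dualCone K) (x : V) :
    ff φ ψ x (t + s) u = ff φ ψ x t u + ff φ ψ x s (ψ t u) := by
  obtain ⟨h1, h2⟩ := semiflow hK X ht hs hu
  unfold ff
  rw [h1, h2]
  simp only [inner_sub_left]
  ring

theorem ff_deriv {F : V → ℝ} {R : V → V} {u : V}
    (hF : HasDerivWithinAt (fun t => φ t u) (F u) (Set.Ici (0 : ℝ)) 0)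
    (hR : HasDerivWithinAt (fun t => ψ t u) (R u) (Set.Ici (0 : ℝ)) 0) (x : V) :
    HasDerivWithinAt (fun t => ff φ ψ x t u) (F u + ⟪R u, x⟫) (Set.Ici (0 : ℝ)) 0 := by
  unfold ff
  refine hF.add ?_
  have h1 := (hR.sub_const u).inner ℝ (hasDerivWithinAt_const (0:ℝ) (Set.Ici (0 : ℝ)) x)
  simpa using h1

theorem ff_zero (hK : IsProperConvexCone K) (X : AffineTransitionFamily K φ ψ)
    {u : V} (hu : u ∈ dualCone K) (x : V) : ff φ ψ x 0 u = 0 := by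
  obtain ⟨h1, h2⟩ := init_eq hK X hu
  simp [ff, h1, h2]

theorem slope_tendsto {f : ℝ → ℝ} {a : ℝ} (h : HasDerivWithinAt f a (Set.Ici (0:ℝ)) 0)
    (h0 : f 0 = 0) : Tendsto (fun t => t⁻¹ * f t) (𝓝[>] 0) (𝓝 a) := by
  have := (hasDerivWithinAt_iff_tendsto_slope.1 h)
  rw [Ici_sdiff_left] at this
  refine this.congr fun t => ?_
  simp [slope, vsub_eq_sub, h0, smul_eq_mul]

theorem ff_tendsto (hK : IsProperConvexCone K) (X : AffineTransitionFamily K φ ψ)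
    {F : V → ℝ} {R : V → V} {u : V} (hu : u ∈ dualCone K)
    (hF : HasDerivWithinAt (fun t => φ t u) (F u) (Set.Ici (0 : ℝ)) 0)
    (hR : HasDerivWithinAt (fun t => ψ t u) (R u) (Set.Ici (0 : ℝ)) 0) (x : V) :
    Tendsto (fun t => t⁻¹ * ff φ ψ x t u) (𝓝[>] 0) (𝓝 (F u + ⟪R u, x⟫)) :=
  slope_tendsto (ff_deriv hF hR x) (ff_zero hK X hu x)

theorem EE_tendsto (hK : IsProperConvexCone K) (X : AffineTransitionFamily K φ ψ)
    {F : V → ℝ} {R : V → V} {u : V} (hu : u ∈ dualCone K)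
    (hF : HasDerivWithinAt (fun t => φ t u) (F u) (Set.Ici (0 : ℝ)) 0)
    (hR : HasDerivWithinAt (fun t => ψ t u) (R u) (Set.Ici (0 : ℝ)) 0) {x : V} (hx : x ∈ K) :
    Tendsto (fun t => t⁻¹ * (1 - ∫ ξ, Real.exp (-⟪u, ξ - x⟫) ∂(X.p t x))) (𝓝[>] 0)
      (𝓝 (F u + ⟪R u, x⟫)) := by
  have h := ((ff_deriv hF hR x).neg.exp).const_sub 1
  have h2 := slope_tendsto h (by simp [ff_zero hK X hu x])
  simp only [Pi.neg_apply, ff_zero hK X hu x, neg_zero, Real.exp_zero, one_mul, neg_neg] at h2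
  refine h2.congr' ?_
  filter_upwards [self_mem_nhdsWithin] with t ht
  rw [ff_lap X (le_of_lt ht) hx hu]

end ProcFam

section NuLim

set_option linter.unusedSectionVars false
set_option linter.unusedVariables false

variable {K : Set V} {φ : ℝ → V → ℝ} {ψ : ℝ → V → V} {n : ℕ}

/-- rescaled increment measure -/
noncomputable def nu (X : AffineTransitionFamily K φ ψ) (x : V) (t : ℝ) : Measure V :=
  ENNReal.ofReal t⁻¹ • (X.p t x).map (fun ξ => ξ - x)

theorem nu_fin (X : AffineTransitionFamily K φ ψ) {t : ℝ} (ht : 0 < t) {x : V} (hx : x ∈ K) :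
    IsFiniteMeasure (nu X x t) := by
  have := p_fin X ht.le hx
  unfold nu
  exact Measure.smul_finite _ ENNReal.ofReal_ne_top

theorem nu_ae (hK : IsProperConvexCone K) (X : AffineTransitionFamily K φ ψ) {t : ℝ} (ht : 0 < t)
    {x : V} (hx : x ∈ K) : ∀ᵐ y ∂(nu X x t), y ∈ shift K x := by
  refine Measure.ae_smul_measure ?_ _
  refine (ae_map_iff (p := fun y => y ∈ shift K x) (by fun_prop)
    (shift_closed hK x).measurableSet).2 ?_
  filter_upwards [p_ae X ht.le hx] with ξ hξ
  simpa [shift] using hξ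

theorem nu_integral (X : AffineTransitionFamily K φ ψ) {t : ℝ} (ht : 0 < t) (x : V)
    {f : V → ℝ} (hf : Continuous f) :
    ∫ y, f y ∂(nu X x t) = t⁻¹ * ∫ ξ, f (ξ - x) ∂(X.p t x) := by
  unfold nu
  rw [integral_smul_measure, integral_map (by fun_prop) hf.aestronglyMeasurable,
    ENNReal.toReal_ofReal (by positivity), smul_eq_mul]

theorem bdd_integrable {μ : Measure V} [IsFiniteMeasure μ] {S : Set V} (hS : ∀ᵐ y ∂μ, y ∈ S)
    {f : V → ℝ} (hf : AEStronglyMeasurable f μ) (hb : Bdd S f) : Integrable f μ := by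
  obtain ⟨C, hC⟩ := hb
  refine Integrable.of_bound (C := C) hf ?_
  filter_upwards [hS] with y hy using hC y hy

theorem nu_integrable (hK : IsProperConvexCone K) (X : AffineTransitionFamily K φ ψ) {t : ℝ}
    (ht : 0 < t) {x : V} (hx : x ∈ K) {f : V → ℝ} (hf : Continuous f) (hb : Bdd (shift K x) f) :
    Integrable f (nu X x t) := by
  have := nu_fin X ht hx
  exact bdd_integrable (nu_ae hK X ht hx) hf.aestronglyMeasurable hb

/-- limit of the integrals as time tends to zero -/
structure NL (X : AffineTransitionFamily K φ ψ) (x : V) (f : V → ℝ) (a : ℝ) : Prop where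
  cont : Continuous f
  bdd : Bdd (shift K x) f
  lim : Tendsto (fun t => ∫ y, f y ∂(nu X x t)) (𝓝[>] 0) (𝓝 a)

theorem NL.add (hK : IsProperConvexCone K) {X : AffineTransitionFamily K φ ψ} {x : V} (hx : x ∈ K)
    {f g : V → ℝ} {a c : ℝ} (hf : NL X x f a) (hg : NL X x g c) :
    NL X x (fun y => f y + g y) (a + c) := by
  refine ⟨hf.cont.add hg.cont, hf.bdd.add hg.bdd, (hf.lim.add hg.lim).congr' ?_⟩
  filter_upwards [self_mem_nhdsWithin] with t ht
  rw [integral_add (nu_integrable hK X ht hx hf.cont hf.bdd)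
    (nu_integrable hK X ht hx hg.cont hg.bdd)]

theorem NL.const_mul {X : AffineTransitionFamily K φ ψ} {x : V}
    {f : V → ℝ} {a : ℝ} (c : ℝ) (hf : NL X x f a) :
    NL X x (fun y => c * f y) (c * a) := by
  refine ⟨continuous_const.mul hf.cont, hf.bdd.const_mul c, (hf.lim.const_mul c).congr fun t => ?_⟩
  rw [integral_const_mul]

theorem NL.sub (hK : IsProperConvexCone K) {X : AffineTransitionFamily K φ ψ} {x : V} (hx : x ∈ K)
    {f g : V → ℝ} {a c : ℝ} (hf : NL X x f a) (hg : NL X x g c) :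
    NL X x (fun y => f y - g y) (a - c) := by
  have := hf.add hK hx (hg.const_mul (-1))
  simpa [sub_eq_add_neg] using this

theorem NL.congr {X : AffineTransitionFamily K φ ψ} {x : V}
    {f g : V → ℝ} {a b : ℝ} (hf : NL X x f a) (h : ∀ y, f y = g y) (hab : a = b) : NL X x g b := by
  have : f = g := funext h
  subst this; subst hab; exact hf

theorem NL.sum (hK : IsProperConvexCone K) {X : AffineTransitionFamily K φ ψ} {x : V} (hx : x ∈ K)
    {ι : Type*} (s : Finset ι) {f : ι → V → ℝ} {a : ι → ℝ} (hf : ∀ i, NL X x (f i) (a i)) :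
    NL X x (fun y => ∑ i ∈ s, f i y) (∑ i ∈ s, a i) := by
  classical
  induction s using Finset.induction_on with
  | empty =>
    refine ⟨by simpa using continuous_const, by simpa using Bdd.const 0, by simp⟩
  | insert i s hi ih =>
    refine ((hf i).add hK hx ih).congr (fun y => ?_) ?_ <;> rw [Finset.sum_insert hi]

/-- the generator symbol at `x` -/
noncomputable def GG (F : V → ℝ) (R : V → V) (x u : V) : ℝ := F u + ⟪R u, x⟫

noncomputable def HH (F : V → ℝ) (R : V → V) (x u : V) : ℝ := GG F R x u - GG F R x 0

variable {F : V → ℝ} {R : V → V}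

theorem mass_lim (hK : IsProperConvexCone K) (X : AffineTransitionFamily K φ ψ)
    (hF : ∀ u ∈ dualCone K, HasDerivWithinAt (fun t => φ t u) (F u) (Set.Ici (0 : ℝ)) 0)
    (hR : ∀ u ∈ dualCone K, HasDerivWithinAt (fun t => ψ t u) (R u) (Set.Ici (0 : ℝ)) 0)
    {x : V} (hx : x ∈ K) :
    Tendsto (fun t => t⁻¹ * (1 - (X.p t x).real univ)) (𝓝[>] 0) (𝓝 (GG F R x 0)) := by
  have h := EE_tendsto hK X dual_zero_mem (hF 0 dual_zero_mem) (hR 0 dual_zero_mem) hx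
  simpa [GG] using h

theorem GG_zero_nonneg (hK : IsProperConvexCone K) (X : AffineTransitionFamily K φ ψ)
    (hF : ∀ u ∈ dualCone K, HasDerivWithinAt (fun t => φ t u) (F u) (Set.Ici (0 : ℝ)) 0)
    (hR : ∀ u ∈ dualCone K, HasDerivWithinAt (fun t => ψ t u) (R u) (Set.Ici (0 : ℝ)) 0)
    {x : V} (hx : x ∈ K) : 0 ≤ GG F R x 0 := by
  refine ge_of_tendsto (mass_lim hK X hF hR hx) ?_
  filter_upwards [self_mem_nhdsWithin] with t ht
  have h1 := p_mass_le X (le_of_lt ht) hx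
  have : (0:ℝ) < t := ht
  have h2 : 0 ≤ 1 - (X.p t x).real univ := by linarith
  positivity

theorem nu_exp_eq (hK : IsProperConvexCone K) (X : AffineTransitionFamily K φ ψ) {t : ℝ}
    (ht : 0 < t) {x : V} (hx : x ∈ K) {u : V} (hu : u ∈ dualCone K) :
    ∫ y, (1 - Real.exp (-⟪u, y⟫)) ∂(nu X x t) =
      t⁻¹ * (1 - ∫ ξ, Real.exp (-⟪u, ξ - x⟫) ∂(X.p t x)) - t⁻¹ * (1 - (X.p t x).real univ) := by
  have := p_fin X ht.le hx
  rw [nu_integral X ht x (by fun_prop), integral_sub (integrable_const _)]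
  · rw [integral_const, smul_eq_mul, mul_one]; ring
  · have h : ∀ ξ, Real.exp (-⟪u, ξ - x⟫) = Real.exp ⟪u, x⟫ * Real.exp (-⟪u, ξ⟫) := fun ξ => by
      rw [← Real.exp_add, inner_sub_right]; congr 1; ring
    simp only [h]
    exact (p_int X ht.le hx hu).const_mul _

theorem NL_exp (hK : IsProperConvexCone K) (X : AffineTransitionFamily K φ ψ)
    (hF : ∀ u ∈ dualCone K, HasDerivWithinAt (fun t => φ t u) (F u) (Set.Ici (0 : ℝ)) 0)
    (hR : ∀ u ∈ dualCone K, HasDerivWithinAt (fun t => ψ t u) (R u) (Set.Ici (0 : ℝ)) 0)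
    {x : V} (hx : x ∈ K) {u : V} (hu : u ∈ dualCone K) :
    NL X x (fun y => 1 - Real.exp (-⟪u, y⟫)) (HH F R x u) := by
  refine ⟨by fun_prop, (Bdd.const 1).sub (exp_bdd hu), ?_⟩
  have h := (EE_tendsto hK X hu (hF u hu) (hR u hu) hx).sub (mass_lim hK X hF hR hx)
  refine h.congr' ?_
  filter_upwards [self_mem_nhdsWithin] with t ht
  rw [nu_exp_eq hK X ht hx hu]

theorem NL_th (hK : IsProperConvexCone K) (X : AffineTransitionFamily K φ ψ)
    (hF : ∀ u ∈ dualCone K, HasDerivWithinAt (fun t => φ t u) (F u) (Set.Ici (0 : ℝ)) 0)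
    (hR : ∀ u ∈ dualCone K, HasDerivWithinAt (fun t => ψ t u) (R u) (Set.Ici (0 : ℝ)) 0)
    (B : Module.Basis (Fin n) ℝ V) (hB : ∀ i, B i ∈ sPos K)
    {x : V} (hx : x ∈ K) (i : Fin n) : NL X x (th B i) (HH F R x (B i)) :=
  NL_exp hK X hF hR hx (sPos_subset (hB i))

theorem NL_ta (hK : IsProperConvexCone K) (X : AffineTransitionFamily K φ ψ)
    (hF : ∀ u ∈ dualCone K, HasDerivWithinAt (fun t => φ t u) (F u) (Set.Ici (0 : ℝ)) 0)
    (hR : ∀ u ∈ dualCone K, HasDerivWithinAt (fun t => ψ t u) (R u) (Set.Ici (0 : ℝ)) 0)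
    (B : Module.Basis (Fin n) ℝ V) (hB : ∀ i, B i ∈ sPos K)
    {x : V} (hx : x ∈ K) (i : Fin n) :
    NL X x (ta B i) (2 * HH F R x (B i) - 1 / 2 * HH F R x ((2:ℝ) • B i)) :=
  ((NL_th hK X hF hR B hB hx i).const_mul 2).sub hK hx
    ((NL_exp hK X hF hR hx (dual_smul_mem two_pos.le (sPos_subset (hB i)))).const_mul (1 / 2))

theorem NL_thth (hK : IsProperConvexCone K) (X : AffineTransitionFamily K φ ψ)
    (hF : ∀ u ∈ dualCone K, HasDerivWithinAt (fun t => φ t u) (F u) (Set.Ici (0 : ℝ)) 0)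
    (hR : ∀ u ∈ dualCone K, HasDerivWithinAt (fun t => ψ t u) (R u) (Set.Ici (0 : ℝ)) 0)
    (B : Module.Basis (Fin n) ℝ V) (hB : ∀ i, B i ∈ sPos K)
    {x : V} (hx : x ∈ K) (i j : Fin n) :
    NL X x (fun y => th B i y * th B j y)
      (HH F R x (B i) + HH F R x (B j) - HH F R x (B i + B j)) := by
  refine (((NL_th hK X hF hR B hB hx i).add hK hx (NL_th hK X hF hR B hB hx j)).sub hK hx
    (NL_exp hK X hF hR hx (dual_add_mem (sPos_subset (hB i)) (sPos_subset (hB j))))).congr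
    (fun y => ?_) rfl
  unfold th
  rw [inner_add_left, neg_add, Real.exp_add]
  ring

theorem NL_hhexp (hK : IsProperConvexCone K) (X : AffineTransitionFamily K φ ψ)
    (hF : ∀ u ∈ dualCone K, HasDerivWithinAt (fun t => φ t u) (F u) (Set.Ici (0 : ℝ)) 0)
    (hR : ∀ u ∈ dualCone K, HasDerivWithinAt (fun t => ψ t u) (R u) (Set.Ici (0 : ℝ)) 0)
    (B : Module.Basis (Fin n) ℝ V) (hB : ∀ i, B i ∈ sPos K)
    {x : V} (hx : x ∈ K) {u : V} (hu : u ∈ dualCone K) :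
    NL X x (fun y => hh B y * Real.exp (-⟪u, y⟫))
      (∑ i, (2 * HH F R x (u + B i) - HH F R x u - HH F R x (u + (2:ℝ) • B i))) := by
  have h : ∀ i, NL X x (fun y => th B i y ^ 2 * Real.exp (-⟪u, y⟫))
      (2 * HH F R x (u + B i) - HH F R x u - HH F R x (u + (2:ℝ) • B i)) := by
    intro i
    refine ((((NL_exp hK X hF hR hx (dual_add_mem hu (sPos_subset (hB i)))).const_mul 2).sub hK hx
      (NL_exp hK X hF hR hx hu)).sub hK hx (NL_exp hK X hF hR hx (dual_add_mem hu
        (dual_smul_mem two_pos.le (sPos_subset (hB i)))))).congr (fun y => ?_) rfl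
    unfold th
    rw [inner_add_left, inner_add_left, real_inner_smul_left, neg_add, neg_add, Real.exp_add,
      Real.exp_add, show -(2 * ⟪B i, y⟫) = -⟪B i, y⟫ + -⟪B i, y⟫ by ring, Real.exp_add]
    ring
  refine (NL.sum hK hx Finset.univ h).congr (fun y => ?_) rfl
  rw [hh, Finset.sum_mul]

theorem HH_zero (F : V → ℝ) (R : V → V) (x : V) : HH F R x 0 = 0 := sub_self _

theorem NL_hh (hK : IsProperConvexCone K) (X : AffineTransitionFamily K φ ψ)
    (hF : ∀ u ∈ dualCone K, HasDerivWithinAt (fun t => φ t u) (F u) (Set.Ici (0 : ℝ)) 0)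
    (hR : ∀ u ∈ dualCone K, HasDerivWithinAt (fun t => ψ t u) (R u) (Set.Ici (0 : ℝ)) 0)
    (B : Module.Basis (Fin n) ℝ V) (hB : ∀ i, B i ∈ sPos K)
    {x : V} (hx : x ∈ K) :
    NL X x (hh B) (∑ i, (2 * HH F R x (B i) - HH F R x ((2:ℝ) • B i))) := by
  refine (NL_hhexp hK X hF hR B hB hx dual_zero_mem).congr (fun y => by simp) ?_
  simp [HH_zero]

end NuLim

section ContZero

set_option linter.unusedSectionVars false
set_option linter.unusedVariables false

variable {K : Set V} {φ : ℝ → V → ℝ} {ψ : ℝ → V → V} {n : ℕ} {F : V → ℝ} {R : V → V}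

noncomputable def EE (X : AffineTransitionFamily K φ ψ) (x : V) (s : ℝ) (z : V) : ℝ :=
  1 - ∫ ξ, Real.exp (-⟪z, ξ - x⟫) ∂(X.p s x)

theorem p_int' (X : AffineTransitionFamily K φ ψ) {t : ℝ} (ht : 0 ≤ t) {x : V} (hx : x ∈ K)
    {u : V} (hu : u ∈ dualCone K) : Integrable (fun ξ => Real.exp (-⟪u, ξ - x⟫)) (X.p t x) := by
  have h : ∀ ξ, Real.exp (-⟪u, ξ - x⟫) = Real.exp ⟪u, x⟫ * Real.exp (-⟪u, ξ⟫) := fun ξ => by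
      rw [← Real.exp_add, inner_sub_right]; congr 1; ring
  simp only [h]
  exact (p_int X ht hx hu).const_mul _

theorem EE_concave (X : AffineTransitionFamily K φ ψ) {t : ℝ} (ht : 0 ≤ t) {x : V} (hx : x ∈ K) :
    ConcaveOn ℝ (dualCone K) (EE X x t) := by
  refine ⟨dual_convex, fun u hu v hv a c ha hc hac => ?_⟩
  have h : ∫ ξ, Real.exp (-⟪a • u + c • v, ξ - x⟫) ∂(X.p t x) ≤
      ∫ ξ, (a * Real.exp (-⟪u, ξ - x⟫) + c * Real.exp (-⟪v, ξ - x⟫)) ∂(X.p t x) := by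
    refine integral_mono (p_int' X ht hx (dual_convex hu hv ha hc hac))
      (((p_int' X ht hx hu).const_mul a).add ((p_int' X ht hx hv).const_mul c)) fun ξ => ?_
    have := convexOn_exp.2 (mem_univ (-⟪u, ξ - x⟫)) (mem_univ (-⟪v, ξ - x⟫)) ha hc hac
    simp only [smul_eq_mul] at this
    refine le_trans (le_of_eq ?_) this
    rw [inner_add_left, real_inner_smul_left, real_inner_smul_left]
    congr 1; ring
  rw [integral_add ((p_int' X ht hx hu).const_mul a) ((p_int' X ht hx hv).const_mul c),
    integral_const_mul, integral_const_mul] at h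
  unfold EE
  simp only [smul_eq_mul]
  nlinarith

theorem GG_concave (hK : IsProperConvexCone K) (X : AffineTransitionFamily K φ ψ)
    (hF : ∀ u ∈ dualCone K, HasDerivWithinAt (fun t => φ t u) (F u) (Set.Ici (0 : ℝ)) 0)
    (hR : ∀ u ∈ dualCone K, HasDerivWithinAt (fun t => ψ t u) (R u) (Set.Ici (0 : ℝ)) 0)
    {x : V} (hx : x ∈ K) : ConcaveOn ℝ (dualCone K) (GG F R x) := by
  refine ⟨dual_convex, fun u hu v hv a c ha hc hac => ?_⟩
  have hT := fun u hu => EE_tendsto hK X hu (hF u hu) (hR u hu) hx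
  refine le_of_tendsto_of_tendsto (((hT u hu).const_mul a).add ((hT v hv).const_mul c))
    (hT _ (dual_convex hu hv ha hc hac)) ?_
  filter_upwards [self_mem_nhdsWithin] with t ht
  have ht' : (0:ℝ) < t := ht
  have := (EE_concave X ht'.le hx).2 hu hv ha hc hac
  unfold EE at this
  simp only [smul_eq_mul] at this
  have h2 : 0 < t⁻¹ := by positivity
  have := mul_le_mul_of_nonneg_left this h2.le
  linarith

theorem EE_le_ff (X : AffineTransitionFamily K φ ψ) {t : ℝ} (ht : 0 ≤ t) {x : V} (hx : x ∈ K)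
    {u : V} (hu : u ∈ dualCone K) : EE X x t u ≤ ff φ ψ x t u := by
  unfold EE
  rw [ff_lap X ht hx hu]
  have := Real.add_one_le_exp (-ff φ ψ x t u)
  linarith

theorem order_bdd (hK : IsProperConvexCone K) (B : Module.Basis (Fin n) ℝ V) (u0 : V) :
    ∃ M, 0 ≤ M ∧ ∀ z ∈ dualCone K, u0 - z ∈ dualCone K → ∀ i, |B.repr z i| ≤ M := by
  have h : ∀ i, ∃ M, ∀ z ∈ dualCone K, u0 - z ∈ dualCone K → |B.repr z i| ≤ M := by
    intro i
    let w := (InnerProductSpace.toDual ℝ V).symm (LinearMap.toContinuousLinearMap (B.coord i))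
    have hw : ∀ z, ⟪w, z⟫ = B.repr z i := fun z => by simp [w]
    obtain ⟨a, ha, b, hb, hab⟩ := hK.generating w
    refine ⟨⟪a, u0⟫ + ⟪b, u0⟫, fun z hz hz' => ?_⟩
    rw [← hw, hab, inner_sub_left]
    have h1 := hz a ha
    have h2 := hz b hb
    have h3 := hz' a ha
    have h4 := hz' b hb
    rw [inner_sub_right] at h3 h4
    rw [abs_le]; constructor <;> linarith
  choose M hM using h
  refine ⟨∑ i, |M i|, Finset.sum_nonneg fun i _ => abs_nonneg _, fun z hz hz' i => ?_⟩
  exact (hM i z hz hz').trans ((le_abs_self _).trans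
    (Finset.single_le_sum (f := fun i => |M i|) (fun i _ => abs_nonneg _) (Finset.mem_univ i)))

theorem EE_lower (hK : IsProperConvexCone K) (X : AffineTransitionFamily K φ ψ)
    (hF : ∀ u ∈ dualCone K, HasDerivWithinAt (fun t => φ t u) (F u) (Set.Ici (0 : ℝ)) 0)
    (hR : ∀ u ∈ dualCone K, HasDerivWithinAt (fun t => ψ t u) (R u) (Set.Ici (0 : ℝ)) 0)
    (B : Module.Basis (Fin n) ℝ V) (hB : ∀ i, B i ∈ sPos K)
    {x : V} (hx : x ∈ K) {M : ℝ} (hM : 0 ≤ M) :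
    ∃ C, 0 ≤ C ∧ ∀ᶠ s in 𝓝[>] (0:ℝ), ∀ z ∈ dualCone K, (∀ i, |B.repr z i| ≤ M) →
      -C * s ≤ EE X x s z := by
  obtain ⟨C, hC, h⟩ := L4 hK B hB x hM
  have hth := NL_th hK X hF hR B hB hx
  have hhh := NL_hh hK X hF hR B hB hx
  have hl : Tendsto (fun s => M * ∑ i, |∫ y, th B i y ∂(nu X x s)| + C * ∫ y, hh B y ∂(nu X x s))
      (𝓝[>] 0) (𝓝 (M * ∑ i, |HH F R x (B i)| +
        C * ∑ i, (2 * HH F R x (B i) - HH F R x ((2:ℝ) • B i)))) :=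
    ((tendsto_finsetSum _ fun i _ => (hth i).lim.abs).const_mul M).add (hhh.lim.const_mul C)
  set L := M * ∑ i, |HH F R x (B i)| + C * ∑ i, (2 * HH F R x (B i) - HH F R x ((2:ℝ) • B i))
  refine ⟨|L| + 1, by positivity, ?_⟩
  have hev := hl.eventually_lt_const (show L < |L| + 1 by linarith [le_abs_self L])
  filter_upwards [hev, self_mem_nhdsWithin] with s hs hs0 z hz hzM
  have hs0' : (0:ℝ) < s := hs0
  have i1 := nu_integrable hK X hs0' hx (f := fun y => ∑ i, B.repr z i * th B i y)
    (by have := th_cont B; fun_prop) (Bdd.sum _ fun i => (hth i).bdd.const_mul _)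
  have i2 := nu_integrable hK X hs0' hx (f := fun y => C * hh B y)
    (by have := hh_cont B; fun_prop) (hhh.bdd.const_mul _)
  have i3 := nu_integrable hK X hs0' hx (f := fun y => 1 - Real.exp (-⟪z, y⟫))
    (by fun_prop) ((Bdd.const 1).sub (exp_bdd hz))
  have h1 : ∫ y, (∑ i, B.repr z i * th B i y - C * hh B y) ∂(nu X x s) ≤
      ∫ y, (1 - Real.exp (-⟪z, y⟫)) ∂(nu X x s) := by
    refine integral_mono_ae (i1.sub i2) i3 ?_
    filter_upwards [nu_ae hK X hs0' hx] with y hy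
    have := h z hz hzM y hy
    linarith
  rw [integral_sub i1 i2, integral_finsetSum _ fun i _ =>
    (nu_integrable hK X hs0' hx (hth i).cont (hth i).bdd).const_mul _, integral_const_mul] at h1
  simp only [integral_const_mul] at h1
  have h2 : -(M * ∑ i, |∫ y, th B i y ∂(nu X x s)|) ≤
      ∑ i, B.repr z i * ∫ y, th B i y ∂(nu X x s) := by
    rw [Finset.mul_sum, ← Finset.sum_neg_distrib]
    refine Finset.sum_le_sum fun i _ => ?_
    refine le_trans ?_ (neg_abs_le _)
    rw [abs_mul]
    have := mul_le_mul_of_nonneg_right (hzM i) (abs_nonneg (∫ y, th B i y ∂(nu X x s)))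
    linarith
  have h3 := nu_exp_eq hK X hs0' hx hz
  have h4 := p_mass_le X hs0'.le hx
  have h5 : 0 ≤ s⁻¹ * (1 - (X.p s x).real univ) := mul_nonneg (by positivity) (by linarith)
  have h6 : -(|L| + 1) ≤ s⁻¹ * EE X x s z := by unfold EE; linarith
  have h7 := mul_le_mul_of_nonneg_left h6 hs0'.le
  rw [← mul_assoc, mul_inv_cancel₀ hs0'.ne', one_mul] at h7
  linarith

theorem ff_sum (hK : IsProperConvexCone K) (X : AffineTransitionFamily K φ ψ) {τ : ℝ} (hτ : 0 ≤ τ)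
    {u : V} (hu : u ∈ dualCone K) (x : V) (m : ℕ) :
    ff φ ψ x (m * τ) u = ∑ k ∈ Finset.range m, ff φ ψ x τ (ψ (k * τ) u) := by
  induction m with
  | zero => simp [ff_zero hK X hu]
  | succ m ih =>
    rw [Finset.sum_range_succ, ← ih, ← ff_semiflow hK X (by positivity) hτ hu]
    congr 1; push_cast; ring

theorem psi_cont_zero (hK : IsProperConvexCone K) (X : AffineTransitionFamily K φ ψ)
    (hR : ∀ u ∈ dualCone K, HasDerivWithinAt (fun t => ψ t u) (R u) (Set.Ici (0 : ℝ)) 0)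
    {u : V} (hu : u ∈ dualCone K) : Tendsto (fun t => ψ t u) (𝓝[≥] 0) (𝓝 u) := by
  have := (hR u hu).continuousWithinAt
  change Tendsto _ _ (𝓝 (ψ 0 u)) at this
  rwa [(init_eq hK X hu).2] at this

theorem key_ineq (hK : IsProperConvexCone K) (X : AffineTransitionFamily K φ ψ)
    (hF : ∀ u ∈ dualCone K, HasDerivWithinAt (fun t => φ t u) (F u) (Set.Ici (0 : ℝ)) 0)
    (hR : ∀ u ∈ dualCone K, HasDerivWithinAt (fun t => ψ t u) (R u) (Set.Ici (0 : ℝ)) 0)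
    {x : V} (hx : x ∈ K) {u0 : V} (hu0 : u0 ∈ sPos K) :
    ∃ C, 0 ≤ C ∧ ∀ θ : ℝ, 0 < θ → θ < 1 → ∀ᶠ t in 𝓝[>] (0:ℝ), ∀ᶠ j in atTop (α := ℕ),
      t * ((1 - θ) * GG F R x ((1/2:ℝ) ^ (j + 1) • u0) - θ * C) ≤
        ff φ ψ x t ((1/2:ℝ) ^ j • u0) := by
  obtain ⟨n, B, hB⟩ := exists_basis_sPos hK
  obtain ⟨M, hM, hMz⟩ := order_bdd hK B u0
  obtain ⟨C, hC, hev⟩ := EE_lower hK X hF hR B hB hx hM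
  refine ⟨C, hC, fun θ h0 h1 => ?_⟩
  have hu := sPos_subset hu0
  obtain ⟨j1, hj1⟩ := exists_pow_lt_of_lt_one (show (0:ℝ) < θ / 4 by positivity)
    (show (1/2:ℝ) < 1 by norm_num)
  set l1 := (1/2:ℝ) ^ j1
  have hl1 : 0 < l1 := by positivity
  have e1 : ∀ᶠ s in 𝓝[≥] (0:ℝ), ψ s u0 - (1/2:ℝ) • u0 ∈ dualCone K := by
    have := (psi_cont_zero hK X hR hu).sub_const ((1/2:ℝ) • u0)
    have hm : u0 - (1/2:ℝ) • u0 ∈ sPos K := by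
      rw [show u0 - (1/2:ℝ) • u0 = (1/2:ℝ) • u0 by module]
      exact sPos_smul (by norm_num) hu0
    filter_upwards [this.eventually (sPos_isOpen.mem_nhds hm)] with s hs using sPos_subset hs
  have e2 : ∀ᶠ s in 𝓝[≥] (0:ℝ), (2 * l1) • u0 - ψ s (l1 • u0) ∈ dualCone K := by
    have := (psi_cont_zero hK X hR (dual_smul_mem hl1.le hu)).const_sub ((2 * l1) • u0)
    have hm : (2 * l1) • u0 - l1 • u0 ∈ sPos K := by
      rw [show (2 * l1) • u0 - l1 • u0 = l1 • u0 by module]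
      exact sPos_smul hl1 hu0
    filter_upwards [this.eventually (sPos_isOpen.mem_nhds hm)] with s hs using sPos_subset hs
  obtain ⟨δ, hδ, hδs⟩ := mem_nhdsGE_iff_exists_Icc_subset.1 (e1.and e2)
  have hδ' : (0:ℝ) < δ := hδ
  filter_upwards [Ioc_mem_nhdsGT hδ'] with t ht
  filter_upwards [eventually_ge_atTop j1] with j hj
  set l := (1/2:ℝ) ^ j
  have hl : 0 < l := by positivity
  have hll1 : l ≤ l1 := pow_le_pow_of_le_one (by norm_num) (by norm_num) hj
  set w := (1/2:ℝ) ^ (j + 1) • u0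
  have hwl : w = (1/2:ℝ) • l • u0 := by simp only [w, l, pow_succ', mul_smul]
  have hw : w ∈ dualCone K := dual_smul_mem (by positivity) hu
  have hvu : l • u0 ∈ dualCone K := dual_smul_mem hl.le hu
  -- pointwise step
  have step : ∀ τ, 0 < τ → (∀ z ∈ dualCone K, (∀ i, |B.repr z i| ≤ M) → -C * τ ≤ EE X x τ z) →
      ∀ s ∈ Icc 0 δ, (1 - θ) * EE X x τ w - θ * (C * τ) ≤ ff φ ψ x τ (ψ s (l • u0)) := by
    intro τ hτ hEE s hs
    obtain ⟨a1, a2⟩ := hδs hs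
    set v := ψ s (l • u0)
    have b1 : v - w ∈ dualCone K := by
      have c1 := dual_add_mem (psi_half_pow hK X hs.1 hu j) (dual_smul_mem hl.le a1)
      convert c1 using 1
      rw [hwl]; module
    have b2 : (θ / 2) • u0 - v ∈ dualCone K := by
      have c1 : ψ s (l1 • u0) - v ∈ dualCone K := psi_mono hK X hs.1 hvu (by
        rw [← sub_smul]; exact dual_smul_mem (by linarith) hu)
      have c2 : (θ / 2 - 2 * l1) • u0 ∈ dualCone K := dual_smul_mem (by linarith) hu
      convert dual_add_mem c2 (dual_add_mem a2 c1) using 1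
      module
    have hz : w + θ⁻¹ • (v - w) ∈ dualCone K :=
      dual_add_mem hw (dual_smul_mem (by positivity) b1)
    have hz' : u0 - (w + θ⁻¹ • (v - w)) ∈ dualCone K := by
      have c1 : (1/2:ℝ) • u0 ∈ dualCone K := dual_smul_mem (by norm_num) hu
      have c2 : (θ⁻¹ - 1) • w ∈ dualCone K :=
        dual_smul_mem (by have := (one_lt_inv₀ h0).2 h1; linarith) hw
      have c3 := dual_smul_mem (c := θ⁻¹) (by positivity) b2
      convert dual_add_mem c1 (dual_add_mem c2 c3) using 1
      rw [smul_sub θ⁻¹ _ v, smul_smul θ⁻¹, show θ⁻¹ * (θ / 2) = 1 / 2 by field_simp]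
      module
    have hv : v ∈ dualCone K := psi_mem hK X hs.1 hvu
    have d1 := (EE_concave X hτ.le hx).2 hw hz (show 0 ≤ 1 - θ by linarith) h0.le (by ring)
    rw [show (1 - θ) • w + θ • (w + θ⁻¹ • (v - w)) = v by
      rw [smul_add θ, smul_smul θ θ⁻¹, mul_inv_cancel₀ h0.ne']; module] at d1
    have d2 := EE_le_ff X hτ.le hx hv
    have d3 := mul_le_mul_of_nonneg_left (hEE _ hz (hMz _ hz hz')) h0.le
    simp only [smul_eq_mul] at d1
    linarith
  -- limit
  have hτ : Tendsto (fun m : ℕ => t / (m + 1 : ℕ)) atTop (𝓝[>] 0) := by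
    refine tendsto_nhdsWithin_iff.2 ⟨?_, Eventually.of_forall fun m => ?_⟩
    · exact (tendsto_const_div_atTop_nhds_zero_nat t).comp (tendsto_add_atTop_nat 1)
    · have := ht.1
      simp only [mem_Ioi]; positivity
  have hlim := (((EE_tendsto hK X hw (hF w hw) (hR w hw) hx).comp hτ).const_mul
    (1 - θ)).sub_const (θ * C) |>.const_mul t
  refine le_of_tendsto hlim ?_
  filter_upwards [hτ.eventually hev] with m hm
  set τ := t / (m + 1 : ℕ) with hτd
  have htp := ht.1
  have hτp : 0 < τ := by positivity
  have hmt : ((m + 1 : ℕ) : ℝ) * τ = t := by rw [hτd]; field_simp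
  have hsum := ff_sum hK X hτp.le hvu x (m + 1)
  rw [hmt] at hsum
  rw [hsum]
  have hge : ∑ k ∈ Finset.range (m + 1), ((1 - θ) * EE X x τ w - θ * (C * τ)) ≤
      ∑ k ∈ Finset.range (m + 1), ff φ ψ x τ (ψ (k * τ) (l • u0)) := by
    refine Finset.sum_le_sum fun k hk => step τ hτp hm _ ⟨by positivity, ?_⟩
    have hk' : (k:ℝ) ≤ ((m + 1 : ℕ) : ℝ) := by exact_mod_cast (Finset.mem_range.1 hk).le
    calc (k:ℝ) * τ ≤ ((m + 1 : ℕ) : ℝ) * τ := by gcongr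
      _ ≤ δ := by rw [hmt]; exact ht.2
  refine le_trans (le_of_eq ?_) hge
  rw [Finset.sum_const, Finset.card_range, nsmul_eq_mul]
  simp only [Function.comp_apply]
  change t * ((1 - θ) * (τ⁻¹ * EE X x τ w) - θ * C) = _
  rw [← hmt]
  field_simp

theorem lap_tendsto_zero (X : AffineTransitionFamily K φ ψ) {t : ℝ} (ht : 0 ≤ t) {x : V}
    (hx : x ∈ K) {u0 : V} (hu : u0 ∈ dualCone K) :
    Tendsto (fun j : ℕ => Real.exp (-ff φ ψ x t ((1/2:ℝ) ^ j • u0))) atTop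
      (𝓝 (Real.exp (-ff φ ψ x t 0))) := by
  have := p_fin X ht hx
  rw [← ff_lap X ht hx dual_zero_mem]
  have h : ∀ j : ℕ, Real.exp (-ff φ ψ x t ((1/2:ℝ) ^ j • u0)) =
      ∫ ξ, Real.exp (-⟪(1/2:ℝ) ^ j • u0, ξ - x⟫) ∂(X.p t x) := fun j =>
    (ff_lap X ht hx (dual_smul_mem (by positivity) hu)).symm
  simp only [h]
  refine tendsto_integral_of_dominated_convergence (fun _ => Real.exp ⟪u0, x⟫)
    (fun j => by fun_prop) (integrable_const _) (fun j => ?_) (Eventually.of_forall fun ξ => ?_)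
  · filter_upwards [p_ae X ht hx] with ξ hξ
    rw [Real.norm_of_nonneg (Real.exp_pos _).le, Real.exp_le_exp, real_inner_smul_left,
      inner_sub_right]
    have h1 := dual_nonneg hu hξ
    have h2 := dual_nonneg hu hx
    have h3 : (1/2:ℝ) ^ j ≤ 1 := pow_le_one₀ (by norm_num) (by norm_num)
    have h4 : (0:ℝ) ≤ (1/2:ℝ) ^ j := by positivity
    nlinarith [mul_nonneg h4 h1]
  · have hc : Continuous fun v : V => Real.exp (-⟪v, ξ - x⟫) := by fun_prop
    have h1 : Tendsto (fun j : ℕ => (1/2:ℝ) ^ j • u0) atTop (𝓝 0) := by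
      simpa using (tendsto_pow_atTop_nhds_zero_of_lt_one (r := (1/2:ℝ)) (by norm_num)
        (by norm_num)).smul_const u0
    exact (hc.tendsto 0).comp h1

theorem GG_limsup (hK : IsProperConvexCone K) (X : AffineTransitionFamily K φ ψ)
    (hF : ∀ u ∈ dualCone K, HasDerivWithinAt (fun t => φ t u) (F u) (Set.Ici (0 : ℝ)) 0)
    (hR : ∀ u ∈ dualCone K, HasDerivWithinAt (fun t => ψ t u) (R u) (Set.Ici (0 : ℝ)) 0)
    {x : V} (hx : x ∈ K) {u0 : V} (hu0 : u0 ∈ sPos K) {η : ℝ} (hη : 0 < η) :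
    ∀ᶠ j in atTop (α := ℕ), GG F R x ((1/2:ℝ) ^ j • u0) ≤ GG F R x 0 + η := by
  obtain ⟨C, hC, hkey⟩ := key_ineq hK X hF hR hx hu0
  have hG0 := GG_zero_nonneg hK X hF hR hx
  set g0 := GG F R x 0
  by_contra hcon
  have hfreq : ∃ᶠ j in atTop (α := ℕ), g0 + η ≤ GG F R x ((1/2:ℝ) ^ (j + 1) • u0) := by
    intro hno
    apply hcon
    rw [← map_add_atTop_eq_nat 1, eventually_map]
    filter_upwards [hno] with j hj
    push Not at hj
    exact hj.le
  set θ := η / (2 * (g0 + η + C)) with hθ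
  have hs : 0 < g0 + η + C := by linarith
  have h0 : 0 < θ := by positivity
  have hθs : θ * (g0 + η + C) = η / 2 := by rw [hθ]; field_simp
  have h1 : θ < 1 := by
    rw [hθ, div_lt_one (by positivity)]; linarith
  have hfin : ∀ᶠ t in 𝓝[>] (0:ℝ), (1 - θ) * (g0 + η) - θ * C ≤ t⁻¹ * ff φ ψ x t 0 := by
    filter_upwards [hkey θ h0 h1, self_mem_nhdsWithin] with t ht ht0
    have ht0' : (0:ℝ) < t := ht0
    have hb : Real.exp (-ff φ ψ x t 0) ≤ Real.exp (-(t * ((1 - θ) * (g0 + η) - θ * C))) := by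
      refine le_of_tendsto_of_frequently (lap_tendsto_zero X ht0'.le hx (sPos_subset hu0)) ?_
      refine (hfreq.and_eventually ht).mono ?_
      rintro j ⟨a1, a2⟩
      apply Real.exp_le_exp.2
      have h3 : (1 - θ) * (g0 + η) ≤ (1 - θ) * GG F R x ((1/2:ℝ) ^ (j + 1) • u0) :=
        mul_le_mul_of_nonneg_left a1 (by linarith)
      have h4 : t * ((1 - θ) * (g0 + η) - θ * C) ≤
          t * ((1 - θ) * GG F R x ((1/2:ℝ) ^ (j + 1) • u0) - θ * C) := by gcongr
      linarith
    rw [Real.exp_le_exp] at hb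
    rw [le_inv_mul_iff₀ ht0']
    linarith
  have := ge_of_tendsto (ff_tendsto hK X dual_zero_mem (hF 0 dual_zero_mem) (hR 0 dual_zero_mem) x)
    hfin
  change _ ≤ g0 at this
  nlinarith

end ContZero

section Rho

set_option linter.unusedSectionVars false
set_option linter.unusedVariables false

theorem prohorov {μ : ℕ → Measure V} [hfin : ∀ k, IsFiniteMeasure (μ k)] (C : NNReal)
    (hC : ∀ k, μ k univ ≤ C)
    (ht : ∀ η : ℝ≥0∞, 0 < η → ∃ r : ℝ, ∀ᶠ k in atTop, μ k {y | r < ‖y‖} ≤ η) :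
    ∃ ρ : Measure V, IsFiniteMeasure ρ ∧ ∃ l : Filter ℕ, l.NeBot ∧ l ≤ atTop ∧
      ∀ f : BoundedContinuousFunction V ℝ, Tendsto (fun k => ∫ y, f y ∂(μ k)) l (𝓝 (∫ y, f y ∂ρ)) := by
  have : ProperSpace V := FiniteDimensional.proper ℝ V
  have htight : IsTightMeasureSet (range μ) := by
    apply isTightMeasureSet_range_of_tendsto_limsup_measure_norm_gt
    rw [ENNReal.tendsto_nhds_zero]
    intro ε hε
    obtain ⟨r, hr⟩ := ht ε hε
    filter_upwards [eventually_ge_atTop r] with s hs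
    refine limsup_le_of_le (by isBoundedDefault) ?_
    filter_upwards [hr] with k hk
    refine le_trans (measure_mono ?_) hk
    intro y (hy : s < ‖y‖)
    exact lt_of_le_of_lt hs hy
  rw [isTightMeasureSet_iff_exists_isCompact_measure_compl_le] at htight
  have hu : ∀ n : ℕ, (0:ℝ≥0∞) < (((1 / ((n:NNReal) + 1) : NNReal)) : ℝ≥0∞) := fun n => by
    rw [ENNReal.coe_pos]; positivity
  choose Kn hKn hKn' using fun n : ℕ => htight _ (hu n)
  have hcomp := isCompact_setOfPred_finiteMeasure_mass_le_compl_isCompact_le (E := V)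
    (u := fun n : ℕ => (1 / ((n:NNReal) + 1) : NNReal)) (K := Kn) C
    (tendsto_one_div_add_atTop_nhds_zero_nat (𝕜 := NNReal)) hKn (Or.inl inferInstance)
  let μ' : ℕ → FiniteMeasure V := fun k => ⟨μ k, hfin k⟩
  obtain ⟨ρ, hρ, hlim⟩ := hcomp.ultrafilter_le_nhds' ((hyperfilter ℕ).map μ') (by
    rw [Ultrafilter.mem_map]
    refine Filter.Eventually.of_forall (f := (hyperfilter ℕ : Filter ℕ)) fun k => ?_
    refine ⟨?_, fun n => ?_⟩
    · rw [← ENNReal.coe_le_coe, FiniteMeasure.ennreal_mass]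
      exact hC k
    · rw [← ENNReal.coe_le_coe, FiniteMeasure.ennreal_coeFn_eq_coeFn_toMeasure]
      exact hKn' n _ (mem_range_self k))
  refine ⟨ρ, inferInstance, hyperfilter ℕ, inferInstance, Nat.hyperfilter_le_atTop, ?_⟩
  have : Tendsto μ' (hyperfilter ℕ) (𝓝 ρ) := hlim
  rw [FiniteMeasure.tendsto_iff_forall_integral_tendsto] at this
  exact this

variable {K : Set V} {φ : ℝ → V → ℝ} {ψ : ℝ → V → V} {n : ℕ} {F : V → ℝ} {R : V → V}

theorem GG_cont (hK : IsProperConvexCone K) (X : AffineTransitionFamily K φ ψ)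
    (hF : ∀ u ∈ dualCone K, HasDerivWithinAt (fun t => φ t u) (F u) (Set.Ici (0 : ℝ)) 0)
    (hR : ∀ u ∈ dualCone K, HasDerivWithinAt (fun t => ψ t u) (R u) (Set.Ici (0 : ℝ)) 0)
    {x : V} (hx : x ∈ K) : ContinuousOn (GG F R x) (sPos K) :=
  ((GG_concave hK X hF hR hx).subset sPos_subset sPos_convex).continuousOn sPos_isOpen

theorem LL_small (hK : IsProperConvexCone K) (X : AffineTransitionFamily K φ ψ)
    (hF : ∀ u ∈ dualCone K, HasDerivWithinAt (fun t => φ t u) (F u) (Set.Ici (0 : ℝ)) 0)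
    (hR : ∀ u ∈ dualCone K, HasDerivWithinAt (fun t => ψ t u) (R u) (Set.Ici (0 : ℝ)) 0)
    (B : Module.Basis (Fin n) ℝ V) (hB : ∀ i, B i ∈ sPos K)
    {x : V} (hx : x ∈ K) {u0 : V} (hu0 : u0 ∈ sPos K) {η : ℝ} (hη : 0 < η) :
    ∃ j : ℕ, (∑ i, (2 * HH F R x (B i) - HH F R x ((2:ℝ) • B i))) -
      Real.exp (-⟪(1/2:ℝ) ^ j • u0, x⟫) *
       (∑ i, (2 * HH F R x ((1/2:ℝ) ^ j • u0 + B i) - HH F R x ((1/2:ℝ) ^ j • u0) -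
          HH F R x ((1/2:ℝ) ^ j • u0 + (2:ℝ) • B i))) < η := by
  have hp : Tendsto (fun j : ℕ => (1/2:ℝ) ^ j • u0) atTop (𝓝 0) := by
    have := (tendsto_pow_atTop_nhds_zero_of_lt_one (r := (1/2:ℝ)) (by norm_num)
      (by norm_num)).smul_const u0
    simpa using this
  have hH : ∀ v ∈ sPos K, Tendsto (fun j : ℕ => HH F R x ((1/2:ℝ) ^ j • u0 + v)) atTop
      (𝓝 (HH F R x v)) := by
    intro v hv
    have h1 : ContinuousAt (GG F R x) v := (GG_cont hK X hF hR hx).continuousAt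
      (sPos_isOpen.mem_nhds hv)
    have h2 : Tendsto (fun j : ℕ => (1/2:ℝ) ^ j • u0 + v) atTop (𝓝 v) := by
      simpa using hp.add_const v
    exact (h1.tendsto.comp h2).sub_const _
  have he : Tendsto (fun j : ℕ => Real.exp (-⟪(1/2:ℝ) ^ j • u0, x⟫)) atTop (𝓝 1) := by
    have h1 : Tendsto (fun z : V => Real.exp (-⟪z, x⟫)) (𝓝 0) (𝓝 1) := by
      have : Continuous (fun z : V => Real.exp (-⟪z, x⟫)) := by fun_prop
      simpa using this.tendsto 0
    exact h1.comp hp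
  have hA : Tendsto (fun j : ℕ => ∑ i, (2 * HH F R x ((1/2:ℝ) ^ j • u0 + B i) -
      HH F R x ((1/2:ℝ) ^ j • u0 + (2:ℝ) • B i))) atTop
      (𝓝 (∑ i, (2 * HH F R x (B i) - HH F R x ((2:ℝ) • B i)))) :=
    tendsto_finsetSum _ fun i _ => ((hH _ (hB i)).const_mul 2).sub
      (hH _ (sPos_smul (by norm_num) (hB i)))
  set L0 := ∑ i, (2 * HH F R x (B i) - HH F R x ((2:ℝ) • B i)) with hL0
  have hl : Tendsto (fun j : ℕ => L0 - Real.exp (-⟪(1/2:ℝ) ^ j • u0, x⟫) *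
      ((∑ i, (2 * HH F R x ((1/2:ℝ) ^ j • u0 + B i) -
      HH F R x ((1/2:ℝ) ^ j • u0 + (2:ℝ) • B i))) - n * (η / (2 * (n + 1))))) atTop
      (𝓝 (L0 - 1 * (L0 - n * (η / (2 * (n + 1)))))) :=
    (he.mul (hA.sub_const _)).const_sub _
  have hlt : L0 - 1 * (L0 - n * (η / (2 * (n + 1)))) < η := by
    have : (n:ℝ) * (η / (2 * (n + 1))) < η := by
      rw [← mul_div_assoc, div_lt_iff₀ (by positivity)]
      nlinarith [(Nat.cast_nonneg n : (0:ℝ) ≤ n)]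
    linarith
  obtain ⟨j, hj1, hj2⟩ := ((hl.eventually_lt_const hlt).and
    (GG_limsup hK X hF hR hx hu0 (η := η / (2 * (n + 1))) (by positivity))).exists
  refine ⟨j, lt_of_le_of_lt ?_ hj1⟩
  have hj2' : HH F R x ((1/2:ℝ) ^ j • u0) ≤ η / (2 * (n + 1)) := by
    unfold HH; linarith
  have : ∑ i, (2 * HH F R x ((1/2:ℝ) ^ j • u0 + B i) - HH F R x ((1/2:ℝ) ^ j • u0) -
          HH F R x ((1/2:ℝ) ^ j • u0 + (2:ℝ) • B i)) =
      (∑ i, (2 * HH F R x ((1/2:ℝ) ^ j • u0 + B i) -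
      HH F R x ((1/2:ℝ) ^ j • u0 + (2:ℝ) • B i))) - n * HH F R x ((1/2:ℝ) ^ j • u0) := by
    have h3 : (n:ℝ) * HH F R x ((1/2:ℝ) ^ j • u0) = ∑ i : Fin n, HH F R x ((1/2:ℝ) ^ j • u0) := by
      simp
    rw [h3, ← Finset.sum_sub_distrib]
    exact Finset.sum_congr rfl fun i _ => by ring
  rw [this]
  gcongr

noncomputable def rt (X : AffineTransitionFamily K φ ψ) (B : Module.Basis (Fin n) ℝ V) (x : V)
    (t : ℝ) : Measure V := (nu X x t).withDensity (fun y => ENNReal.ofReal (hh B y))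

theorem rt_lint (X : AffineTransitionFamily K φ ψ) (B : Module.Basis (Fin n) ℝ V) (x : V)
    (t : ℝ) {s : Set V} (hs : MeasurableSet s) :
    rt X B x t s = ∫⁻ y in s, ENNReal.ofReal (hh B y) ∂(nu X x t) := withDensity_apply _ hs

theorem rt_integral (X : AffineTransitionFamily K φ ψ) (B : Module.Basis (Fin n) ℝ V) (x : V)
    (t : ℝ) (f : V → ℝ) : ∫ y, f y ∂(rt X B x t) = ∫ y, f y * hh B y ∂(nu X x t) := by
  unfold rt
  rw [integral_withDensity_eq_integral_toReal_smul]
  · refine integral_congr_ae (Eventually.of_forall fun y => ?_)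
    simp [ENNReal.toReal_ofReal (hh_nonneg B y), mul_comm]
  · exact (hh_cont B).measurable.ennreal_ofReal
  · exact Eventually.of_forall fun y => ENNReal.ofReal_lt_top

theorem rt_tail (hK : IsProperConvexCone K) (X : AffineTransitionFamily K φ ψ)
    (hF : ∀ u ∈ dualCone K, HasDerivWithinAt (fun t => φ t u) (F u) (Set.Ici (0 : ℝ)) 0)
    (hR : ∀ u ∈ dualCone K, HasDerivWithinAt (fun t => ψ t u) (R u) (Set.Ici (0 : ℝ)) 0)
    (B : Module.Basis (Fin n) ℝ V) (hB : ∀ i, B i ∈ sPos K)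
    {x : V} (hx : x ∈ K) {η : ℝ} (hη : 0 < η) :
    ∃ r : ℝ, ∀ᶠ t in 𝓝[>] (0:ℝ), rt X B x t {y | r < ‖y‖} ≤ ENNReal.ofReal η := by
  obtain ⟨u0, hu0⟩ := sPos_nonempty hK
  obtain ⟨j, hj⟩ := LL_small hK X hF hR B hB hx hu0 (half_pos hη)
  obtain ⟨ε, hε, hu0'⟩ := id hu0
  set lam : ℝ := (1/2:ℝ) ^ j with hlam
  have hlam0 : 0 < lam := by positivity
  have hlu : lam • u0 ∈ dualCone K := dual_smul_mem hlam0.le (sPos_subset hu0)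
  have hNL := (((NL_hh hK X hF hR B hB hx).sub hK hx
    ((NL_hhexp hK X hF hR B hB hx hlu).const_mul (Real.exp (-⟪lam • u0, x⟫)))).const_mul 2)
  refine ⟨‖x‖ + 1 / (ε * lam), ?_⟩
  filter_upwards [hNL.lim.eventually_lt_const (show _ < η by linarith), self_mem_nhdsWithin]
    with t ht ht0
  have ht0' : 0 < t := ht0
  rw [rt_lint X B x t (measurableSet_lt measurable_const measurable_norm)]
  refine le_trans ?_ (ENNReal.ofReal_le_ofReal ht.le)
  have hfx : ∀ y, 2 * (hh B y - Real.exp (-⟪lam • u0, x⟫) * (hh B y * Real.exp (-⟪lam • u0, y⟫))) =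
      2 * (1 - Real.exp (-⟪lam • u0, y + x⟫)) * hh B y := by
    intro y
    rw [inner_add_right, neg_add, Real.exp_add]; ring
  have hnn : ∀ y ∈ shift K x, 0 ≤ 1 - Real.exp (-⟪lam • u0, y + x⟫) := by
    intro y hy
    have : 0 ≤ ⟪lam • u0, y + x⟫ := dual_nonneg hlu hy
    have := Real.exp_le_one_iff.2 (neg_nonpos.2 this)
    linarith
  rw [ofReal_integral_eq_lintegral_ofReal (nu_integrable hK X ht0' hx hNL.cont hNL.bdd)]
  · rw [← lintegral_indicator (measurableSet_lt measurable_const measurable_norm)]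
    refine lintegral_mono_ae ?_
    filter_upwards [nu_ae hK X ht0' hx] with y hy
    by_cases hyr : y ∈ {y | ‖x‖ + 1 / (ε * lam) < ‖y‖}
    · rw [indicator_of_mem hyr]
      refine ENNReal.ofReal_le_ofReal ?_
      rw [hfx]
      have h1 : 1 ≤ ⟪lam • u0, y + x⟫ := by
        rw [real_inner_smul_left]
        have h2 := hu0' _ hy
        have h3 : 1 / (ε * lam) ≤ ‖y + x‖ := by
          have := norm_sub_le (y + x) x
          rw [add_sub_cancel_right] at this
          have h5 : ‖x‖ + 1 / (ε * lam) < ‖y‖ := hyr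
          linarith
        rw [div_le_iff₀ (by positivity)] at h3
        have := mul_le_mul_of_nonneg_left h2 hlam0.le
        linarith
      have h2 : Real.exp (-⟪lam • u0, y + x⟫) ≤ 1 / 2 := by
        refine le_trans (Real.exp_le_exp.2 (neg_le_neg h1)) ?_
        rw [Real.exp_neg, one_div]
        refine inv_anti₀ (by norm_num) ?_
        have := Real.add_one_le_exp (1:ℝ)
        linarith
      have := hh_nonneg B y
      nlinarith
    · rw [indicator_of_notMem hyr]; exact zero_le
  · filter_upwards [nu_ae hK X ht0' hx] with y hy
    rw [hfx]
    exact mul_nonneg (mul_nonneg (by norm_num) (hnn y hy)) (hh_nonneg B y)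

end Rho

section Rho2

set_option linter.unusedSectionVars false
set_option linter.unusedVariables false

variable {K : Set V} {φ : ℝ → V → ℝ} {ψ : ℝ → V → V} {n : ℕ} {F : V → ℝ} {R : V → V}

theorem rt_fin (hK : IsProperConvexCone K) (X : AffineTransitionFamily K φ ψ)
    (hF : ∀ u ∈ dualCone K, HasDerivWithinAt (fun t => φ t u) (F u) (Set.Ici (0 : ℝ)) 0)
    (hR : ∀ u ∈ dualCone K, HasDerivWithinAt (fun t => ψ t u) (R u) (Set.Ici (0 : ℝ)) 0)
    (B : Module.Basis (Fin n) ℝ V) (hB : ∀ i, B i ∈ sPos K)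
    {x : V} (hx : x ∈ K) {t : ℝ} (ht : 0 < t) :
    rt X B x t univ = ENNReal.ofReal (∫ y, hh B y ∂(nu X x t)) := by
  have hNL := NL_hh hK X hF hR B hB hx
  rw [rt_lint X B x t MeasurableSet.univ, Measure.restrict_univ,
    ofReal_integral_eq_lintegral_ofReal (nu_integrable hK X ht hx hNL.cont hNL.bdd)]
  exact Eventually.of_forall fun y => hh_nonneg B y

theorem rt_ae (hK : IsProperConvexCone K) (X : AffineTransitionFamily K φ ψ)
    (B : Module.Basis (Fin n) ℝ V) {x : V} (hx : x ∈ K) {t : ℝ} (ht : 0 < t) :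
    ∀ᵐ y ∂(rt X B x t), y ∈ shift K x :=
  (withDensity_absolutelyContinuous _ _).ae_le (nu_ae hK X ht hx)

structure IsRho (X : AffineTransitionFamily K φ ψ) (B : Module.Basis (Fin n) ℝ V) (x : V)
    (ρ : Measure V) : Prop where
  fin : IsFiniteMeasure ρ
  supp : ∀ᵐ y ∂ρ, y ∈ shift K x
  lim : ∃ l : Filter ℝ, l.NeBot ∧ l ≤ 𝓝[>] 0 ∧ ∀ f : V → ℝ, Continuous f → Bdd (shift K x) f →
    Tendsto (fun t => ∫ y, f y * hh B y ∂(nu X x t)) l (𝓝 (∫ y, f y ∂ρ))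

theorem exists_rho (hK : IsProperConvexCone K) (X : AffineTransitionFamily K φ ψ)
    (hF : ∀ u ∈ dualCone K, HasDerivWithinAt (fun t => φ t u) (F u) (Set.Ici (0 : ℝ)) 0)
    (hR : ∀ u ∈ dualCone K, HasDerivWithinAt (fun t => ψ t u) (R u) (Set.Ici (0 : ℝ)) 0)
    (B : Module.Basis (Fin n) ℝ V) (hB : ∀ i, B i ∈ sPos K)
    {x : V} (hx : x ∈ K) : ∃ ρ : Measure V, IsRho X B x ρ := by
  have hNL := NL_hh hK X hF hR B hB hx
  set C := (∑ i, (2 * HH F R x (B i) - HH F R x ((2:ℝ) • B i))) + 1 with hC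
  have hev := hNL.lim.eventually_lt_const (show _ < C by linarith)
  obtain ⟨δ, hδ, hδ'⟩ := mem_nhdsGT_iff_exists_Ioo_subset.1 hev
  have hδ0 : 0 < δ := hδ
  let T : ℕ → ℝ := fun k => δ / ((k:ℝ) + 1 + 1)
  have hT0 : ∀ k, 0 < T k := fun k => by positivity
  have hTδ : ∀ k, T k < δ := fun k => by
    rw [div_lt_iff₀ (by positivity)]
    nlinarith [(Nat.cast_nonneg k : (0:ℝ) ≤ k)]
  have hTlim : Tendsto T atTop (𝓝[>] 0) := by
    refine tendsto_nhdsWithin_iff.2 ⟨?_, Eventually.of_forall hT0⟩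
    refine Tendsto.div_atTop tendsto_const_nhds ?_
    exact tendsto_atTop_add_const_right _ _
      (tendsto_atTop_add_const_right _ _ tendsto_natCast_atTop_atTop)
  have hmass : ∀ k, rt X B x (T k) univ ≤ (C.toNNReal : ℝ≥0∞) := fun k => by
    rw [rt_fin hK X hF hR B hB hx (hT0 k)]
    exact ENNReal.ofReal_le_ofReal (show _ ≤ C from (hδ' ⟨hT0 k, hTδ k⟩).le)
  have hfin : ∀ k, IsFiniteMeasure (rt X B x (T k)) := fun k =>
    ⟨lt_of_le_of_lt (hmass k) ENNReal.coe_lt_top⟩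
  obtain ⟨ρ, hρ, l, hl, hl', hlim⟩ := prohorov (μ := fun k => rt X B x (T k)) C.toNNReal hmass (by
    intro η hη
    obtain ⟨η', h0, h1⟩ := exists_between hη
    obtain ⟨r, hr⟩ := rt_tail hK X hF hR B hB hx (η := η'.toReal)
      (ENNReal.toReal_pos h0.ne' (ne_top_of_lt h1))
    refine ⟨r, (hTlim.eventually hr).mono fun k hk => hk.trans ?_⟩
    rw [ENNReal.ofReal_toReal (ne_top_of_lt h1)]
    exact h1.le)
  have hne : (shift K x).Nonempty := ⟨0, by simpa [shift] using hx⟩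
  have hcl : IsClosed (shift K x) := shift_closed hK x
  have hsupp : ∀ᵐ y ∂ρ, y ∈ shift K x := by
    let f0 : BoundedContinuousFunction V ℝ := BoundedContinuousFunction.ofNormedAddCommGroup
      (fun y => min 1 (Metric.infDist y (shift K x)))
      (continuous_const.min (Metric.continuous_infDist_pt _)) 1 (fun y => by
        rw [Real.norm_of_nonneg (le_min zero_le_one Metric.infDist_nonneg)]
        exact min_le_left _ _)
    have hf0 : ∀ y, f0 y = min 1 (Metric.infDist y (shift K x)) := fun y => rfl
    have hz : ∀ k, ∫ y, f0 y ∂(rt X B x (T k)) = 0 := fun k => by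
      refine integral_eq_zero_of_ae ?_
      filter_upwards [rt_ae hK X B hx (hT0 k)] with y hy
      rw [hf0, Metric.infDist_zero_of_mem hy]; simp
    have h0 : ∫ y, f0 y ∂ρ = 0 := by
      have := hlim f0
      simp only [hz] at this
      exact tendsto_nhds_unique this tendsto_const_nhds
    have hf0n : 0 ≤ fun y => f0 y := fun y => le_min zero_le_one Metric.infDist_nonneg
    rw [integral_eq_zero_iff_of_nonneg hf0n (f0.integrable ρ)] at h0
    filter_upwards [h0] with y hy
    rw [hcl.mem_iff_infDist_zero hne]
    have h2 : min 1 (Metric.infDist y (shift K x)) = 0 := hy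
    rcases min_choice 1 (Metric.infDist y (shift K x)) with h | h
    · rw [h] at h2; norm_num at h2
    · rw [← h, h2]
  refine ⟨ρ, hρ, hsupp, l.map T, hl.map T, (map_mono hl').trans hTlim, ?_⟩
  rintro f hf ⟨D, hD⟩
  rw [tendsto_map'_iff]
  have hD0 : 0 ≤ D := by
    obtain ⟨y, hy⟩ := hne
    exact (abs_nonneg _).trans (hD y hy)
  let g : BoundedContinuousFunction V ℝ := BoundedContinuousFunction.ofNormedAddCommGroup
    (fun y => max (-D) (min D (f y))) (by fun_prop) D (fun y => by
        rw [Real.norm_eq_abs, abs_le]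
        exact ⟨le_max_left _ _, max_le (by linarith) (min_le_left _ _)⟩)
  have hg : ∀ y ∈ shift K x, g y = f y := fun y hy => by
    have := abs_le.1 (hD y hy)
    change max (-D) (min D (f y)) = f y
    rw [min_eq_right this.2, max_eq_right this.1]
  have h1 : ∫ y, g y ∂ρ = ∫ y, f y ∂ρ := integral_congr_ae (hsupp.mono hg)
  have h2 : ∀ k, ∫ y, g y ∂(rt X B x (T k)) = ∫ y, f y * hh B y ∂(nu X x (T k)) := fun k => by
    rw [← rt_integral]
    exact integral_congr_ae ((rt_ae hK X B hx (hT0 k)).mono hg)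
  rw [← h1]
  refine (hlim g).congr fun k => h2 k

theorem IsRho.eq_of_NL {X : AffineTransitionFamily K φ ψ} {B : Module.Basis (Fin n) ℝ V}
    {x : V} {ρ : Measure V} (hρ : IsRho X B x ρ) {f : V → ℝ} (hf : Continuous f)
    (hb : Bdd (shift K x) f) {a : ℝ} {g : V → ℝ} (hg : NL X x g a) (h : ∀ y, f y * hh B y = g y) :
    ∫ y, f y ∂ρ = a := by
  obtain ⟨l, hl, hl', hlim⟩ := hρ.lim
  have := hlim f hf hb
  simp only [h] at this
  exact tendsto_nhds_unique this (hg.lim.mono_left hl')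

theorem IsRho.integrable {X : AffineTransitionFamily K φ ψ} {B : Module.Basis (Fin n) ℝ V}
    {x : V} {ρ : Measure V} (hρ : IsRho X B x ρ) {f : V → ℝ} (hf : Continuous f)
    (hb : Bdd (shift K x) f) : Integrable f ρ := by
  have := hρ.fin
  exact bdd_integrable hρ.supp hf.aestronglyMeasurable hb

/-- (C1) -/
theorem IsRho.exp_eq (hK : IsProperConvexCone K) {X : AffineTransitionFamily K φ ψ}
    (hF : ∀ u ∈ dualCone K, HasDerivWithinAt (fun t => φ t u) (F u) (Set.Ici (0 : ℝ)) 0)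
    (hR : ∀ u ∈ dualCone K, HasDerivWithinAt (fun t => ψ t u) (R u) (Set.Ici (0 : ℝ)) 0)
    {B : Module.Basis (Fin n) ℝ V} (hB : ∀ i, B i ∈ sPos K)
    {x : V} (hx : x ∈ K) {ρ : Measure V} (hρ : IsRho X B x ρ) {u : V} (hu : u ∈ dualCone K) :
    ∫ y, Real.exp (-⟪u, y⟫) ∂ρ =
      ∑ i, (2 * HH F R x (u + B i) - HH F R x u - HH F R x (u + (2:ℝ) • B i)) :=
  hρ.eq_of_NL (by fun_prop) (exp_bdd hu) (NL_hhexp hK X hF hR B hB hx hu) fun y => mul_comm _ _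

/-- (C3), Fatou. -/
theorem IsRho.fatou (hK : IsProperConvexCone K) {X : AffineTransitionFamily K φ ψ}
    {B : Module.Basis (Fin n) ℝ V}
    {x : V} (hx : x ∈ K) {ρ : Measure V} (hρ : IsRho X B x ρ) {g : V → ℝ} {a : ℝ}
    (hg : NL X x g a) (hpos : ∀ y ∈ shift K x, 0 ≤ g y) :
    ∫⁻ y, ENNReal.ofReal (g y * (hh B y)⁻¹) ∂ρ ≤ ENNReal.ofReal a := by
  obtain ⟨l, hl, hl', hlim⟩ := hρ.lim
  let gn : ℕ → V → ℝ := fun k y => g y / max (hh B y) (1 / ((k:ℝ) + 1))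
  have hmax : ∀ (k : ℕ) y, 0 < max (hh B y) (1 / ((k:ℝ) + 1)) := fun k y =>
    lt_max_of_lt_right (by positivity)
  have hgc : ∀ k, Continuous (gn k) := fun k =>
    hg.cont.div ((hh_cont B).max continuous_const) fun y => (hmax k y).ne'
  have hgb : ∀ k, Bdd (shift K x) (gn k) := fun k => by
    obtain ⟨C, hC⟩ := hg.bdd
    refine ⟨C * (k + 1), fun y hy => ?_⟩
    rw [abs_div, abs_of_pos (hmax k y), div_le_iff₀ (hmax k y)]
    have h1 : 1 ≤ ((k:ℝ) + 1) * max (hh B y) (1 / ((k:ℝ) + 1)) := by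
      have := mul_le_mul_of_nonneg_left (le_max_right (hh B y) (1 / ((k:ℝ) + 1)))
        (show (0:ℝ) ≤ k + 1 by positivity)
      rwa [mul_one_div_cancel (by positivity)] at this
    have h2 := hC y hy
    have h3 : 0 ≤ C := (abs_nonneg _).trans h2
    nlinarith
  have hle : ∀ k, ∫ y, gn k y ∂ρ ≤ a := fun k => by
    refine le_of_tendsto_of_tendsto (hlim _ (hgc k) (hgb k)) (hg.lim.mono_left hl') ?_
    filter_upwards [hl' self_mem_nhdsWithin] with t ht
    have ht' : 0 < t := ht
    have hbh : Bdd (shift K x) (fun y => gn k y * hh B y) := by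
      obtain ⟨C, hC⟩ := hg.bdd
      refine ⟨C, fun y hy => le_trans ?_ (hC y hy)⟩
      rw [abs_mul, abs_div, abs_of_pos (hmax k y), abs_of_nonneg (hh_nonneg B y),
        div_mul_eq_mul_div, div_le_iff₀ (hmax k y)]
      exact mul_le_mul_of_nonneg_left (le_max_left _ _) (abs_nonneg _)
    refine integral_mono_ae (nu_integrable hK X ht' hx ((hgc k).mul (hh_cont B)) hbh)
      (nu_integrable hK X ht' hx hg.cont hg.bdd) ?_
    filter_upwards [nu_ae hK X ht' hx] with y hy
    change g y / max (hh B y) (1 / ((k:ℝ) + 1)) * hh B y ≤ g y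
    rw [div_mul_eq_mul_div, div_le_iff₀ (hmax k y)]
    exact mul_le_mul_of_nonneg_left (le_max_left _ _) (hpos y hy)
  have hle' : ∀ k, ∫⁻ y, ENNReal.ofReal (gn k y) ∂ρ ≤ ENNReal.ofReal a := fun k => by
    rw [← ofReal_integral_eq_lintegral_ofReal (hρ.integrable (hgc k) (hgb k))]
    · exact ENNReal.ofReal_le_ofReal (hle k)
    · filter_upwards [hρ.supp] with y hy
      exact div_nonneg (hpos y hy) (hmax k y).le
  calc ∫⁻ y, ENNReal.ofReal (g y * (hh B y)⁻¹) ∂ρ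
      ≤ ∫⁻ y, liminf (fun k => ENNReal.ofReal (gn k y)) atTop ∂ρ := by
        refine lintegral_mono_ae ?_
        filter_upwards [hρ.supp] with y hy
        by_cases h0 : hh B y = 0
        · simp [h0]
        · have hp : 0 < hh B y := lt_of_le_of_ne (hh_nonneg B y) (Ne.symm h0)
          have h1 : Tendsto (fun k : ℕ => 1 / ((k:ℝ) + 1)) atTop (𝓝 0) :=
            tendsto_one_div_add_atTop_nhds_zero_nat
          have h2 : ∀ᶠ k : ℕ in atTop, ENNReal.ofReal (gn k y) = ENNReal.ofReal (g y * (hh B y)⁻¹) := by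
            filter_upwards [h1.eventually_lt_const hp] with k hk
            change ENNReal.ofReal (g y / max (hh B y) (1 / ((k:ℝ) + 1))) = _
            rw [max_eq_left hk.le, div_eq_mul_inv]
          have h3 : Tendsto (fun k : ℕ => ENNReal.ofReal (gn k y)) atTop
              (𝓝 (ENNReal.ofReal (g y * (hh B y)⁻¹))) :=
            tendsto_const_nhds.congr' (h2.mono fun k hk => hk.symm)
          rw [h3.liminf_eq]
    _ ≤ liminf (fun k => ∫⁻ y, ENNReal.ofReal (gn k y) ∂ρ) atTop :=
        lintegral_liminf_le fun k => (hgc k).measurable.ennreal_ofReal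
    _ ≤ ENNReal.ofReal a := by
        refine liminf_le_of_le (by isBoundedDefault) fun b hb => ?_
        obtain ⟨k, hk⟩ := hb.exists
        exact hk.trans (hle' k)

end Rho2

section Uniq

set_option linter.unusedSectionVars false
set_option linter.unusedVariables false

variable {K : Set V} {φ : ℝ → V → ℝ} {ψ : ℝ → V → V} {n : ℕ} {F : V → ℝ} {R : V → V}

theorem lap_unique (hK : IsProperConvexCone K) {B : Module.Basis (Fin n) ℝ V}
    (hB : ∀ i, B i ∈ sPos K) {w : V} {μ ν : Measure V} [IsFiniteMeasure μ] [IsFiniteMeasure ν]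
    (hμ : ∀ᵐ y ∂μ, y ∈ shift K w) (hν : ∀ᵐ y ∂ν, y ∈ shift K w)
    (h : ∀ u ∈ dualCone K, ∫ y, Real.exp (-⟪u, y⟫) ∂μ = ∫ y, Real.exp (-⟪u, y⟫) ∂ν) : μ = ν := by
  have hcl : IsClosed (shift K w) := shift_closed hK w
  have hme := hcl.measurableSet
  have hpol : PolishSpace ↥(shift K w) := hcl.polishSpace
  let e : ∀ u, u ∈ dualCone K → BoundedContinuousFunction ↥(shift K w) ℝ := fun u hu =>
    BoundedContinuousFunction.ofNormedAddCommGroup (fun y => Real.exp (-⟪u, (y:V)⟫)) (by fun_prop)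
      (exp_bdd (x := w) hu).choose (fun y => (exp_bdd (x := w) hu).choose_spec y y.2)
  let M : Submonoid (BoundedContinuousFunction ↥(shift K w) ℝ) :=
    { carrier := {g | ∃ u ∈ dualCone K, ∀ y, g y = Real.exp (-⟪u, (y:V)⟫)}
      mul_mem' := by
        rintro a c ⟨u, hu, ha⟩ ⟨v, hv, hc⟩
        refine ⟨u + v, dual_add_mem hu hv, fun y => ?_⟩
        rw [BoundedContinuousFunction.mul_apply, ha, hc, ← Real.exp_add, inner_add_left]
        congr 1; ring
      one_mem' := ⟨0, dual_zero_mem, fun y => by simp⟩ }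
  let A : StarSubalgebra ℝ (BoundedContinuousFunction ↥(shift K w) ℝ) :=
    { Algebra.adjoin ℝ (M : Set (BoundedContinuousFunction ↥(shift K w) ℝ)) with
      star_mem' := by
        intro a ha
        have : star a = a := by ext y; simp
        rw [this]; exact ha }
  have hcom : ∀ (μ : Measure V), (∀ᵐ y ∂μ, y ∈ shift K w) → ∀ f : V → ℝ,
      ∫ y : ↥(shift K w), f y ∂(Measure.comap Subtype.val μ) = ∫ y, f y ∂μ := fun μ hμ f => by
    rw [integral_subtype_comap hme, Measure.restrict_eq_self_of_ae_mem hμ]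
  have hfin : ∀ (μ : Measure V) [IsFiniteMeasure μ], IsFiniteMeasure
      (Measure.comap (Subtype.val : ↥(shift K w) → V) μ) := fun μ _ =>
    ⟨by rw [(MeasurableEmbedding.subtype_coe hme).comap_apply]; exact measure_lt_top _ _⟩
  have f1 := hfin μ
  have f2 := hfin ν
  have heq : Measure.comap (Subtype.val : ↥(shift K w) → V) μ = Measure.comap Subtype.val ν := by
    refine ext_of_forall_mem_subalgebra_integral_eq_of_polish (𝕜 := ℝ) (A := A) ?_ ?_
    · intro y z hyz
      by_contra hcon
      push Not at hcon
      apply hyz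
      have : (y:V) - z = 0 := basis_inner_zero B fun i => by
        have h1 := hcon (fun y : ↥(shift K w) => Real.exp (-⟪B i, (y:V)⟫))
          ⟨(e (B i) (sPos_subset (hB i)) : C(↥(shift K w), ℝ)), ?_, rfl⟩
        · have h2 := Real.exp_injective h1
          rw [inner_sub_right]; linarith
        · refine ⟨e (B i) (sPos_subset (hB i)), ?_, rfl⟩
          exact Algebra.subset_adjoin ⟨B i, sPos_subset (hB i), fun y => rfl⟩
      exact Subtype.ext (sub_eq_zero.1 this)
    · intro g hg
      have hg' : g ∈ Submodule.span ℝ (M : Set (BoundedContinuousFunction ↥(shift K w) ℝ)) := by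
        have h1 : g ∈ Subalgebra.toSubmodule
          (Algebra.adjoin ℝ (M : Set (BoundedContinuousFunction ↥(shift K w) ℝ))) := hg
        rwa [Algebra.adjoin_eq_span, Submonoid.closure_eq] at h1
      clear hg
      induction hg' using Submodule.span_induction with
      | mem g hg =>
        obtain ⟨u, hu, hgu⟩ := hg
        simp only [hgu]
        rw [hcom μ hμ (fun y => Real.exp (-⟪u, y⟫)), hcom ν hν (fun y => Real.exp (-⟪u, y⟫)), h u hu]
      | zero => simp
      | add a c ha' hc' iha ihc =>
        simp only [BoundedContinuousFunction.add_apply]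
        rw [integral_add (a.integrable _) (c.integrable _),
          integral_add (a.integrable _) (c.integrable _), iha, ihc]
      | smul r a ha' iha =>
        simp only [BoundedContinuousFunction.smul_apply]
        rw [integral_smul, integral_smul, iha]
  have := congrArg (Measure.map (Subtype.val : ↥(shift K w) → V)) heq
  rwa [map_comap_subtype_coe hme, map_comap_subtype_coe hme, Measure.restrict_eq_self_of_ae_mem hμ,
    Measure.restrict_eq_self_of_ae_mem hν] at this

theorem div_hh_bdd (hK : IsProperConvexCone K) (B : Module.Basis (Fin n) ℝ V)
    (hB : ∀ i, B i ∈ sPos K) (x : V) {g : V → ℝ} (h1 : Bdd (shift K x) g)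
    (h2 : g =O[𝓝 0] fun y => ‖y‖ ^ 2) : Bdd (shift K x) fun y => g y / hh B y := by
  obtain ⟨C₁, h1⟩ := h1
  obtain ⟨C, hC, h⟩ := abs_le_hh_of_isBigO hK B hB x h1 h2
  refine ⟨C, fun y hy => ?_⟩
  rw [abs_div, abs_of_nonneg (hh_nonneg B y)]
  by_cases h0 : hh B y = 0
  · simp [h0, hC]
  · rw [div_le_iff₀ (lt_of_le_of_ne (hh_nonneg B y) (Ne.symm h0))]
    exact h y hy

theorem hh_eq_zero {B : Module.Basis (Fin n) ℝ V} {y : V} (h : hh B y = 0) : y = 0 := by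
  by_contra hy
  exact (hh_pos B hy).ne' h

theorem isBigO_zero {g : V → ℝ} (h2 : g =O[𝓝 0] fun y => ‖y‖ ^ 2) : g 0 = 0 := by
  obtain ⟨c, hc⟩ := h2.bound
  have := hc.self_of_nhds
  simpa using this

theorem div_hh_mul (B : Module.Basis (Fin n) ℝ V) {g : V → ℝ}
    (h2 : g =O[𝓝 0] fun y => ‖y‖ ^ 2) (y : V) : g y / hh B y * hh B y = g y := by
  by_cases h0 : hh B y = 0
  · rw [hh_eq_zero h0, hh_zero, isBigO_zero h2]; simp
  · field_simp

noncomputable def AA (F : V → ℝ) (R : V → V) (B : Module.Basis (Fin n) ℝ V) (x : V) (i j : Fin n) :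
    ℝ := HH F R x (B i) + HH F R x (B j) - HH F R x (B i + B j)

noncomputable def TT (F : V → ℝ) (R : V → V) (B : Module.Basis (Fin n) ℝ V) (x : V) (i : Fin n) :
    ℝ := 2 * HH F R x (B i) - 1 / 2 * HH F R x ((2:ℝ) • B i)

theorem sq_sum (c : Fin n → ℝ) (θ : Fin n → ℝ) :
    (∑ i, c i * θ i) ^ 2 = ∑ i, ∑ j, c i * c j * (θ i * θ j) := by
  rw [sq, Finset.sum_mul_sum]
  exact Finset.sum_congr rfl fun i _ => Finset.sum_congr rfl fun j _ => by ring

theorem NL_sq (hK : IsProperConvexCone K) (X : AffineTransitionFamily K φ ψ)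
    (hF : ∀ u ∈ dualCone K, HasDerivWithinAt (fun t => φ t u) (F u) (Set.Ici (0 : ℝ)) 0)
    (hR : ∀ u ∈ dualCone K, HasDerivWithinAt (fun t => ψ t u) (R u) (Set.Ici (0 : ℝ)) 0)
    (B : Module.Basis (Fin n) ℝ V) (hB : ∀ i, B i ∈ sPos K)
    {x : V} (hx : x ∈ K) (c : Fin n → ℝ) :
    NL X x (fun y => (∑ i, c i * th B i y) ^ 2) (∑ i, ∑ j, c i * c j * AA F R B x i j) := by
  have := NL.sum hK hx Finset.univ (X := X) fun i => NL.sum hK hx Finset.univ (X := X) fun j =>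
    (NL_thth hK X hF hR B hB hx i j).const_mul (c i * c j)
  exact this.congr (fun y => (sq_sum _ _).symm) rfl

theorem NL_kk (hK : IsProperConvexCone K) (X : AffineTransitionFamily K φ ψ)
    (hF : ∀ u ∈ dualCone K, HasDerivWithinAt (fun t => φ t u) (F u) (Set.Ici (0 : ℝ)) 0)
    (hR : ∀ u ∈ dualCone K, HasDerivWithinAt (fun t => ψ t u) (R u) (Set.Ici (0 : ℝ)) 0)
    (B : Module.Basis (Fin n) ℝ V) (hB : ∀ i, B i ∈ sPos K)
    {x : V} (hx : x ∈ K) {u : V} (hu : u ∈ dualCone K) :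
    NL X x (kk B u) (-HH F R x u + ∑ i, B.repr u i * TT F R B x i -
      1 / 2 * ∑ i, ∑ j, B.repr u i * B.repr u j * AA F R B x i j) := by
  have h1 := (NL_exp hK X hF hR hx hu).const_mul (-1)
  have h2 := NL.sum hK hx Finset.univ (X := X) fun i =>
    (NL_ta hK X hF hR B hB hx i).const_mul (B.repr u i)
  have h3 := (NL_sq hK X hF hR B hB hx (B.repr u)).const_mul (1 / 2)
  refine ((h1.add hK hx h2).sub hK hx h3).congr (fun y => ?_) ?_
  · unfold kk; ring
  · unfold TT; ring

/-- (C2) -/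
theorem IsRho.kk_eq (hK : IsProperConvexCone K) {X : AffineTransitionFamily K φ ψ}
    (hF : ∀ u ∈ dualCone K, HasDerivWithinAt (fun t => φ t u) (F u) (Set.Ici (0 : ℝ)) 0)
    (hR : ∀ u ∈ dualCone K, HasDerivWithinAt (fun t => ψ t u) (R u) (Set.Ici (0 : ℝ)) 0)
    {B : Module.Basis (Fin n) ℝ V} (hB : ∀ i, B i ∈ sPos K)
    {x : V} (hx : x ∈ K) {ρ : Measure V} (hρ : IsRho X B x ρ) {u : V} (hu : u ∈ dualCone K) :
    ∫ y, kk B u y / hh B y ∂ρ = -HH F R x u + ∑ i, B.repr u i * TT F R B x i -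
      1 / 2 * ∑ i, ∑ j, B.repr u i * B.repr u j * AA F R B x i j := by
  have hNL := NL_kk hK X hF hR B hB hx hu
  exact hρ.eq_of_NL (div_hh_cont B (kk_cont B u) (kk_isLittleO B u))
    (div_hh_bdd hK B hB x hNL.bdd (kk_isLittleO B u).isBigO) hNL
    (div_hh_mul B (kk_isLittleO B u).isBigO)

end Uniq

section FPart

set_option linter.unusedSectionVars false
set_option linter.unusedVariables false

variable {K : Set V} {φ : ℝ → V → ℝ} {ψ : ℝ → V → V} {n : ℕ} {F : V → ℝ} {R : V → V}

noncomputable def mm (B : Module.Basis (Fin n) ℝ V) (ρ : Measure V) : Measure V :=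
  ρ.withDensity (fun y => ENNReal.ofReal (hh B y)⁻¹)

theorem hinv_meas (B : Module.Basis (Fin n) ℝ V) :
    Measurable (fun y => ENNReal.ofReal (hh B y)⁻¹) :=
  (hh_cont B).measurable.inv.ennreal_ofReal

theorem mm_lint (B : Module.Basis (Fin n) ℝ V) (ρ : Measure V) {g : V → ℝ} (hg : Measurable g) :
    ∫⁻ y, ENNReal.ofReal (g y) ∂(mm B ρ) = ∫⁻ y, ENNReal.ofReal (g y * (hh B y)⁻¹) ∂ρ := by
  unfold mm
  rw [lintegral_withDensity_eq_lintegral_mul _ (hinv_meas B) hg.ennreal_ofReal]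
  refine lintegral_congr fun y => ?_
  rw [Pi.mul_apply, mul_comm (g y), ENNReal.ofReal_mul (inv_nonneg.2 (hh_nonneg B y))]

theorem mm_integral (B : Module.Basis (Fin n) ℝ V) (ρ : Measure V) (g : V → ℝ) :
    ∫ y, g y ∂(mm B ρ) = ∫ y, g y / hh B y ∂ρ := by
  unfold mm
  rw [integral_withDensity_eq_integral_toReal_smul (hinv_meas B)
    (Eventually.of_forall fun y => ENNReal.ofReal_lt_top)]
  refine integral_congr_ae (Eventually.of_forall fun y => ?_)
  simp only [smul_eq_mul]
  rw [ENNReal.toReal_ofReal (inv_nonneg.2 (hh_nonneg B y)), div_eq_inv_mul]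

theorem mm_integrable (B : Module.Basis (Fin n) ℝ V) (ρ : Measure V) (g : V → ℝ) :
    Integrable g (mm B ρ) ↔ Integrable (fun y => g y / hh B y) ρ := by
  unfold mm
  rw [integrable_withDensity_iff_integrable_smul' (hinv_meas B)
    (Eventually.of_forall fun y => ENNReal.ofReal_lt_top)]
  refine integrable_congr (Eventually.of_forall fun y => ?_)
  simp only [smul_eq_mul]
  rw [ENNReal.toReal_ofReal (inv_nonneg.2 (hh_nonneg B y)), div_eq_inv_mul]

theorem mm_zero (B : Module.Basis (Fin n) ℝ V) (ρ : Measure V) : mm B ρ {0} = 0 := by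
  unfold mm
  rw [withDensity_apply _ (measurableSet_singleton 0), lintegral_singleton, hh_zero]
  simp

theorem mm_supp (B : Module.Basis (Fin n) ℝ V) {ρ : Measure V} {s : Set V} (h : ρ s = 0) :
    mm B ρ s = 0 := withDensity_absolutelyContinuous _ _ h

theorem mm_sigma (B : Module.Basis (Fin n) ℝ V) (ρ : Measure V) [IsFiniteMeasure ρ] :
    SigmaFinite (mm B ρ) := by
  unfold mm
  exact SigmaFinite.withDensity_ofReal (fun y => (hh B y)⁻¹)

theorem shift_zero : shift K (0:V) = K := by
  ext y; simp [shift]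

/-- (C4) -/
theorem rho_zero (hK : IsProperConvexCone K) {X : AffineTransitionFamily K φ ψ}
    (hF : ∀ u ∈ dualCone K, HasDerivWithinAt (fun t => φ t u) (F u) (Set.Ici (0 : ℝ)) 0)
    (hR : ∀ u ∈ dualCone K, HasDerivWithinAt (fun t => ψ t u) (R u) (Set.Ici (0 : ℝ)) 0)
    {B : Module.Basis (Fin n) ℝ V} (hB : ∀ i, B i ∈ sPos K)
    {ρ : Measure V} (hρ : IsRho X B 0 ρ) : ρ {0} = 0 := by
  have hfin := hρ.fin
  have h0K : (0:V) ∈ K := cone_zero_mem hK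
  obtain ⟨l, hl, hl', hlim⟩ := hρ.lim
  have hs := NL.sum hK h0K Finset.univ (X := X) fun i => NL_th hK X hF hR B hB h0K i
  set a := ∑ i, HH F R 0 (B i) with ha
  have hthc := th_cont B
  have hnn : ∀ y ∈ K, 0 ≤ ∑ i, th B i y := fun y hy =>
    Finset.sum_nonneg fun i _ => (ta_nonneg B hB i hy).1
  have hhle : ∀ y ∈ K, hh B y ≤ (∑ i, th B i y) ^ 2 := fun y hy =>
    Finset.sum_sq_le_sq_sum_of_nonneg fun i _ => (ta_nonneg B hB i hy).1
  have key : ∀ k : ℕ, ((k:ℝ) + 1) * ρ.real {0} ≤ a := by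
    intro k
    let f : V → ℝ := fun y => max 0 (1 - (k + 1) * ∑ i, th B i y)
    have hfc : Continuous f := by fun_prop
    have hfb : ∀ y ∈ K, 0 ≤ f y ∧ f y ≤ 1 := fun y hy => by
      refine ⟨le_max_left _ _, max_le zero_le_one ?_⟩
      have := mul_nonneg (show (0:ℝ) ≤ k + 1 by positivity) (hnn y hy)
      linarith
    have hfb' : Bdd (shift K 0) f := ⟨1, fun y hy => by
      rw [shift_zero] at hy
      rw [abs_of_nonneg (hfb y hy).1]; exact (hfb y hy).2⟩
    have hle : ((k:ℝ) + 1) * ∫ y, f y ∂ρ ≤ a := by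
      refine le_of_tendsto_of_tendsto ((hlim f hfc hfb').const_mul ((k:ℝ) + 1))
        (hs.lim.mono_left hl') ?_
      filter_upwards [hl' self_mem_nhdsWithin] with t ht
      have ht' : 0 < t := ht
      rw [← integral_const_mul]
      refine integral_mono_ae ((nu_integrable hK X ht' h0K (hfc.mul (hh_cont B))
        (hfb'.mul (NL_hh hK X hF hR B hB h0K).bdd)).const_mul _)
        (nu_integrable hK X ht' h0K hs.cont hs.bdd) ?_
      filter_upwards [nu_ae hK X ht' h0K] with y hy
      rw [shift_zero] at hy
      have e1 := hnn y hy
      have e2 := hhle y hy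
      have e3 := hfb y hy
      change ((k:ℝ) + 1) * (f y * hh B y) ≤ ∑ i, th B i y
      have hk : (0:ℝ) < k + 1 := by positivity
      rcases le_total (1 - ((k:ℝ) + 1) * ∑ i, th B i y) 0 with hc | hc
      · have : f y = 0 := max_eq_left hc
        rw [this]; simpa using e1
      · calc ((k:ℝ) + 1) * (f y * hh B y) ≤ ((k:ℝ) + 1) * (1 * (∑ i, th B i y) ^ 2) := by
              gcongr
              · exact hh_nonneg B y
              · exact e3.2
          _ = (((k:ℝ) + 1) * ∑ i, th B i y) * (∑ i, th B i y) := by ring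
          _ ≤ 1 * ∑ i, th B i y := by gcongr; linarith
          _ = _ := one_mul _
    have hge : ρ.real {0} ≤ ∫ y, f y ∂ρ := by
      rw [← integral_indicator_one (measurableSet_singleton (0:V))]
      refine integral_mono_ae ?_ (hρ.integrable hfc hfb') ?_
      · exact (integrable_const (1:ℝ)).indicator (measurableSet_singleton (0:V))
      · filter_upwards [hρ.supp] with y hy
        rw [shift_zero] at hy
        by_cases h : y ∈ ({0} : Set V)
        · rw [indicator_of_mem h]
          have : y = 0 := h
          rw [this]
          simp [f, th_zero]
        · rw [indicator_of_notMem h]; exact (hfb y hy).1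
    exact (mul_le_mul_of_nonneg_left hge (by positivity)).trans hle
  have : 0 ≤ -ρ.real {0} := nonneg_of_nat (a := a - ρ.real {0}) fun k => by
    have := key k; nlinarith
  have h2 : ρ.real {0} = 0 := le_antisymm (by linarith) measureReal_nonneg
  rwa [measureReal_eq_zero_iff] at h2

theorem sq_div_bdd (hK : IsProperConvexCone K) (B : Module.Basis (Fin n) ℝ V) (c : Fin n → ℝ) (y : V) :
    (∑ i, c i * th B i y) ^ 2 ≤ (∑ i, c i ^ 2) * hh B y :=
  Finset.sum_mul_sq_le_sq_mul_sq _ _ _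

theorem sq_div_integrable (hK : IsProperConvexCone K) (B : Module.Basis (Fin n) ℝ V) (c : Fin n → ℝ)
    (ρ : Measure V) [IsFiniteMeasure ρ] :
    Integrable (fun y => (∑ i, c i * th B i y) ^ 2 / hh B y) ρ := by
  have := th_cont B
  have hm : Measurable (fun y => (∑ i, c i * th B i y) ^ 2 / hh B y) :=
    Measurable.div (Continuous.measurable (by fun_prop)) (hh_cont B).measurable
  refine Integrable.of_bound hm.aestronglyMeasurable (∑ i, c i ^ 2) (Eventually.of_forall fun y => ?_)
  rw [Real.norm_of_nonneg (div_nonneg (sq_nonneg _) (hh_nonneg B y))]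
  by_cases h0 : hh B y = 0
  · rw [h0, div_zero]; positivity
  · rw [div_le_iff₀ (lt_of_le_of_ne (hh_nonneg B y) (Ne.symm h0))]
    exact sq_div_bdd hK B c y

theorem IsRho.sq_le (hK : IsProperConvexCone K) {X : AffineTransitionFamily K φ ψ}
    (hF : ∀ u ∈ dualCone K, HasDerivWithinAt (fun t => φ t u) (F u) (Set.Ici (0 : ℝ)) 0)
    (hR : ∀ u ∈ dualCone K, HasDerivWithinAt (fun t => ψ t u) (R u) (Set.Ici (0 : ℝ)) 0)
    {B : Module.Basis (Fin n) ℝ V} (hB : ∀ i, B i ∈ sPos K) {x : V} (hx : x ∈ K)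
    {ρ : Measure V} (hρ : IsRho X B x ρ) (c : Fin n → ℝ) :
    ∫ y, (∑ i, c i * th B i y) ^ 2 / hh B y ∂ρ ≤ ∑ i, ∑ j, c i * c j * AA F R B x i j := by
  have := hρ.fin
  have hNL := NL_sq hK X hF hR B hB hx c
  have h1 := hρ.fatou hK hx hNL (fun y _ => sq_nonneg _)
  have hA : 0 ≤ ∑ i, ∑ j, c i * c j * AA F R B x i j := by
    refine ge_of_tendsto hNL.lim ?_
    filter_upwards with t
    exact integral_nonneg fun y => sq_nonneg _
  rw [← ENNReal.ofReal_le_ofReal_iff hA, ofReal_integral_eq_lintegral_ofReal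
    (sq_div_integrable hK B c ρ) (Eventually.of_forall fun y => div_nonneg (sq_nonneg _) (hh_nonneg B y))]
  simpa only [div_eq_mul_inv] using h1

theorem rho_zero_sq (hK : IsProperConvexCone K) {X : AffineTransitionFamily K φ ψ}
    (hF : ∀ u ∈ dualCone K, HasDerivWithinAt (fun t => φ t u) (F u) (Set.Ici (0 : ℝ)) 0)
    (hR : ∀ u ∈ dualCone K, HasDerivWithinAt (fun t => ψ t u) (R u) (Set.Ici (0 : ℝ)) 0)
    {B : Module.Basis (Fin n) ℝ V} (hB : ∀ i, B i ∈ sPos K)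
    {ρ : Measure V} (hρ : IsRho X B 0 ρ) (c : Fin n → ℝ) :
    ∫ y, (∑ i, c i * th B i y) ^ 2 / hh B y ∂ρ = ∑ i, ∑ j, c i * c j * AA F R B 0 i j := by
  have := hρ.fin
  have h0K : (0:V) ∈ K := cone_zero_mem hK
  refine le_antisymm (hρ.sq_le hK hF hR hB h0K c) ?_
  have hNL := (((NL_hh hK X hF hR B hB h0K).const_mul (∑ i, c i ^ 2)).sub hK h0K
    (NL_sq hK X hF hR B hB h0K c))
  set L := ∑ i, (2 * HH F R 0 (B i) - HH F R 0 ((2:ℝ) • B i))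
  have hmass : ∫ y, (1:ℝ) ∂ρ = L := hρ.eq_of_NL continuous_const ⟨1, by simp⟩
    (NL_hh hK X hF hR B hB h0K) (by simp)
  have hnn : ∀ y, 0 ≤ (∑ i, c i ^ 2) * hh B y - (∑ i, c i * th B i y) ^ 2 := fun y =>
    sub_nonneg.2 (sq_div_bdd hK B c y)
  have h1 := hρ.fatou hK h0K hNL (fun y _ => hnn y)
  have hA : 0 ≤ (∑ i, c i ^ 2) * L - ∑ i, ∑ j, c i * c j * AA F R B 0 i j := by
    refine ge_of_tendsto hNL.lim ?_
    filter_upwards with t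
    exact integral_nonneg hnn
  have hae : ∀ᵐ y ∂ρ, ((∑ i, c i ^ 2) * hh B y - (∑ i, c i * th B i y) ^ 2) * (hh B y)⁻¹ =
      (∑ i, c i ^ 2) * 1 - (∑ i, c i * th B i y) ^ 2 / hh B y := by
    have hz : ∀ᵐ y ∂ρ, y ≠ 0 := by
      rw [ae_iff]; simpa using rho_zero hK hF hR hB hρ
    filter_upwards [hz] with y hy
    have := (hh_pos B hy).ne'
    field_simp
  have hi : Integrable (fun y => (∑ i, c i ^ 2) * 1 - (∑ i, c i * th B i y) ^ 2 / hh B y) ρ :=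
    ((integrable_const _).const_mul _).sub (sq_div_integrable hK B c ρ)
  rw [lintegral_congr_ae (hae.mono fun y hy => congrArg ENNReal.ofReal hy),
    ← ofReal_integral_eq_lintegral_ofReal hi (by
      filter_upwards [hae] with y hy
      rw [← hy]
      exact mul_nonneg (hnn y) (inv_nonneg.2 (hh_nonneg B y))),
    ENNReal.ofReal_le_ofReal_iff hA,
    integral_sub ((integrable_const _).const_mul _) (sq_div_integrable hK B c ρ),
    integral_const_mul, hmass] at h1
  linarith

end FPart

section FPart2

set_option linter.unusedSectionVars false
set_option linter.unusedVariables false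

variable {K : Set V} {φ : ℝ → V → ℝ} {ψ : ℝ → V → V} {n : ℕ} {F : V → ℝ} {R : V → V}

theorem exists_dual_basis (B : Module.Basis (Fin n) ℝ V) :
    ∃ w : Fin n → V, ∀ i z, ⟪w i, z⟫ = B.repr z i :=
  ⟨fun i => (InnerProductSpace.toDual ℝ V).symm (LinearMap.toContinuousLinearMap (B.coord i)),
    fun i z => by simp⟩

/-- nonneg functions with a limit are integrable against `mm` -/
theorem IsRho.fatou_int (hK : IsProperConvexCone K) {X : AffineTransitionFamily K φ ψ}
    {B : Module.Basis (Fin n) ℝ V}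
    {x : V} (hx : x ∈ K) {ρ : Measure V} (hρ : IsRho X B x ρ) {g : V → ℝ} {a : ℝ}
    (hg : NL X x g a) (hpos : ∀ y ∈ shift K x, 0 ≤ g y) :
    Integrable (fun y => g y / hh B y) ρ ∧ ∫ y, g y / hh B y ∂ρ ≤ a := by
  have h1 := hρ.fatou hK hx hg hpos
  have hm : Measurable (fun y => g y / hh B y) := hg.cont.measurable.div (hh_cont B).measurable
  have hnn : 0 ≤ᵐ[ρ] fun y => g y / hh B y := by
    filter_upwards [hρ.supp] with y hy
    exact div_nonneg (hpos y hy) (hh_nonneg B y)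
  have ha : 0 ≤ a := by
    refine ge_of_tendsto hg.lim ?_
    filter_upwards [self_mem_nhdsWithin] with t ht
    refine integral_nonneg_of_ae ?_
    filter_upwards [nu_ae hK X ht hx] with y hy
    exact hpos y hy
  have hi : Integrable (fun y => g y / hh B y) ρ := by
    refine ⟨hm.aestronglyMeasurable, ?_⟩
    rw [hasFiniteIntegral_iff_ofReal hnn]
    refine lt_of_le_of_lt (le_trans (le_of_eq ?_) h1) ENNReal.ofReal_lt_top
    simp only [div_eq_mul_inv]
  refine ⟨hi, ?_⟩
  rw [← ENNReal.ofReal_le_ofReal_iff ha, ofReal_integral_eq_lintegral_ofReal hi hnn]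
  simpa only [div_eq_mul_inv] using h1

theorem min_le_one_sub_exp {ε s : ℝ} (hε : 0 < ε) {r : ℝ} (hr : 0 ≤ r) (h : ε * r ≤ s) :
    min ε 1 / 2 * min r 1 ≤ 1 - Real.exp (-s) := by
  have hp : 0 < min ε 1 := lt_min hε one_pos
  have h1 : min ε 1 * min r 1 ≤ s :=
    le_trans (mul_le_mul (min_le_left _ _) (min_le_left _ _) (le_min hr zero_le_one) hε.le) h
  have h2 : min ε 1 * min r 1 ≤ 1 :=
    mul_le_one₀ (min_le_right _ _) (le_min hr zero_le_one) (min_le_right _ _)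
  have h0 : 0 ≤ min ε 1 * min r 1 := mul_nonneg hp.le (le_min hr zero_le_one)
  set q := min ε 1 * min r 1 with hq
  have h3 : Real.exp (-s) ≤ Real.exp (-q) := Real.exp_le_exp.2 (by linarith)
  have h4 : Real.exp (-q) ≤ 1 - q / 2 := by
    rw [Real.exp_neg]
    rw [inv_le_comm₀ (Real.exp_pos _) (by linarith)]
    refine le_trans ?_ (Real.add_one_le_exp q)
    rw [inv_le_iff_one_le_mul₀ (by linarith)]
    nlinarith
  have : min ε 1 / 2 * min r 1 = q / 2 := by rw [hq]; ring
  linarith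

theorem F_part (hK : IsProperConvexCone K) (X : AffineTransitionFamily K φ ψ)
    (hF : ∀ u ∈ dualCone K, HasDerivWithinAt (fun t => φ t u) (F u) (Set.Ici (0 : ℝ)) 0)
    (hR : ∀ u ∈ dualCone K, HasDerivWithinAt (fun t => ψ t u) (R u) (Set.Ici (0 : ℝ)) 0)
    (B : Module.Basis (Fin n) ℝ V) (hB : ∀ i, B i ∈ sPos K) : Nonempty (FParams K F) := by
  have h0K : (0:V) ∈ K := cone_zero_mem hK
  obtain ⟨ρ, hρ⟩ := exists_rho hK X hF hR B hB h0K
  have hfin := hρ.fin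
  obtain ⟨w, hw⟩ := exists_dual_basis B
  have hHH : ∀ u, HH F R 0 u = F u - F 0 := fun u => by simp [HH, GG]
  let g : Fin n → ℝ := fun i => TT F R B 0 i - ∫ y, ta B i y / hh B y ∂ρ
  have hta : ∀ i, Integrable (fun y => ta B i y / hh B y) ρ := fun i =>
    (hρ.fatou_int hK h0K (NL_ta hK X hF hR B hB h0K i) (fun y hy => by
      rw [shift_zero] at hy; exact (ta_nonneg B hB i hy).2)).1
  have hexp : ∀ u ∈ dualCone K, Integrable (fun y => (1 - Real.exp (-⟪u, y⟫)) / hh B y) ρ ∧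
      ∫ y, (1 - Real.exp (-⟪u, y⟫)) / hh B y ∂ρ ≤ HH F R 0 u := fun u hu =>
    hρ.fatou_int hK h0K (NL_exp hK X hF hR h0K hu) (fun y hy => by
      rw [shift_zero] at hy
      have := dual_nonneg hu hy
      have := Real.exp_le_one_iff.2 (neg_nonpos.2 this)
      linarith)
  have hb : ∀ u, ⟪∑ i, g i • w i, u⟫ = ∑ i, B.repr u i * g i := fun u => by
    rw [sum_inner]
    refine Finset.sum_congr rfl fun i _ => ?_
    rw [real_inner_smul_left, hw]; ring
  have hmain : ∀ u ∈ dualCone K, HH F R 0 u = ⟪∑ i, g i • w i, u⟫ +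
      ∫ y, (1 - Real.exp (-⟪u, y⟫)) / hh B y ∂ρ := by
    intro u hu
    have h1 := hρ.kk_eq hK hF hR hB h0K hu
    rw [← rho_zero_sq hK hF hR hB hρ (B.repr u)] at h1
    have h2 : ∀ y, kk B u y / hh B y = -((1 - Real.exp (-⟪u, y⟫)) / hh B y) +
        ∑ i, B.repr u i * (ta B i y / hh B y) -
        1 / 2 * ((∑ i, B.repr u i * th B i y) ^ 2 / hh B y) := by
      intro y
      have : ∑ i, B.repr u i * (ta B i y / hh B y) = (∑ i, B.repr u i * ta B i y) / hh B y := by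
        rw [Finset.sum_div]
        exact Finset.sum_congr rfl fun i _ => by ring
      rw [this]; unfold kk; ring
    have i1 : Integrable (fun y => -((1 - Real.exp (-⟪u, y⟫)) / hh B y)) ρ := (hexp u hu).1.neg
    have i2 : Integrable (fun y => ∑ i, B.repr u i * (ta B i y / hh B y)) ρ :=
      integrable_finsetSum _ fun i _ => (hta i).const_mul _
    have i3 : Integrable (fun y => 1 / 2 * ((∑ i, B.repr u i * th B i y) ^ 2 / hh B y)) ρ :=
      (sq_div_integrable hK B (B.repr u) ρ).const_mul _
    have i12 : Integrable (fun y => -((1 - Real.exp (-⟪u, y⟫)) / hh B y) +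
      ∑ i, B.repr u i * (ta B i y / hh B y)) ρ := i1.add i2
    simp only [h2] at h1
    rw [integral_sub i12 i3, integral_add i1 i2, integral_neg, integral_const_mul,
      integral_finsetSum _ fun i _ => (hta i).const_mul _] at h1
    simp only [integral_const_mul] at h1
    rw [hb]
    have h3 : ∑ i, B.repr u i * g i = ∑ i, B.repr u i * TT F R B 0 i -
        ∑ i, B.repr u i * ∫ y, ta B i y / hh B y ∂ρ := by
      rw [← Finset.sum_sub_distrib]
      exact Finset.sum_congr rfl fun i _ => by simp only [g]; ring
    rw [h3]
    linarith
  refine ⟨{ b := ∑ i, g i • w i, b_mem := ?_, c := F 0, c_nonneg := ?_, m := mm B ρ, m_supp := ?_,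
            m_zero := mm_zero B ρ, m_int := ?_, eq := ?_ }⟩
  · refine bidual hK fun u hu => ?_
    have := hmain u hu
    have := (hexp u hu).2
    linarith
  · have := GG_zero_nonneg hK X hF hR h0K
    simpa [GG] using this
  · apply mm_supp
    have := hρ.supp
    rw [shift_zero] at this
    exact this
  · obtain ⟨u, hu⟩ := sPos_nonempty hK
    obtain ⟨ε, hε, hu'⟩ := id hu
    have hp : 0 < min ε 1 := lt_min hε one_pos
    rw [mm_lint B ρ (by fun_prop)]
    have hint := ((hexp u (sPos_subset hu)).1.const_mul (2 / min ε 1))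
    refine lt_of_le_of_lt (lintegral_mono_ae ?_) hint.lintegral_lt_top
    filter_upwards [hρ.supp] with y hy
    rw [shift_zero] at hy
    refine ENNReal.ofReal_le_ofReal ?_
    rw [← div_eq_mul_inv, ← mul_div_assoc]
    refine div_le_div_of_nonneg_right ?_ (hh_nonneg B y)
    have h1 := min_le_one_sub_exp hε (norm_nonneg y) (hu' y hy)
    rw [div_mul_eq_mul_div, le_div_iff₀ hp]
    linarith
  · intro u hu
    have h1 := hmain u hu
    rw [hHH] at h1
    rw [mm_integral]
    have h2 : ∫ y, (Real.exp (-⟪u, y⟫) - 1) / hh B y ∂ρ =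
      -∫ y, (1 - Real.exp (-⟪u, y⟫)) / hh B y ∂ρ := by
      rw [← integral_neg]
      refine integral_congr_ae (Eventually.of_forall fun y => ?_)
      simp only; ring
    rw [h2]
    linarith

end FPart2

section Sigma

set_option linter.unusedSectionVars false
set_option linter.unusedVariables false

variable {K : Set V} {φ : ℝ → V → ℝ} {ψ : ℝ → V → V} {n : ℕ} {F : V → ℝ} {R : V → V}

theorem meas_cancel {μ₁ μ₂ ν : Measure V} [IsFiniteMeasure ν] (h : μ₁ + ν = μ₂ + ν) : μ₁ = μ₂ := by
  ext A hA
  have := congrArg (fun μ : Measure V => μ A) h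
  simp only [Measure.add_apply] at this
  exact (ENNReal.add_left_inj (measure_ne_top ν A)).1 this

theorem HH_affine (x u : V) : HH F R x u = (F u - F 0) + ⟪R u - R 0, x⟫ := by
  unfold HH GG; rw [inner_sub_left]; ring

theorem shift_mono (hK : IsProperConvexCone K) {x y : V} (hy : y ∈ K) :
    shift K x ⊆ shift K (x + y) := by
  intro z (hz : z + x ∈ K)
  change z + (x + y) ∈ K
  rw [← add_assoc]
  exact cone_add_mem hK hz hy

theorem exists_sigma (hK : IsProperConvexCone K) (X : AffineTransitionFamily K φ ψ)
    (hF : ∀ u ∈ dualCone K, HasDerivWithinAt (fun t => φ t u) (F u) (Set.Ici (0 : ℝ)) 0)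
    (hR : ∀ u ∈ dualCone K, HasDerivWithinAt (fun t => ψ t u) (R u) (Set.Ici (0 : ℝ)) 0)
    (B : Module.Basis (Fin n) ℝ V) (hB : ∀ i, B i ∈ sPos K) :
    ∃ ρ0 : Measure V, IsRho X B 0 ρ0 ∧ ∃ σ : V → Measure V,
      (∀ x ∈ K, IsFiniteMeasure (σ x) ∧ IsRho X B x (σ x + ρ0) ∧ σ x Kᶜ = 0) ∧
      (∀ x ∈ K, ∀ y ∈ K, σ (x + y) = σ x + σ y) ∧
      (∀ c : ℝ, 0 ≤ c → ∀ x ∈ K, σ (c • x) = ENNReal.ofReal c • σ x) := by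
  have h0K : (0:V) ∈ K := cone_zero_mem hK
  have hex : ∀ x : V, ∃ ρ : Measure V, x ∈ K → IsRho X B x ρ := fun x => by
    by_cases hx : x ∈ K
    · obtain ⟨ρ, hρ⟩ := exists_rho hK X hF hR B hB hx
      exact ⟨ρ, fun _ => hρ⟩
    · exact ⟨0, fun h => absurd h hx⟩
  choose ρ hρ using hex
  have hfin0 : IsFiniteMeasure (ρ 0) := (hρ 0 h0K).fin
  have hexpi : ∀ x ∈ K, ∀ u ∈ dualCone K, Integrable (fun y => Real.exp (-⟪u, y⟫)) (ρ x) :=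
    fun x hx u hu => (hρ x hx).integrable (by fun_prop) (exp_bdd hu)
  have hadd : ∀ x ∈ K, ∀ y ∈ K, ρ x + ρ y = ρ (x + y) + ρ 0 := by
    intro x hx y hy
    have hxy := cone_add_mem hK hx hy
    have := (hρ x hx).fin
    have := (hρ y hy).fin
    have := (hρ _ hxy).fin
    refine lap_unique hK hB (w := x + y) ?_ ?_ fun u hu => ?_
    · rw [ae_add_measure_iff]
      refine ⟨(hρ x hx).supp.mono fun z hz => shift_mono hK hy hz, (hρ y hy).supp.mono fun z hz => ?_⟩
      rw [add_comm]; exact shift_mono hK hx hz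
    · rw [ae_add_measure_iff]
      refine ⟨(hρ _ hxy).supp, (hρ 0 h0K).supp.mono fun z hz => ?_⟩
      have := shift_mono hK hxy hz
      rwa [zero_add] at this
    · rw [integral_add_measure (hexpi x hx u hu) (hexpi y hy u hu),
        integral_add_measure (hexpi _ hxy u hu) (hexpi 0 h0K u hu),
        (hρ x hx).exp_eq hK hF hR hB hx hu, (hρ y hy).exp_eq hK hF hR hB hy hu,
        (hρ _ hxy).exp_eq hK hF hR hB hxy hu, (hρ 0 h0K).exp_eq hK hF hR hB h0K hu,
        ← Finset.sum_add_distrib, ← Finset.sum_add_distrib]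
      refine Finset.sum_congr rfl fun i _ => ?_
      simp only [HH_affine, inner_add_right, inner_zero_right]
      ring
  have hsmul : ∀ c : ℝ, 0 ≤ c → ∀ x ∈ K,
      ρ (c • x) + ENNReal.ofReal c • ρ 0 = ρ 0 + ENNReal.ofReal c • ρ x := by
    intro c hc x hx
    have hcx := hK.smul_mem c hc x hx
    have f1 := (hρ x hx).fin
    have f2 := (hρ _ hcx).fin
    have f3 : IsFiniteMeasure (ENNReal.ofReal c • ρ 0) := Measure.smul_finite _ ENNReal.ofReal_ne_top
    have f4 : IsFiniteMeasure (ENNReal.ofReal c • ρ x) := Measure.smul_finite _ ENNReal.ofReal_ne_top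
    have hs0 : ∀ᵐ z ∂(ρ 0), z ∈ shift K (x + c • x) := (hρ 0 h0K).supp.mono fun z hz => by
      have := shift_mono hK (cone_add_mem hK hx hcx) hz
      rwa [zero_add] at this
    refine lap_unique hK hB (w := x + c • x) ?_ ?_ fun u hu => ?_
    · rw [ae_add_measure_iff]
      refine ⟨(hρ _ hcx).supp.mono fun z hz => ?_, Measure.ae_smul_measure hs0 _⟩
      rw [add_comm]; exact shift_mono hK hx hz
    · rw [ae_add_measure_iff]
      exact ⟨hs0, Measure.ae_smul_measure
        ((hρ x hx).supp.mono fun z hz => shift_mono hK hcx hz) _⟩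
    · rw [integral_add_measure (hexpi _ hcx u hu)
          ((hexpi 0 h0K u hu).smul_measure ENNReal.ofReal_ne_top),
        integral_add_measure (hexpi 0 h0K u hu)
          ((hexpi x hx u hu).smul_measure ENNReal.ofReal_ne_top),
        integral_smul_measure, integral_smul_measure,
        (hρ x hx).exp_eq hK hF hR hB hx hu,
        (hρ _ hcx).exp_eq hK hF hR hB hcx hu, (hρ 0 h0K).exp_eq hK hF hR hB h0K hu,
        ENNReal.toReal_ofReal hc, smul_eq_mul, smul_eq_mul, Finset.mul_sum, Finset.mul_sum,
        ← Finset.sum_add_distrib, ← Finset.sum_add_distrib]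
      refine Finset.sum_congr rfl fun i _ => ?_
      simp only [HH_affine, inner_smul_right, inner_zero_right]
      ring
  have hle : ∀ x ∈ K, ρ 0 ≤ ρ x := by
    intro x hx
    have f1 := (hρ x hx).fin
    refine Measure.le_iff.2 fun A hA => ?_
    have h1 : 0 ≤ (ρ x).real A - (ρ 0).real A := by
      refine nonneg_of_nat (a := (ρ 0).real A) fun k => ?_
      have f2 := (hρ _ (hK.smul_mem (k:ℝ) k.cast_nonneg x hx)).fin
      have h2 := congrArg (fun μ : Measure V => (μ A).toReal) (hsmul k k.cast_nonneg x hx)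
      simp only [Measure.add_apply, Measure.smul_apply, smul_eq_mul] at h2
      rw [ENNReal.toReal_add (measure_ne_top _ _)
          (ENNReal.mul_ne_top ENNReal.ofReal_ne_top (measure_ne_top _ _)),
        ENNReal.toReal_add (measure_ne_top _ _)
          (ENNReal.mul_ne_top ENNReal.ofReal_ne_top (measure_ne_top _ _)),
        ENNReal.toReal_mul, ENNReal.toReal_mul, ENNReal.toReal_ofReal k.cast_nonneg] at h2
      have h3 : 0 ≤ (ρ ((k:ℝ) • x) A).toReal := ENNReal.toReal_nonneg
      change 0 ≤ (ρ 0 A).toReal + k * ((ρ x A).toReal - (ρ 0 A).toReal)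
      linarith
    rw [← ENNReal.toReal_le_toReal (measure_ne_top _ _) (measure_ne_top _ _)]
    exact sub_nonneg.1 h1
  let σ : V → Measure V := fun x => ρ x - ρ 0
  have hσ : ∀ x ∈ K, σ x + ρ 0 = ρ x := fun x hx => Measure.sub_add_cancel_of_le (hle x hx)
  have hσle : ∀ x, σ x ≤ ρ x := fun x => Measure.sub_le
  have hσfin : ∀ x ∈ K, IsFiniteMeasure (σ x) := fun x hx => by
    have := (hρ x hx).fin
    exact isFiniteMeasure_of_le _ (hσle x)
  have hσadd : ∀ x ∈ K, ∀ y ∈ K, σ (x + y) = σ x + σ y := by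
    intro x hx y hy
    have h1 := hadd x hx y hy
    rw [← hσ x hx, ← hσ y hy, ← hσ _ (cone_add_mem hK hx hy)] at h1
    have h2 : σ (x + y) + (ρ 0 + ρ 0) = (σ x + σ y) + (ρ 0 + ρ 0) := by
      rw [← add_assoc, ← h1]; abel
    exact meas_cancel h2
  have hσsmul : ∀ c : ℝ, 0 ≤ c → ∀ x ∈ K, σ (c • x) = ENNReal.ofReal c • σ x := by
    intro c hc x hx
    have f3 : IsFiniteMeasure (ENNReal.ofReal c • ρ 0) := Measure.smul_finite _ ENNReal.ofReal_ne_top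
    have h1 := hsmul c hc x hx
    rw [← hσ x hx, ← hσ _ (hK.smul_mem c hc x hx), smul_add] at h1
    have h2 : σ (c • x) + (ρ 0 + ENNReal.ofReal c • ρ 0) =
        ENNReal.ofReal c • σ x + (ρ 0 + ENNReal.ofReal c • ρ 0) := by
      rw [← add_assoc, h1]; abel
    exact meas_cancel h2
  refine ⟨ρ 0, hρ 0 h0K, σ, fun x hx => ⟨hσfin x hx, by rw [hσ x hx]; exact hρ x hx, ?_⟩, hσadd, hσsmul⟩
  have hsub : Kᶜ ⊆ ⋃ k : ℕ, (shift K ((1 / ((k:ℝ) + 1)) • x))ᶜ := by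
    intro y hy
    by_contra hcon
    simp only [mem_iUnion, not_exists, mem_compl_iff, not_not] at hcon
    apply hy
    have hlim : Tendsto (fun k : ℕ => y + (1 / ((k:ℝ) + 1)) • x) atTop (𝓝 (y + (0:ℝ) • x)) :=
      (tendsto_one_div_add_atTop_nhds_zero_nat.smul_const x).const_add y
    rw [zero_smul, add_zero] at hlim
    exact hK.isClosed.mem_of_tendsto hlim (Eventually.of_forall hcon)
  refine measure_mono_null hsub (measure_iUnion_null fun k => ?_)
  have hk : (0:ℝ) < 1 / ((k:ℝ) + 1) := by positivity
  have h1 : σ ((1 / ((k:ℝ) + 1)) • x) (shift K ((1 / ((k:ℝ) + 1)) • x))ᶜ = 0 :=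
    le_antisymm ((hσle _ _).trans (le_of_eq (hρ _ (hK.smul_mem _ hk.le x hx)).supp)) zero_le
  rw [hσsmul _ hk.le x hx, Measure.smul_apply, smul_eq_mul, mul_eq_zero] at h1
  rcases h1 with h1 | h1
  · rw [ENNReal.ofReal_eq_zero] at h1; linarith
  · exact h1

end Sigma

section RPart

set_option linter.unusedSectionVars false
set_option linter.unusedVariables false

variable {K : Set V} {φ : ℝ → V → ℝ} {ψ : ℝ → V → V} {n : ℕ} {F : V → ℝ} {R : V → V}

theorem cone_ext (hK : IsProperConvexCone K) {f : V → ℝ}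
    (hadd : ∀ x ∈ K, ∀ y ∈ K, f (x + y) = f x + f y)
    (hsm : ∀ c : ℝ, 0 ≤ c → ∀ x ∈ K, f (c • x) = c * f x) : ∃ w : V, ∀ x ∈ K, ⟪w, x⟫ = f x := by
  choose p hp q hq hpq using hK.generating
  have key : ∀ v, ∀ x ∈ K, ∀ y ∈ K, v = x - y → f (p v) - f (q v) = f x - f y := by
    intro v x hx y hy hv
    have h1 : p v + y = x + q v := by
      have := hpq v
      rw [hv] at this ⊢
      have h2 := congrArg (fun z => z + y + q (x - y)) this
      simp only [sub_add_cancel] at h2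
      rw [h2]; abel
    have h2 := hadd _ (hp v) _ hy
    have h3 := hadd _ hx _ (hq v)
    rw [h1] at h2
    linarith
  let g : V →ₗ[ℝ] ℝ :=
    { toFun := fun v => f (p v) - f (q v)
      map_add' := fun v v' => by
        rw [key (v + v') (p v + p v') (cone_add_mem hK (hp v) (hp v')) (q v + q v')
          (cone_add_mem hK (hq v) (hq v')) (by
            nth_rewrite 1 [hpq v, hpq v']; abel),
          hadd _ (hp v) _ (hp v'), hadd _ (hq v) _ (hq v')]
        ring
      map_smul' := fun c v => by
        simp only [RingHom.id_apply, smul_eq_mul]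
        rcases le_total 0 c with hc | hc
        · rw [key (c • v) (c • p v) (hK.smul_mem c hc _ (hp v)) (c • q v)
            (hK.smul_mem c hc _ (hq v)) (by nth_rewrite 1 [hpq v]; rw [smul_sub]),
            hsm c hc _ (hp v), hsm c hc _ (hq v)]
          ring
        · have hc' : 0 ≤ -c := by linarith
          rw [key (c • v) ((-c) • q v) (hK.smul_mem _ hc' _ (hq v)) ((-c) • p v)
            (hK.smul_mem _ hc' _ (hp v)) (by
              nth_rewrite 1 [hpq v]; rw [smul_sub, neg_smul, neg_smul]; abel),
            hsm _ hc' _ (hp v), hsm _ hc' _ (hq v)]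
          ring }
  refine ⟨(InnerProductSpace.toDual ℝ V).symm (LinearMap.toContinuousLinearMap g), fun x hx => ?_⟩
  have h0 : f 0 = 0 := by
    have := hsm 0 le_rfl _ hx
    simpa using this
  have h1 : g x = f x - f 0 := key x x hx 0 (cone_zero_mem hK) (by simp)
  rw [InnerProductSpace.toDual_symm_apply]
  simpa [h0] using h1

theorem sigma_ext (hK : IsProperConvexCone K) {B : Module.Basis (Fin n) ℝ V} {σ : V → Measure V}
    (hadd : ∀ x ∈ K, ∀ y ∈ K, σ (x + y) = σ x + σ y)
    (hsm : ∀ c : ℝ, 0 ≤ c → ∀ x ∈ K, σ (c • x) = ENNReal.ofReal c • σ x) {g : V → ℝ}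
    (hg : ∀ x ∈ K, Integrable g (σ x)) : ∃ w : V, ∀ x ∈ K, ⟪w, x⟫ = ∫ y, g y ∂(σ x) := by
  refine cone_ext hK (f := fun x => ∫ y, g y ∂(σ x)) (fun x hx y hy => ?_) fun c hc x hx => ?_
  · rw [hadd x hx y hy, integral_add_measure (hg x hx) (hg y hy)]
  · rw [hsm c hc x hx, integral_smul_measure, ENNReal.toReal_ofReal hc, smul_eq_mul]

theorem div_int (hK : IsProperConvexCone K) {B : Module.Basis (Fin n) ℝ V}
    (hB : ∀ i, B i ∈ sPos K) {σ : Measure V} [IsFiniteMeasure σ] (hσ : σ Kᶜ = 0)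
    {g : V → ℝ} (hc : Continuous g) (h1 : Bdd (shift K 0) g) (h2 : g =O[𝓝 0] fun y => ‖y‖ ^ 2) :
    Integrable (fun y => g y / hh B y) σ := by
  have hs : ∀ᵐ y ∂σ, y ∈ shift K 0 := by rw [shift_zero]; exact hσ
  exact bdd_integrable hs (hc.measurable.div (hh_cont B).measurable).aestronglyMeasurable
    (div_hh_bdd hK B hB 0 h1 h2)

theorem R_part (hK : IsProperConvexCone K) (X : AffineTransitionFamily K φ ψ)
    (hF : ∀ u ∈ dualCone K, HasDerivWithinAt (fun t => φ t u) (F u) (Set.Ici (0 : ℝ)) 0)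
    (hR : ∀ u ∈ dualCone K, HasDerivWithinAt (fun t => ψ t u) (R u) (Set.Ici (0 : ℝ)) 0)
    (B : Module.Basis (Fin n) ℝ V) (hB : ∀ i, B i ∈ sPos K) {χ : V → V} (hχ : IsTruncation χ) :
    Nonempty (RParams K χ R) := by
  have h0K : (0:V) ∈ K := cone_zero_mem hK
  obtain ⟨ρ0, hρ0, σ, hσ, hadd, hsm⟩ := exists_sigma hK X hF hR B hB
  have hfin0 := hρ0.fin
  have hfin : ∀ x ∈ K, IsFiniteMeasure (σ x) := fun x hx => (hσ x hx).1
  have hthth_i : ∀ i j, ∀ x ∈ K, Integrable (fun y => th B i y * th B j y / hh B y) (σ x) :=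
    fun i j x hx => by
      have := hfin x hx
      have hNL := NL_thth hK X hF hR B hB h0K i j
      exact div_int hK hB (hσ x hx).2.2 hNL.cont hNL.bdd (thth_isBigO B i j)
  have hchi_i : ∀ i, ∀ x ∈ K, Integrable (fun y => (⟪χ y, B i⟫ - ta B i y) / hh B y) (σ x) :=
    fun i x hx => by
      have := hfin x hx
      have hNL := NL_ta hK X hF hR B hB h0K i
      have hc := hχ.1
      have htc := hNL.cont
      exact div_int hK hB (hσ x hx).2.2 (by fun_prop) ((chi_bdd hχ (B i)).sub hNL.bdd)
        (chi_sub_isLittleO B hχ i).isBigO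
  choose w hw using fun i j => sigma_ext hK (B := B) hadd hsm (hthth_i i j)
  choose w' hw' using fun i => sigma_ext hK (B := B) hadd hsm (hchi_i i)
  let D : V → V := fun u => R u - R 0
  let a : Fin n → Fin n → V := fun i j => D (B i) + D (B j) - D (B i + B j)
  let q : Fin n → Fin n → V := fun i j => a i j - w i j
  let bv : Fin n → V := fun i => (2:ℝ) • D (B i) - (1/2:ℝ) • D ((2:ℝ) • B i) + w' i
  have hAA : ∀ x i j, AA F R B x i j = AA F R B 0 i j + ⟪a i j, x⟫ := fun x i j => by
    simp only [AA, HH_affine, inner_zero_right, a, D, inner_sub_left, inner_add_left]; ring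
  have hTT : ∀ x i, TT F R B x i = TT F R B 0 i +
      ⟪(2:ℝ) • D (B i) - (1/2:ℝ) • D ((2:ℝ) • B i), x⟫ := fun x i => by
    simp only [TT, HH_affine, inner_zero_right, D, inner_sub_left, real_inner_smul_left]; ring
  have hwsymm : ∀ i j, w i j = w j i := fun i j => inner_ext_cone hK fun x hx => by
    rw [hw i j x hx, hw j i x hx]
    simp only [mul_comm (th B i _)]
  have hqsymm : ∀ i j, q i j = q j i := fun i j => by
    simp only [q, a]
    rw [hwsymm, add_comm (B i), add_comm (D (B i))]
  let Q : V →ₗ[ℝ] V →ₗ[ℝ] V := LinearMap.mk₂ ℝ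
    (fun u v => ∑ i, ∑ j, (B.repr u i * B.repr v j) • q i j)
    (fun u u' v => by simp only [map_add, Finsupp.add_apply, add_mul, add_smul, Finset.sum_add_distrib])
    (fun c u v => by
      simp only [map_smul, Finsupp.smul_apply, smul_eq_mul, mul_smul, Finset.smul_sum])
    (fun u v v' => by
      simp only [map_add, Finsupp.add_apply, mul_add, add_smul, Finset.sum_add_distrib])
    (fun c u v => by
      simp only [map_smul, Finsupp.smul_apply, smul_eq_mul, Finset.smul_sum, smul_smul]
      exact Finset.sum_congr rfl fun i _ => Finset.sum_congr rfl fun j _ => by congr 1; ring)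
  have hQ : ∀ u v, Q u v = ∑ i, ∑ j, (B.repr u i * B.repr v j) • q i j := fun u v => rfl
  let BT : V →ₗ[ℝ] V :=
    { toFun := fun u => ∑ i, B.repr u i • bv i
      map_add' := fun u v => by
        simp only [map_add, Finsupp.add_apply, add_smul, Finset.sum_add_distrib]
      map_smul' := fun c u => by
        simp only [map_smul, Finsupp.smul_apply, smul_eq_mul, mul_smul, Finset.smul_sum,
          RingHom.id_apply] }
  have hBT : ∀ u, BT u = ∑ i, B.repr u i • bv i := fun u => rfl
  have hQin : ∀ v x, ⟪Q v v, x⟫ = ∑ i, ∑ j, B.repr v i * B.repr v j * ⟪a i j, x⟫ -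
      ∑ i, ∑ j, B.repr v i * B.repr v j * ⟪w i j, x⟫ := fun v x => by
    rw [hQ, sum_inner, ← Finset.sum_sub_distrib]
    refine Finset.sum_congr rfl fun i _ => ?_
    rw [sum_inner, ← Finset.sum_sub_distrib]
    refine Finset.sum_congr rfl fun j _ => ?_
    rw [real_inner_smul_left, inner_sub_left]; ring
  have hsqint : ∀ (c : Fin n → ℝ), ∀ x ∈ K, ∫ y, (∑ i, c i * th B i y) ^ 2 / hh B y ∂(σ x) =
      ∑ i, ∑ j, c i * c j * ⟪w i j, x⟫ := by
    intro c x hx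
    have h1 : ∀ y, (∑ i, c i * th B i y) ^ 2 / hh B y =
        ∑ i, ∑ j, c i * c j * (th B i y * th B j y / hh B y) := fun y => by
      rw [sq_sum, Finset.sum_div]
      refine Finset.sum_congr rfl fun i _ => ?_
      rw [Finset.sum_div]
      exact Finset.sum_congr rfl fun j _ => by ring
    simp only [h1]
    rw [integral_finsetSum _ fun i _ => integrable_finsetSum _ fun j _ =>
      (hthth_i i j x hx).const_mul _]
    refine Finset.sum_congr rfl fun i _ => ?_
    rw [integral_finsetSum _ fun j _ => (hthth_i i j x hx).const_mul _]
    refine Finset.sum_congr rfl fun j _ => ?_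
    rw [integral_const_mul, hw i j x hx]
  refine ⟨{ Q := Q, Q_symm := ?_, Q_pos := ?_, B := BT, γ := R 0, γ_mem := ?_,
            M := fun x => mm B (σ x), M_sigma := ?_, M_add := ?_, M_smul := ?_, M_supp := ?_,
            M_zero := fun x _ => mm_zero B (σ x), M_int := ?_, eq := ?_ }⟩
  · intro u v
    rw [hQ, hQ, Finset.sum_comm]
    refine Finset.sum_congr rfl fun i _ => Finset.sum_congr rfl fun j _ => ?_
    rw [hqsymm, mul_comm]
  · intro v x hx
    rw [real_inner_comm, hQin]
    refine nonneg_of_nat (a := ∑ i, ∑ j, B.repr v i * B.repr v j * AA F R B 0 i j) fun k => ?_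
    have hk : (0:ℝ) ≤ k := k.cast_nonneg
    have hkx := hK.smul_mem (k:ℝ) hk x hx
    have f1 := hfin _ hkx
    have h1 := (hσ _ hkx).2.1.sq_le hK hF hR hB hkx (B.repr v)
    rw [integral_add_measure (sq_div_integrable hK B _ _) (sq_div_integrable hK B _ _),
      hsqint _ _ hkx] at h1
    have h2 : 0 ≤ ∫ y, (∑ i, B.repr v i * th B i y) ^ 2 / hh B y ∂ρ0 :=
      integral_nonneg fun y => div_nonneg (sq_nonneg _) (hh_nonneg B y)
    simp only [hAA ((k:ℝ) • x), mul_add, Finset.sum_add_distrib, real_inner_smul_right] at h1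
    simp only [mul_left_comm _ (k:ℝ), ← Finset.mul_sum] at h1
    linarith
  · intro x hx
    rw [real_inner_comm]
    refine nonneg_of_nat (a := F 0) fun k => ?_
    have := GG_zero_nonneg hK X hF hR (hK.smul_mem (k:ℝ) k.cast_nonneg x hx)
    simpa [GG, real_inner_smul_right] using this
  · intro x hx
    have := hfin x hx
    exact mm_sigma B (σ x)
  · intro x hx y hy
    simp only [mm]
    rw [hadd x hx y hy, withDensity_add_measure]
  · intro c hc x hx
    simp only [mm]
    rw [hsm c hc x hx, withDensity_smul_measure]
  · intro x hx
    exact mm_supp B (hσ x hx).2.2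
  · intro x hx
    have := hfin x hx
    obtain ⟨C, hC, hC'⟩ := min_le_hh hK B hB 0
    rw [mm_lint B (σ x) (by fun_prop)]
    have hs : ∀ᵐ y ∂(σ x), y ∈ K := (hσ x hx).2.2
    refine lt_of_le_of_lt (lintegral_mono_ae (g := fun _ => ENNReal.ofReal C) ?_) ?_
    · filter_upwards [hs] with y hy
      refine ENNReal.ofReal_le_ofReal ?_
      by_cases h0 : hh B y = 0
      · rw [h0]; simpa using hC
      · rw [← div_eq_mul_inv, div_le_iff₀ (lt_of_le_of_ne (hh_nonneg B y) (Ne.symm h0))]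
        exact hC' y (by rw [shift_zero]; exact hy)
    · rw [lintegral_const]
      exact ENNReal.mul_lt_top ENNReal.ofReal_lt_top (measure_lt_top _ _)
  · intro u hu x hx
    have f1 := hfin x hx
    have hkc := div_hh_cont B (kk_cont B u) (kk_isLittleO B u)
    have hkb : ∀ z ∈ K, Bdd (shift K z) (fun y => kk B u y / hh B y) := fun z hz =>
      div_hh_bdd hK B hB z (NL_kk hK X hF hR B hB hz hu).bdd (kk_isLittleO B u).isBigO
    have hi := (hσ x hx).2.1.integrable hkc (hkb x hx)
    have h1 := (hσ x hx).2.1.kk_eq hK hF hR hB hx hu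
    have h2 := hρ0.kk_eq hK hF hR hB h0K hu
    rw [integral_add_measure hi.left_of_add_measure hi.right_of_add_measure, h2] at h1
    have i1 : Integrable (fun y => kk B u y / hh B y) (σ x) := hi.left_of_add_measure
    rw [mm_integral]
    have h3 : ∀ y, (Real.exp (-⟪u, y⟫) - 1 + ⟪χ y, u⟫) / hh B y = kk B u y / hh B y +
        ∑ i, B.repr u i * ((⟪χ y, B i⟫ - ta B i y) / hh B y) +
        1 / 2 * ((∑ i, B.repr u i * th B i y) ^ 2 / hh B y) := by
      intro y
      have e1 : ∑ i, B.repr u i * ((⟪χ y, B i⟫ - ta B i y) / hh B y) =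
          (∑ i, B.repr u i * ⟪B i, χ y⟫ - ∑ i, B.repr u i * ta B i y) / hh B y := by
        rw [← Finset.sum_sub_distrib, Finset.sum_div]
        exact Finset.sum_congr rfl fun i _ => by rw [real_inner_comm]; ring
      rw [e1, ← basis_inner B, real_inner_comm u]
      unfold kk; ring
    have i2 : Integrable (fun y => ∑ i, B.repr u i * ((⟪χ y, B i⟫ - ta B i y) / hh B y)) (σ x) :=
      integrable_finsetSum _ fun i _ => (hchi_i i x hx).const_mul _
    have i3 : Integrable (fun y => 1 / 2 * ((∑ i, B.repr u i * th B i y) ^ 2 / hh B y)) (σ x) :=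
      (sq_div_integrable hK B (B.repr u) (σ x)).const_mul _
    have i12 : Integrable (fun y => kk B u y / hh B y +
        ∑ i, B.repr u i * ((⟪χ y, B i⟫ - ta B i y) / hh B y)) (σ x) := i1.add i2
    simp only [h3]
    rw [integral_add i12 i3, integral_add i1 i2, integral_const_mul, hsqint _ x hx,
      integral_finsetSum _ fun i _ => (hchi_i i x hx).const_mul _]
    simp only [integral_const_mul, ← hw' _ x hx]
    simp only [hTT x, hAA x, HH_affine x u, HH_affine 0 u, inner_zero_right, mul_add,
      Finset.sum_add_distrib] at h1
    have h4 : ⟪BT u, x⟫ = ∑ i, B.repr u i * ⟪(2:ℝ) • D (B i) - (1/2:ℝ) • D ((2:ℝ) • B i), x⟫ +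
        ∑ i, B.repr u i * ⟪w' i, x⟫ := by
      rw [hBT, sum_inner, ← Finset.sum_add_distrib]
      refine Finset.sum_congr rfl fun i _ => ?_
      rw [real_inner_smul_left, ← mul_add, ← inner_add_left]
    rw [h4, hQin]
    rw [inner_sub_left] at h1
    linarith

end RPart

/-- For an affine family of transition kernels on `K` whose associated
functions `φ` and `ψ` admit time-derivatives `F` and `R` at `t = 0`, the function
`F` is of form (F) and, relative to any truncation function `χ`, the function `R`
is of form (R). -/
theorem F_R_LevyKhintchine_form
    {V : Type*} [NormedAddCommGroup V] [InnerProductSpace ℝ V] [FiniteDimensional ℝ V]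
    [MeasurableSpace V] [BorelSpace V]
    (K : Set V) (hK : IsProperConvexCone K)
    (φ : ℝ → V → ℝ) (ψ : ℝ → V → V)
    (X : AffineTransitionFamily K φ ψ)
    (χ : V → V) (hχ : IsTruncation χ)
    (F : V → ℝ) (R : V → V)
    (hF : ∀ u ∈ dualCone K, HasDerivWithinAt (fun t => φ t u) (F u) (Set.Ici (0 : ℝ)) 0)
    (hR : ∀ u ∈ dualCone K, HasDerivWithinAt (fun t => ψ t u) (R u) (Set.Ici (0 : ℝ)) 0) :
    Nonempty (FParams K F) ∧ Nonempty (RParams K χ R) := by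
  obtain ⟨n, B, hB⟩ := exists_basis_sPos hK
  exact ⟨F_part hK X hF hR B hB, R_part hK X hF hR B hB hχ⟩
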